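/- Suppose 0 < 1/n ≪ 1/M ≪ 1/r, ε ≪ d ≪ ν, 1/Δ < 1. Let G be a graph with a vertex partition U ∪ V, let {U_{s,i} : (s,i) ∈ [r] × [2]} be a partition of U and {V_{s,i} : (s,i) ∈ [r] × [2]} be a partition of V. Let 𝒯 be a collection of trees, each on at most 2(1−ν)rn vertices and with maximum degree at most Δ. Assume: (A1) for each s ∈ [r], each of the four bipartite graphs G[V_{s,1}, V_{s,2}], G[U_{s,1}, U_{s,2}], G[U_{s,1}, V_{s,2}], G[V_{s,1}, U_{s,2}] is (ε, d)-super-regular, with |V_{s,1}| = |V_{s,2}| = n and |U_{s,1}|, |U_{s,2}| ≥ εn; (A2) ᾶ(G[U]) ≤ M^{−6}n; (A3) e(𝒯) ≤ (1−ν)·r·d·n². Then there exists a map φ packing 𝒯 into G such that every vertex u ∈ U satisfies d_{φ(𝒯)}(u) ≤ ΔM, where φ(𝒯) denotes the subgraph of G consisting of all edges used by the packing. -/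

import Mathlib

open SimpleGraph

namespace ApproxDecomp

/-- The number of (ordered) edges of `G` from `A` to `B`; for disjoint `A`, `B`
this is the number of edges with one endpoint in each. -/
noncomputable def eBetween {V : Type*} (G : SimpleGraph V) (A B : Set V) : ℕ :=
  {p : V × V | p.1 ∈ A ∧ p.2 ∈ B ∧ G.Adj p.1 p.2}.ncard

/-- The number of neighbours of `v` inside `B`. -/
noncomputable def degIn {V : Type*} (G : SimpleGraph V) (v : V) (B : Finset V) : ℕ :=
  ((B : Set V) ∩ G.neighborSet v).ncard

/-- The pair `(A,B)` is `(ε,d)`-regular in `G`. -/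
def IsRegularPair {V : Type*} (G : SimpleGraph V) (A B : Finset V) (ε d : ℝ) : Prop :=
  ∀ A' ⊆ A, ∀ B' ⊆ B, ε * A.card ≤ (A'.card : ℝ) → ε * B.card ≤ (B'.card : ℝ) →
    |(eBetween G ↑A' ↑B' : ℝ) / (A'.card * B'.card) - d| < ε

/-- The pair `(A,B)` is `(ε,d)`-super-regular in `G`. -/
def IsSuperRegularPair {V : Type*} (G : SimpleGraph V) (A B : Finset V) (ε d : ℝ) : Prop :=
  IsRegularPair G A B ε d ∧
  (∀ a ∈ A, (d - ε) * B.card ≤ (degIn G a B : ℝ) ∧ (degIn G a B : ℝ) ≤ (d + ε) * B.card) ∧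
  (∀ b ∈ B, (d - ε) * A.card ≤ (degIn G b A : ℝ) ∧ (degIn G b A : ℝ) ≤ (d + ε) * A.card)

/-- `G` is a bipartite graph with vertex partition `(A, B)`. -/
def IsBipartiteWith {V : Type*} (G : SimpleGraph V) (A B : Finset V) : Prop :=
  Disjoint A B ∧ (∀ v : V, v ∈ A ∨ v ∈ B) ∧
  (∀ u v : V, G.Adj u v → (u ∈ A ∧ v ∈ B) ∨ (u ∈ B ∧ v ∈ A))

/-- The degree of a vertex, as the cardinality of its neighbour set. -/
noncomputable def deg {V : Type*} (G : SimpleGraph V) (v : V) : ℕ :=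
  (G.neighborSet v).ncard

/-- An `(s,t)`-bipartite hole: two disjoint vertex sets of sizes `s`, `t`
with no edges between them. -/
def HasBipartiteHole {V : Type*} (G : SimpleGraph V) (s t : ℕ) : Prop :=
  ∃ S T : Finset V, Disjoint S T ∧ S.card = s ∧ T.card = t ∧
    ∀ a ∈ S, ∀ b ∈ T, ¬ G.Adj a b

/-- The bi-independence number: the largest `r` such that `G` has an
`(s,t)`-bipartite hole for every `s + t = r`. -/
noncomputable def biIndep {V : Type*} (G : SimpleGraph V) : ℕ :=
  sSup {r : ℕ | ∀ s t : ℕ, s + t = r → HasBipartiteHole G s t}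

end ApproxDecomp

namespace ApproxDecomp
section
open scoped Classical

/-- greedy list colouring -/
lemma greedy_list {α β : Type*} [Fintype α] [Nonempty β] (conf : α → α → Prop)
    (hsymm : ∀ x y, conf x y → conf y x) (L : α → Finset β)
    (h : ∀ x, (Finset.univ.filter fun y => conf x y ∧ y ≠ x).card < (L x).card) :
    ∃ f : α → β, (∀ x, f x ∈ L x) ∧ ∀ x y, x ≠ y → conf x y → f x ≠ f y := by
  have key : ∀ S : Finset α, ∃ f : α → β, (∀ x ∈ S, f x ∈ L x) ∧
      ∀ x ∈ S, ∀ y ∈ S, x ≠ y → conf x y → f x ≠ f y := by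
    intro S
    induction S using Finset.induction_on with
    | empty => exact ⟨fun _ => Classical.arbitrary β, by simp, by simp⟩
    | insert a S ha ih =>
      obtain ⟨f, hf1, hf2⟩ := ih
      have : ∃ b ∈ L a, b ∉ (Finset.univ.filter fun y => conf a y ∧ y ≠ a).image f := by
        by_contra hcon
        push Not at hcon
        have h1 := Finset.card_le_card (show L a ⊆ _ from fun b hb => hcon b hb)
        have h2 := Finset.card_image_le (s := Finset.univ.filter fun y => conf a y ∧ y ≠ a) (f := f)
        have := h a
        omega
      obtain ⟨b, hb, hb'⟩ := this
      have hne : ∀ x ∈ S, x ≠ a := fun x hx e => ha (e ▸ hx)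
      refine ⟨Function.update f a b, ?_, ?_⟩
      · intro x hx
        rcases Finset.mem_insert.1 hx with rfl | hx
        · simpa using hb
        · simpa [Function.update_of_ne (hne x hx)] using hf1 x hx
      · intro x hx y hy hxy hc
        rcases Finset.mem_insert.1 hx with hx' | hx' <;> rcases Finset.mem_insert.1 hy with hy' | hy'
        · exact absurd (hx'.trans hy'.symm) hxy
        · subst hx'
          rw [Function.update_self, Function.update_of_ne (hne y hy')]
          intro e
          exact hb' (Finset.mem_image.2 ⟨y, by simp [hc, Ne.symm hxy], e.symm⟩)
        · subst hy'
          rw [Function.update_self, Function.update_of_ne (hne x hx')]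
          intro e
          exact hb' (Finset.mem_image.2 ⟨x, by simp [hsymm _ _ hc, hxy], e⟩)
        · rw [Function.update_of_ne (hne y hy'), Function.update_of_ne (hne x hx')]
          exact hf2 x hx' y hy' hxy hc
  obtain ⟨f, h1, h2⟩ := key Finset.univ
  exact ⟨f, fun x => h1 x (Finset.mem_univ _), fun x y => h2 x (Finset.mem_univ _) y (Finset.mem_univ _)⟩

/-- a finset of size at most `k` injects into `Fin k` -/
lemma exists_injOn_fin {α : Type*} (S : Finset α) (k : ℕ) (hk : 0 < k) (h : S.card ≤ k) :
    ∃ f : α → Fin k, Set.InjOn f S := by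
  have : Nonempty (Fin k) := ⟨⟨0, hk⟩⟩
  obtain ⟨e⟩ : Nonempty (S ↪ Fin k) := by
    apply Function.Embedding.nonempty_of_card_le; simpa using h
  refine ⟨fun a => if ha : a ∈ S then e ⟨a, ha⟩ else Classical.arbitrary _, ?_⟩
  intro a ha b hb hab
  simp only [Finset.mem_coe] at ha hb
  simp only [ha, hb, dif_pos] at hab
  simpa using e.injective hab

/-- split a finset in groups of size at most `c` -/
lemma exists_groups {α : Type*} (S : Finset α) (c : ℕ) (hc : 0 < c) :
    ∃ j : α → ℕ, (∀ m, (S.filter fun a => j a = m).card ≤ c) ∧ ∀ a ∈ S, j a < S.card / c + 1 := by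
  let e := S.equivFin
  refine ⟨fun a => if ha : a ∈ S then (e ⟨a, ha⟩ : ℕ) / c else 0, ?_, ?_⟩
  · intro m
    have : ((S.filter fun a => (if ha : a ∈ S then (e ⟨a, ha⟩ : ℕ) / c else 0) = m)).card
        ≤ (Finset.Ico (m * c) (m * c + c)).card := by
      apply Finset.card_le_card_of_injOn (fun a => if ha : a ∈ S then (e ⟨a, ha⟩ : ℕ) else 0)
      · intro a ha
        simp only [Finset.coe_filter, Set.mem_ofPred_eq] at ha
        obtain ⟨ha, hm⟩ := ha
        simp only [ha, dif_pos] at hm ⊢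
        simp only [Finset.coe_Ico, Set.mem_Ico]
        constructor
        · rw [← hm]; exact Nat.div_mul_le_self _ _
        · rw [← hm]
          have := Nat.lt_div_mul_add (a := (e ⟨a, ha⟩ : ℕ)) hc
          exact this
      · intro a ha b hb hab
        simp only [Finset.coe_filter, Set.mem_ofPred_eq] at ha hb
        simp only [ha.1, hb.1, dif_pos] at hab
        have := e.injective (Fin.ext hab)
        simpa using this
    simpa using this
  · intro a ha
    simp only [ha, dif_pos]
    exact Nat.lt_succ_of_le (Nat.div_le_div_right (e ⟨a, ha⟩).2.le)

/-- derandomised balancing -/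
lemma balance {t : ℕ} {Sh Cn : Type*} [Fintype Sh] [Nonempty Sh] [Fintype Cn]
    (x : Fin t → Sh → Cn → ℝ) (B : ℝ) (hB : ∀ i s c, 0 ≤ x i s c ∧ x i s c ≤ B) :
    ∃ f : Fin t → Sh, ∀ c, ∑ i, x i (f i) c ≤
      ∑ i, (∑ s, x i s c) / Fintype.card Sh + Real.sqrt (t * Fintype.card Cn) * B := by
  set av : Fin t → Cn → ℝ := fun i c => (∑ s, x i s c) / Fintype.card Sh with hav
  have hcard : (0:ℝ) < Fintype.card Sh := by exact_mod_cast Fintype.card_pos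
  have hav0 : ∀ i c, 0 ≤ av i c ∧ av i c ≤ B := by
    intro i c
    constructor
    · exact div_nonneg (Finset.sum_nonneg fun s _ => (hB i s c).1) hcard.le
    · rw [hav]; simp only
      rw [div_le_iff₀ hcard]
      calc ∑ s, x i s c ≤ ∑ _s : Sh, B := Finset.sum_le_sum fun s _ => (hB i s c).2
        _ = B * Fintype.card Sh := by simp [mul_comm]
  have key : ∀ S : Finset (Fin t), ∃ f : Fin t → Sh,
      ∑ c, (∑ i ∈ S, (x i (f i) c - av i c)) ^ 2 ≤ S.card * (Fintype.card Cn * B ^ 2) := by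
    intro S
    induction S using Finset.induction_on with
    | empty => exact ⟨fun _ => Classical.arbitrary _, by simp⟩
    | insert a S ha ih =>
      obtain ⟨f, hf⟩ := ih
      have : ∃ s : Sh, ∑ c, (∑ i ∈ S, (x i (f i) c - av i c)) * (x a s c - av a c) ≤ 0 := by
        by_contra hcon
        push Not at hcon
        have h1 : 0 < ∑ s, ∑ c, (∑ i ∈ S, (x i (f i) c - av i c)) * (x a s c - av a c) :=
          Finset.sum_pos (fun s _ => hcon s) Finset.univ_nonempty
        rw [Finset.sum_comm] at h1
        have h2 : ∀ c, ∑ s, (∑ i ∈ S, (x i (f i) c - av i c)) * (x a s c - av a c) = 0 := by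
          intro c
          rw [← Finset.mul_sum]
          have h3 : ∑ s, (x a s c - av a c) = 0 := by
            rw [Finset.sum_sub_distrib]
            simp only [Finset.sum_const, Finset.card_univ, nsmul_eq_mul, hav]
            rw [mul_div_cancel₀ _ hcard.ne']
            simp
          rw [h3, mul_zero]
        rw [Finset.sum_congr rfl (fun c _ => h2 c)] at h1
        simp at h1
      obtain ⟨s, hs⟩ := this
      refine ⟨Function.update f a s, ?_⟩
      have hne : ∀ i ∈ S, i ≠ a := fun x hx e => ha (e ▸ hx)
      have e1 : ∀ c, ∑ i ∈ insert a S, (x i (Function.update f a s i) c - av i c) =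
          (x a s c - av a c) + ∑ i ∈ S, (x i (f i) c - av i c) := by
        intro c
        rw [Finset.sum_insert ha, Function.update_self]
        congr 1
        apply Finset.sum_congr rfl
        intro i hi
        rw [Function.update_of_ne (hne i hi)]
      simp only [e1]
      rw [Finset.card_insert_of_notMem ha]
      have e2 : ∑ c, (x a s c - av a c) ^ 2 ≤ Fintype.card Cn * B ^ 2 := by
        calc ∑ c, (x a s c - av a c) ^ 2 ≤ ∑ _c : Cn, B ^ 2 := by
              apply Finset.sum_le_sum
              intro c _
              have h1 := hB a s c
              have h2 := hav0 a c
              apply sq_le_sq'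
              · linarith
              · linarith
          _ = _ := by simp
      have e3 : ∑ c, ((x a s c - av a c) + ∑ i ∈ S, (x i (f i) c - av i c)) ^ 2 =
        ∑ c, (x a s c - av a c) ^ 2 + 2 * ∑ c, (∑ i ∈ S, (x i (f i) c - av i c)) * (x a s c - av a c)
         + ∑ c, (∑ i ∈ S, (x i (f i) c - av i c)) ^ 2 := by
        rw [Finset.mul_sum, ← Finset.sum_add_distrib, ← Finset.sum_add_distrib]
        apply Finset.sum_congr rfl
        intro c _
        ring
      rw [e3]
      push_cast
      linarith
  obtain ⟨f, hf⟩ := key Finset.univ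
  refine ⟨f, fun c => ?_⟩
  have h1 : (∑ i, (x i (f i) c - av i c)) ^ 2 ≤ t * (Fintype.card Cn * B ^ 2) := by
    have := Finset.single_le_sum (f := fun c => (∑ i, (x i (f i) c - av i c)) ^ 2)
      (fun c _ => sq_nonneg _) (Finset.mem_univ c)
    simp only [Finset.card_univ, Fintype.card_fin] at hf
    linarith
  have hB0 : 0 ≤ B ∨ t = 0 := by
    rcases Nat.eq_zero_or_pos t with h | h
    · exact Or.inr h
    · exact Or.inl (le_trans (hB ⟨0, h⟩ (Classical.arbitrary _) c).1 (hB ⟨0, h⟩ (Classical.arbitrary _) c).2)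
  rcases hB0 with hB0 | h0
  · have h2 : ∑ i, (x i (f i) c - av i c) ≤ Real.sqrt (t * Fintype.card Cn) * B := by
      apply le_of_sq_le_sq _ (by positivity)
      rw [mul_pow, Real.sq_sqrt (by positivity)]
      linarith
    rw [Finset.sum_sub_distrib] at h2
    linarith
  · subst h0
    simp

end
end ApproxDecomp

namespace ApproxDecomp
section
open scoped Classical

lemma reg_perms (n : ℕ) : ∀ (D : ℕ) (A : Fin n → Fin n → ℕ), (∀ i, ∑ j, A i j = D) →
    (∀ j, ∑ i, A i j = D) → ∃ τ : Fin D → Equiv.Perm (Fin n), ∀ i j, 0 < A i j → ∃ c, τ c i = j := by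
  intro D
  induction D with
  | zero =>
    intro A hr hc
    refine ⟨fun c => c.elim0, ?_⟩
    intro i j h
    have := hr i
    rw [Finset.sum_eq_zero_iff] at this
    have := this j (Finset.mem_univ _)
    omega
  | succ D ih =>
    intro A hr hc
    have hall : ∀ s : Finset (Fin n),
        s.card ≤ (s.biUnion fun i => Finset.univ.filter fun j => 0 < A i j).card := by
      intro s
      set N := s.biUnion fun i => Finset.univ.filter fun j => 0 < A i j with hN
      have h1 : s.card * (D+1) ≤ N.card * (D+1) := by
        calc s.card * (D+1) = ∑ i ∈ s, ∑ j, A i j := by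
              rw [Finset.sum_congr rfl (fun i _ => hr i)]; simp
          _ = ∑ i ∈ s, ∑ j ∈ N, A i j := by
              apply Finset.sum_congr rfl
              intro i hi
              symm
              apply Finset.sum_subset (Finset.subset_univ _)
              intro j _ hj
              by_contra h
              apply hj
              rw [hN, Finset.mem_biUnion]
              exact ⟨i, hi, by simp; omega⟩
          _ = ∑ j ∈ N, ∑ i ∈ s, A i j := Finset.sum_comm
          _ ≤ ∑ j ∈ N, ∑ i, A i j := Finset.sum_le_sum fun j _ =>
              Finset.sum_le_sum_of_subset (Finset.subset_univ _)
          _ = N.card * (D+1) := by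
              rw [Finset.sum_congr rfl (fun i _ => hc i)]; simp
      exact Nat.le_of_mul_le_mul_right h1 (Nat.succ_pos D)
    obtain ⟨f, hf, hf'⟩ := (Finset.all_card_le_biUnion_card_iff_exists_injective _).1 hall
    have hbij : Function.Bijective f := Finite.injective_iff_bijective.1 hf
    set σ : Equiv.Perm (Fin n) := Equiv.ofBijective f hbij with hσ
    have hσf : ∀ i, σ i = f i := fun i => rfl
    have hpos : ∀ i, 0 < A i (σ i) := fun i => by
      have := hf' i
      rw [hσf]
      simpa using this
    obtain ⟨τ, hτ⟩ := ih (fun i j => A i j - if σ i = j then 1 else 0) (by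
      intro i
      rw [Finset.sum_tsub_distrib]
      · rw [hr i]; simp
      · intro j _
        split_ifs with h
        · rw [← h]; exact hpos i
        · simp) (by
      intro j
      rw [Finset.sum_tsub_distrib]
      · rw [hc j]
        have : ∀ i, (σ i = j) ↔ (i = σ.symm j) := fun i => by
          rw [Equiv.eq_symm_apply]
        simp [this]
      · intro i _
        split_ifs with h
        · rw [← h]; exact hpos i
        · simp)
    refine ⟨Fin.cons σ τ, ?_⟩
    intro i j h
    by_cases hij : σ i = j
    · exact ⟨0, by simpa using hij⟩
    · obtain ⟨c, hc⟩ := hτ i j (by simpa [hij] using h)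
      exact ⟨c.succ, by simpa using hc⟩

lemma pad_matrix (n D : ℕ) : ∀ (m : ℕ) (A : Fin n → Fin n → ℕ), (∀ i, ∑ j, A i j ≤ D) →
    (∀ j, ∑ i, A i j ≤ D) → n * D ≤ m + ∑ i, ∑ j, A i j →
    ∃ A' : Fin n → Fin n → ℕ, (∀ i j, A i j ≤ A' i j) ∧ (∀ i, ∑ j, A' i j = D) ∧
      (∀ j, ∑ i, A' i j = D) := by
  intro m
  induction m with
  | zero =>
    intro A hr hc h
    refine ⟨A, fun _ _ => le_rfl, ?_, ?_⟩
    · have h1 : ∑ i, ∑ j, A i j = ∑ _i : Fin n, D := by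
        apply le_antisymm (Finset.sum_le_sum fun i _ => hr i)
        simpa using h
      intro i
      exact ((Finset.sum_eq_sum_iff_of_le (fun i _ => hr i)).1 h1) i (Finset.mem_univ _)
    · have h1 : ∑ j, ∑ i, A i j = ∑ _i : Fin n, D := by
        apply le_antisymm (Finset.sum_le_sum fun i _ => hc i)
        rw [Finset.sum_comm]
        simpa using h
      intro i
      exact ((Finset.sum_eq_sum_iff_of_le (fun i _ => hc i)).1 h1) i (Finset.mem_univ _)
  | succ m ih =>
    intro A hr hc h
    by_cases hle : n * D ≤ m + ∑ i, ∑ j, A i j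
    · exact ih A hr hc hle
    · have hlt : ∑ i, ∑ j, A i j < n * D := by omega
      obtain ⟨i₀, hi₀⟩ : ∃ i, ∑ j, A i j < D := by
        by_contra hcon
        push Not at hcon
        have : ∑ _i : Fin n, D ≤ ∑ i, ∑ j, A i j := Finset.sum_le_sum fun i _ => hcon i
        simp at this
        omega
      obtain ⟨j₀, hj₀⟩ : ∃ j, ∑ i, A i j < D := by
        by_contra hcon
        push Not at hcon
        have : ∑ _i : Fin n, D ≤ ∑ j, ∑ i, A i j := Finset.sum_le_sum fun i _ => hcon i
        rw [Finset.sum_comm] at this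
        simp at this
        omega
      have e1 : ∀ i, ∑ j, (A i j + if i = i₀ ∧ j = j₀ then 1 else 0) =
          ∑ j, A i j + if i = i₀ then 1 else 0 := by
        intro i
        rw [Finset.sum_add_distrib]
        congr 1
        by_cases h : i = i₀ <;> simp [h]
      have e2 : ∀ j, ∑ i, (A i j + if i = i₀ ∧ j = j₀ then 1 else 0) =
          ∑ i, A i j + if j = j₀ then 1 else 0 := by
        intro j
        rw [Finset.sum_add_distrib]
        congr 1
        by_cases h : j = j₀ <;> simp [h]
      obtain ⟨A', h1, h2, h3⟩ := ih (fun i j => A i j + if i = i₀ ∧ j = j₀ then 1 else 0)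
        (by
          intro i
          rw [e1]
          split_ifs with h
          · subst h; omega
          · exact hr i)
        (by
          intro i
          rw [e2]
          split_ifs with h
          · subst h; omega
          · exact hc i)
        (by
          simp only [e1]
          rw [Finset.sum_add_distrib]
          simp
          omega)
      exact ⟨A', fun i j => le_trans (Nat.le_add_right _ _) (h1 i j), h2, h3⟩

lemma perm_decomp (n D : ℕ) (A : Fin n → Fin n → Prop)
    (hr : ∀ i, (Finset.univ.filter fun j => A i j).card ≤ D)
    (hc : ∀ j, (Finset.univ.filter fun i => A i j).card ≤ D) :
    ∃ (τ : Fin D → Equiv.Perm (Fin n)) (good : Fin D → Finset (Fin n)),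
      (∀ c, ∀ i ∈ good c, A i (τ c i)) ∧
      (∀ c c' i, i ∈ good c → i ∈ good c' → τ c i = τ c' i → c = c') ∧
      ∑ i, (Finset.univ.filter fun j => A i j).card ≤ ∑ c, (good c).card := by
  obtain ⟨A', h1, h2, h3⟩ := pad_matrix n D (n * D) (fun i j => if A i j then 1 else 0)
    (by intro i; simpa using hr i) (by intro i; simpa using hc i) (by omega)
  obtain ⟨τ, hτ⟩ := reg_perms n D A' h2 h3
  have hcol : ∀ i j, A i j → ∃ c, τ c i = j := by
    intro i j h
    apply hτ
    have := h1 i j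
    simp [h] at this
    omega
  rcases Nat.eq_zero_or_pos D with hD | hD
  · subst hD
    refine ⟨τ, fun c => c.elim0, fun c => c.elim0, fun c => c.elim0, ?_⟩
    have : ∀ i, (Finset.univ.filter fun j => A i j).card = 0 := fun i => Nat.le_zero.1 (hr i)
    simp [this]
  have : Nonempty (Fin D) := ⟨⟨0, hD⟩⟩
  choose! cc hcc using hcol
  refine ⟨τ, fun c => Finset.univ.filter fun i => A i (τ c i) ∧ cc i (τ c i) = c, ?_, ?_, ?_⟩
  · intro c i hi
    simp at hi
    exact hi.1
  · intro c c' i hi hi' h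
    simp at hi hi'
    rw [← hi.2, ← hi'.2, h]
  · rw [← Finset.card_sigma, ← Finset.card_sigma]
    apply Finset.card_le_card_of_injOn (fun p => ⟨cc p.1 p.2, p.1⟩)
    · rintro ⟨i, j⟩ hij
      simp only [Finset.coe_sigma, Finset.coe_filter, Finset.mem_univ, true_and, Set.mem_sigma_iff,
        Finset.coe_univ, Set.mem_univ, Set.mem_ofPred_eq] at hij ⊢
      rw [hcc i j hij]
      exact ⟨hij, rfl⟩
    · rintro ⟨i, j⟩ hij ⟨i', j'⟩ hij' h
      simp only [Finset.coe_sigma, Finset.coe_filter, Finset.mem_univ, true_and, Set.mem_sigma_iff,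
        Finset.coe_univ, Set.mem_univ, Set.mem_ofPred_eq] at hij hij'
      simp only [Sigma.mk.injEq, heq_eq_eq] at h
      obtain ⟨hc', rfl⟩ := h
      have := hcc i j hij
      rw [hc', hcc i j' hij'] at this
      simp [this]

end
end ApproxDecomp

namespace ApproxDecomp
section
open scoped Classical
variable {W : Type*}

lemma eBetween_eq (G : SimpleGraph W) (A B : Finset W) :
    eBetween G (A : Set W) (B : Set W) = ∑ a ∈ A, (B.filter fun b => G.Adj a b).card := by
  unfold eBetween
  have : {p : W × W | p.1 ∈ (A : Set W) ∧ p.2 ∈ (B : Set W) ∧ G.Adj p.1 p.2} =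
      (((A ×ˢ B).filter fun p => G.Adj p.1 p.2 : Finset (W × W)) : Set (W × W)) := by
    ext p
    simp [and_assoc]
  rw [this, Set.ncard_coe_finset, Finset.card_filter, Finset.sum_product]
  apply Finset.sum_congr rfl
  intro a _
  rw [Finset.card_filter]

lemma eBetween_comm (G : SimpleGraph W) (A B : Finset W) :
    eBetween G (A : Set W) (B : Set W) = eBetween G (B : Set W) (A : Set W) := by
  rw [eBetween_eq, eBetween_eq]
  simp only [Finset.card_filter]
  rw [Finset.sum_comm]
  simp only [G.adj_comm]

lemma IsRegularPair.symm {G : SimpleGraph W} {A B : Finset W} {ε d : ℝ}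
    (h : IsRegularPair G A B ε d) : IsRegularPair G B A ε d := by
  intro B' hB A' hA hB' hA'
  have := h A' hA B' hB hA' hB'
  rwa [eBetween_comm, mul_comm]

lemma reg_high {G : SimpleGraph W} {A B : Finset W} {ε d : ℝ} (h : IsRegularPair G A B ε d)
    (hA : 0 < ε * A.card) (B' : Finset W) (hB : B' ⊆ B) (hB' : ε * B.card ≤ B'.card)
    (h0 : 0 < B'.card) :
    ((A.filter fun a => (d + ε) * B'.card < ((B'.filter fun b => G.Adj a b).card : ℝ)).card : ℝ)
      < ε * A.card := by
  by_contra hcon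
  push Not at hcon
  set S := A.filter fun a => (d + ε) * B'.card < ((B'.filter fun b => G.Adj a b).card : ℝ) with hS
  have h1 := h S (Finset.filter_subset _ _) B' hB hcon hB'
  rw [eBetween_eq, abs_lt] at h1
  have hSpos : (0:ℝ) < S.card := lt_of_lt_of_le hA hcon
  have hBpos : (0:ℝ) < B'.card := by exact_mod_cast h0
  have h2 := h1.2
  rw [sub_lt_iff_lt_add, div_lt_iff₀ (by positivity)] at h2
  have h3 : (S.card : ℝ) * ((d + ε) * B'.card) ≤ ((∑ a ∈ S, (B'.filter fun b => G.Adj a b).card : ℕ) : ℝ) := by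
    push_cast
    rw [← nsmul_eq_mul]
    apply Finset.card_nsmul_le_sum
    intro a ha
    exact (Finset.mem_filter.1 ha).2.le
  nlinarith

lemma reg_low {G : SimpleGraph W} {A B : Finset W} {ε d : ℝ} (h : IsRegularPair G A B ε d)
    (hA : 0 < ε * A.card) (B' : Finset W) (hB : B' ⊆ B) (hB' : ε * B.card ≤ B'.card)
    (h0 : 0 < B'.card) :
    ((A.filter fun a => ((B'.filter fun b => G.Adj a b).card : ℝ) < (d - ε) * B'.card).card : ℝ)
      < ε * A.card := by
  by_contra hcon
  push Not at hcon
  set S := A.filter fun a => ((B'.filter fun b => G.Adj a b).card : ℝ) < (d - ε) * B'.card with hS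
  have h1 := h S (Finset.filter_subset _ _) B' hB hcon hB'
  rw [eBetween_eq, abs_lt] at h1
  have hSpos : (0:ℝ) < S.card := lt_of_lt_of_le hA hcon
  have hBpos : (0:ℝ) < B'.card := by exact_mod_cast h0
  have h2 := h1.1
  rw [lt_sub_iff_add_lt, lt_div_iff₀ (by positivity)] at h2
  have h3 : ((∑ a ∈ S, (B'.filter fun b => G.Adj a b).card : ℕ) : ℝ) ≤ (S.card : ℝ) * ((d - ε) * B'.card) := by
    push_cast
    rw [← nsmul_eq_mul]
    apply Finset.sum_le_card_nsmul
    intro a ha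
    exact (Finset.mem_filter.1 ha).2.le
  nlinarith

lemma card_filter_image {n' : ℕ} (pA : Fin n' → W) (hA : Function.Injective pA) (P : W → Prop) :
    (((Finset.univ.image pA).filter P).card) = (Finset.univ.filter fun i => P (pA i)).card := by
  rw [Finset.filter_image, Finset.card_image_of_injective _ hA]

lemma pair_colors {G : SimpleGraph W} {A B : Finset W} {ε d : ℝ} (h : IsRegularPair G A B ε d)
    (n n' D₁ : ℕ) (hAn : A.card = n) (hBn : B.card = n) (hε : 0 < ε) (hd : 0 < d)
    (pA pB : Fin n' → W) (hpA : Function.Injective pA) (hpB : Function.Injective pB)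
    (hA : ∀ i, pA i ∈ A) (hB : ∀ i, pB i ∈ B) (hn' : ε * n ≤ n') (hn0 : 0 < n')
    (β : ℝ) (hβ : 0 < β) (hD₁ : D₁ + 4 * ε * n / β ≤ d * n' - 1) :
    ∃ (τ : Fin D₁ → Equiv.Perm (Fin n')) (bad : Fin D₁ → Finset (Fin n')),
      (∀ c, ((bad c).card : ℝ) ≤ β * n') ∧
      (∀ c i, i ∉ bad c → G.Adj (pA i) (pB (τ c i))) ∧
      (∀ c c' i, i ∉ bad c → i ∉ bad c' → τ c i = τ c' i → c = c') := by
  have hnn : n' ≤ n := by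
    rw [← hAn]
    have := Finset.card_le_card_of_injOn (s := (Finset.univ : Finset (Fin n'))) (t := A) pA
      (fun i _ => hA i) (hpA.injOn)
    simpa using this
  have hn : 0 < n := lt_of_lt_of_le hn0 hnn
  have hn'R : (0:ℝ) < n' := by exact_mod_cast hn0
  have hnR : (0:ℝ) < n := by exact_mod_cast hn
  set A' := Finset.univ.image pA with hA'
  set B' := Finset.univ.image pB with hB'
  have cA' : A'.card = n' := by rw [hA', Finset.card_image_of_injective _ hpA]; simp
  have cB' : B'.card = n' := by rw [hB', Finset.card_image_of_injective _ hpB]; simp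
  have sA' : A' ⊆ A := by intro x hx; obtain ⟨i, _, rfl⟩ := Finset.mem_image.1 hx; exact hA i
  have sB' : B' ⊆ B := by intro x hx; obtain ⟨i, _, rfl⟩ := Finset.mem_image.1 hx; exact hB i
  set dA : Fin n' → ℕ := fun i => (Finset.univ.filter fun j => G.Adj (pA i) (pB j)).card with hdA
  set dB : Fin n' → ℕ := fun j => (Finset.univ.filter fun i => G.Adj (pA i) (pB j)).card with hdB
  set oA := Finset.univ.filter fun i => (d + ε) * n' < (dA i : ℝ) with hoA
  set oB := Finset.univ.filter fun i => (d + ε) * n' < (dB i : ℝ) with hoB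
  have coA : (oA.card : ℝ) ≤ ε * n := by
    have h1 := reg_high h (by rw [hAn]; positivity) B' sB' (by rw [hBn, cB']; exact hn') (by omega)
    rw [hAn, cB'] at h1
    refine le_trans ?_ h1.le
    norm_cast
    rw [← Finset.card_image_of_injective oA hpA]
    apply Finset.card_le_card
    intro x hx
    obtain ⟨i, hi, rfl⟩ := Finset.mem_image.1 hx
    simp only [hoA, Finset.mem_filter, Finset.mem_univ, true_and] at hi
    rw [Finset.mem_filter]
    refine ⟨hA i, ?_⟩
    rw [hB', card_filter_image pB hpB (fun b => G.Adj (pA i) b)]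
    exact hi
  have coB : (oB.card : ℝ) ≤ ε * n := by
    have h1 := reg_high h.symm (by rw [hBn]; positivity) A' sA' (by rw [hAn, cA']; exact hn') (by omega)
    rw [hBn, cA'] at h1
    refine le_trans ?_ h1.le
    norm_cast
    rw [← Finset.card_image_of_injective oB hpB]
    apply Finset.card_le_card
    intro x hx
    obtain ⟨i, hi, rfl⟩ := Finset.mem_image.1 hx
    simp only [hoB, Finset.mem_filter, Finset.mem_univ, true_and] at hi
    rw [Finset.mem_filter]
    refine ⟨hB i, ?_⟩
    rw [hA', card_filter_image pA hpA (fun b => G.Adj (pB i) b)]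
    simp only [G.adj_comm (pB i)]
    exact hi
  -- total edges
  have htot : (d - ε) * (n' * n') ≤ ((∑ i, dA i : ℕ) : ℝ) := by
    have h1 := h A' sA' B' sB' (by rw [hAn, cA']; exact hn') (by rw [hBn, cB']; exact hn')
    rw [eBetween_eq, cA', cB', abs_lt] at h1
    have h2 := h1.1
    rw [lt_sub_iff_add_lt, lt_div_iff₀ (by positivity)] at h2
    have : ∑ a ∈ A', (B'.filter fun b => G.Adj a b).card = ∑ i, dA i := by
      rw [hA', Finset.sum_image (fun _ _ _ _ h => hpA h)]
      apply Finset.sum_congr rfl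
      intro i _
      rw [hB', card_filter_image pB hpB (fun b => G.Adj (pA i) b)]
    rw [this] at h2
    linarith
  set D := ⌊(d + ε) * n'⌋₊ with hD
  have hDle : (D : ℝ) ≤ (d + ε) * n' := Nat.floor_le (by positivity)
  have hDge : (d + ε) * n' - 1 < D := Nat.sub_one_lt_floor _
  obtain ⟨Ar, hAr⟩ : ∃ Ar : Fin n' → Fin n' → Prop, ∀ i j, Ar i j ↔
      (G.Adj (pA i) (pB j) ∧ i ∉ oA ∧ j ∉ oB) := ⟨_, fun _ _ => Iff.rfl⟩
  obtain ⟨τ, good, hg1, hg2, hg3⟩ := perm_decomp n' D Ar (by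
      intro i
      by_cases hi : i ∈ oA
      · simp [hAr, hi]
      · have h1 : (Finset.univ.filter fun j => Ar i j).card ≤ dA i :=
          Finset.card_le_card (Finset.monotone_filter_right _ (fun j _ hj => ((hAr _ _).1 hj).1))
        refine le_trans h1 (Nat.le_floor ?_)
        simpa [hoA] using hi) (by
      intro i
      by_cases hi : i ∈ oB
      · simp [hAr, hi]
      · have h1 : (Finset.univ.filter fun j => Ar j i).card ≤ dB i :=
          Finset.card_le_card (Finset.monotone_filter_right _ (fun j _ hj => ((hAr _ _).1 hj).1))
        refine le_trans h1 (Nat.le_floor ?_)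
        simpa [hoB] using hi)
  have hreal : ((∑ i, dA i : ℕ) : ℝ) ≤ ((∑ c, (good c).card : ℕ) : ℝ) + 2 * (ε * n) * n' := by
    have h1 : ∀ i, dA i ≤ (Finset.univ.filter fun j => Ar i j).card + ((if i ∈ oA then n' else 0) + oB.card) := by
      intro i
      by_cases hi : i ∈ oA
      · have : dA i ≤ n' := by
          refine le_trans (Finset.card_filter_le _ _) (by simp)
        simp [hi]; omega
      · simp only [hi, if_false, zero_add]
        rw [hdA]
        refine le_trans (Finset.card_le_card (t := (Finset.univ.filter fun j => Ar i j) ∪ oB) ?_) (Finset.card_union_le _ _)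
        intro j hj
        simp only [Finset.mem_filter, Finset.mem_univ, true_and] at hj
        by_cases hjB : j ∈ oB
        · exact Finset.mem_union_right _ hjB
        · apply Finset.mem_union_left
          simp [hAr, hj, hi, hjB]
    have h2 : ∑ i, dA i ≤ ∑ c, (good c).card + (oA.card * n' + n' * oB.card) := by
      refine le_trans (Finset.sum_le_sum fun i _ => h1 i) ?_
      rw [Finset.sum_add_distrib, Finset.sum_add_distrib]
      simp only [Finset.sum_ite_mem, Finset.univ_inter, Finset.sum_const, smul_eq_mul, Finset.card_univ, Fintype.card_fin]
      omega
    have h3 : ((∑ i, dA i : ℕ) : ℝ) ≤ ((∑ c, (good c).card : ℕ) : ℝ) + (oA.card * n' + n' * oB.card) := by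
      exact_mod_cast h2
    nlinarith
  -- fakes
  have hfake : ∑ c, ((n' : ℝ) - (good c).card) ≤ 4 * ε * n * n' := by
    rw [Finset.sum_sub_distrib]
    simp only [Finset.sum_const, Finset.card_univ, Fintype.card_fin, nsmul_eq_mul]
    push_cast at hreal htot
    have : (D:ℝ) * n' ≤ (d + ε) * n' * n' := by nlinarith
    have h5 : (n':ℝ) ≤ n := by exact_mod_cast hnn
    have h6 : ε * (n' * n') ≤ ε * (n * n') := by
      apply mul_le_mul_of_nonneg_left _ hε.le
      nlinarith
    nlinarith
  set bc := Finset.univ.filter fun c : Fin D => β * n' < (n' : ℝ) - (good c).card with hbc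
  have hbcc : (bc.card : ℝ) ≤ 4 * ε * n / β := by
    have h1 : (bc.card : ℝ) * (β * n') ≤ ∑ c ∈ bc, ((n' : ℝ) - (good c).card) := by
      rw [← nsmul_eq_mul]
      apply Finset.card_nsmul_le_sum
      intro c hc
      exact (Finset.mem_filter.1 hc).2.le
    have h2 : ∑ c ∈ bc, ((n' : ℝ) - (good c).card) ≤ ∑ c, ((n' : ℝ) - (good c).card) := by
      apply Finset.sum_le_sum_of_subset_of_nonneg (Finset.subset_univ _)
      intro c _ _
      have : (good c).card ≤ n' := by simpa using Finset.card_le_univ (good c)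
      have : ((good c).card : ℝ) ≤ n' := by exact_mod_cast this
      linarith
    rw [le_div_iff₀ hβ]
    have h3 : (bc.card : ℝ) * β * n' ≤ 4 * ε * n * n' := by linarith
    exact le_of_mul_le_mul_right h3 hn'R
  have hcard : D₁ ≤ (Finset.univ \ bc).card := by
    rw [Finset.card_sdiff_of_subset (Finset.subset_univ _)]
    simp only [Finset.card_univ, Fintype.card_fin]
    apply Nat.le_sub_of_add_le
    have : (D₁ : ℝ) + bc.card ≤ D := by nlinarith
    exact_mod_cast this
  obtain ⟨S, hS, hSc⟩ := Finset.exists_subset_card_eq hcard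
  let e := S.equivFinOfCardEq hSc
  refine ⟨fun c => τ (e.symm c), fun c => Finset.univ \ good (e.symm c), ?_, ?_, ?_⟩
  · intro c
    have h1 := hS (e.symm c).2
    simp only [hbc, Finset.mem_sdiff, Finset.mem_univ, Finset.mem_filter, true_and, not_lt] at h1
    rw [Finset.card_sdiff_of_subset (Finset.subset_univ _)]
    have : (good (e.symm c)).card ≤ n' := by simpa using Finset.card_le_univ (good (e.symm c))
    simp only [Finset.card_univ, Fintype.card_fin]
    rw [Nat.cast_sub this]
    exact h1
  · intro c i hi
    simp at hi
    exact ((hAr _ _).1 (hg1 _ _ hi)).1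
  · intro c c' i hi hi' heq
    simp at hi hi'
    have := hg2 _ _ i hi hi' heq
    have := Subtype.ext this
    exact e.symm.injective this

end
end ApproxDecomp

namespace ApproxDecomp
section
open scoped Classical

/-- A rooted forest with bounded number of children, with vertices grouped into bundles. -/
structure Forest (N : Type) [Fintype N] (t Δ : ℕ) where
  par : N → Option N
  dep : N → ℕ
  bd : N → Fin t
  dep_some : ∀ v u, par v = some u → dep v = dep u + 1
  dep_none : ∀ v, par v = none → dep v = 0
  bd_par : ∀ v u, par v = some u → bd v = bd u
  child_le : ∀ u, (Finset.univ.filter fun v => par v = some u).card ≤ Δ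

variable {N : Type} [Fintype N] {t Δ : ℕ}

lemma Forest.ind (F : Forest N t Δ) {motive : N → Prop}
    (root : ∀ v, F.par v = none → motive v)
    (child : ∀ v u, F.par v = some u → motive u → motive v) : ∀ v, motive v := by
  have : ∀ k v, F.dep v = k → motive v := by
    intro k
    induction k with
    | zero =>
      intro v hv
      rcases h : F.par v with _ | u
      · exact root v h
      · have := F.dep_some v u h; omega
    | succ k ih =>
      intro v hv
      rcases h : F.par v with _ | u
      · exact root v h
      · have := F.dep_some v u h
        exact child v u h (ih u (by omega))
  exact fun v => this _ v rfl

def Forest.gk {X : Type*} (F : Forest N t Δ) (base : N → X) (step : N → N → X → X) : ℕ → N → X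
  | 0, v => base v
  | k + 1, v => match F.par v with
    | none => base v
    | some u => step v u (Forest.gk F base step k u)

lemma Forest.exists_rec {X : Type*} (F : Forest N t Δ) (base : N → X) (step : N → N → X → X) :
    ∃ g : N → X, (∀ v, F.par v = none → g v = base v) ∧
      ∀ v u, F.par v = some u → g v = step v u (g u) := by
  refine ⟨fun v => F.gk base step (F.dep v) v, ?_, ?_⟩
  · intro v hv
    simp only [F.dep_none v hv, Forest.gk]
  · intro v u hv
    simp only [F.dep_some v u hv, Forest.gk, hv]

lemma Forest.exists_anc (F : Forest N t Δ) : ∃ anc : N → Finset N,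
    (∀ v, v ∈ anc v) ∧ (∀ v, F.par v = none → anc v = {v}) ∧
    (∀ v u, F.par v = some u → anc v = insert v (anc u)) ∧
    (∀ x u v, x ∈ anc u → u ∈ anc v → x ∈ anc v) ∧
    (∀ x v, x ∈ anc v → F.dep x ≤ F.dep v ∧ (F.dep x = F.dep v → x = v)) ∧
    (∀ x v, x ∈ anc v → F.bd x = F.bd v) := by
  obtain ⟨anc, h1, h2⟩ := F.exists_rec (fun v => ({v} : Finset N)) (fun v _ A => insert v A)
  have hself : ∀ v, v ∈ anc v := by
    intro v
    rcases h : F.par v with _ | u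
    · simp [h1 v h]
    · simp [h2 v u h]
  refine ⟨anc, hself, h1, h2, ?_, ?_, ?_⟩
  · intro x u v hx
    induction v using F.ind with
    | root v hv => intro hu; rw [h1 v hv, Finset.mem_singleton] at hu; subst hu; exact hx
    | child v w hv ih =>
      intro hu
      rw [h2 v w hv, Finset.mem_insert] at hu
      rcases hu with rfl | hu
      · exact hx
      · rw [h2 v w hv]; exact Finset.mem_insert_of_mem (ih hu)
  · intro x v
    induction v using F.ind with
    | root v hv => intro hu; rw [h1 v hv, Finset.mem_singleton] at hu; subst hu; simp
    | child v w hv ih =>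
      intro hu
      rw [h2 v w hv, Finset.mem_insert] at hu
      rcases hu with rfl | hu
      · simp
      · have := ih hu; have := F.dep_some v w hv
        refine ⟨by omega, fun h => by omega⟩
  · intro x v
    induction v using F.ind with
    | root v hv => intro hu; rw [h1 v hv, Finset.mem_singleton] at hu; subst hu; rfl
    | child v w hv ih =>
      intro hu
      rw [h2 v w hv, Finset.mem_insert] at hu
      rcases hu with rfl | hu
      · rfl
      · rw [ih hu, F.bd_par v w hv]

/-- the top of the chunk of `v` -/
noncomputable def Forest.cid (F : Forest N t Δ) (Z : Finset N) : N → N :=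
  (F.exists_rec (fun v => v) (fun v u x => if u ∈ Z then v else x)).choose

lemma Forest.cid_root (F : Forest N t Δ) (Z : Finset N) (v : N) (h : F.par v = none) :
    F.cid Z v = v :=
  (F.exists_rec (fun v => v) (fun v u x => if u ∈ Z then v else x)).choose_spec.1 v h

lemma Forest.cid_some (F : Forest N t Δ) (Z : Finset N) (v u : N) (h : F.par v = some u) :
    F.cid Z v = if u ∈ Z then v else F.cid Z u :=
  (F.exists_rec (fun v => v) (fun v u x => if u ∈ Z then v else x)).choose_spec.2 v u h

lemma Forest.exists_cut (F : Forest N t Δ) (ℓ h : ℕ) (hℓ : 0 < ℓ) (hh : 0 < h) (hΔ : 0 < Δ) :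
    ∃ Z : Finset N, (∀ z ∈ Z, ℓ ∣ F.dep z) ∧
      (∀ b, (Z.filter fun v => F.bd v = b).card * h ≤ (Finset.univ.filter fun v => F.bd v = b).card) ∧
      ∀ q, (Finset.univ.filter fun v => F.cid Z v = q).card ≤ (2 * Δ) ^ ℓ * (h + 1) := by
  obtain ⟨anc, hself, ha1, ha2, htr, hdep, hbd⟩ := F.exists_anc
  have key : ∀ (c : ℕ) (S : Finset N), S.card = c → (∀ v ∈ S, ∀ u, F.par v = some u → u ∈ S) →
      ∃ Z : Finset N, Z ⊆ S ∧ (∀ z ∈ Z, ℓ ∣ F.dep z) ∧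
      (∀ b, (Z.filter fun v => F.bd v = b).card * h ≤ (S.filter fun v => F.bd v = b).card) ∧
      ∀ q, (S.filter fun v => F.cid Z v = q).card ≤ (2 * Δ) ^ ℓ * (h + 1) := by
    intro c
    induction c using Nat.strong_induction_on with
    | _ c IH =>
    intro S hSc hS
    have hcidanc : ∀ Z v, F.cid Z v ∈ anc v := by
      intro Z v
      induction v using F.ind with
      | root v hv => rw [F.cid_root Z v hv]; exact hself v
      | child v u hv ih =>
        rw [F.cid_some Z v u hv, ha2 v u hv]
        split_ifs
        · simp
        · exact Finset.mem_insert_of_mem ih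
    by_cases hex : ∃ v ∈ S, ℓ ∣ F.dep v ∧ h + 1 ≤ (S.filter fun x => v ∈ anc x).card
    · -- deepest
      obtain ⟨v, hv, hmax⟩ := Finset.exists_max_image
        (S.filter fun v => ℓ ∣ F.dep v ∧ h + 1 ≤ (S.filter fun x => v ∈ anc x).card) F.dep
        (by obtain ⟨v, hv, h2⟩ := hex; exact ⟨v, Finset.mem_filter.2 ⟨hv, h2⟩⟩)
      rw [Finset.mem_filter] at hv
      obtain ⟨hvS, hvℓ, hvh⟩ := hv
      -- sizes below v
      have hsz : ∀ (j : ℕ) (x : N), F.dep v < F.dep x → ℓ ∣ F.dep x + j → x ∈ S →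
          (S.filter fun y => x ∈ anc y).card ≤ (2 * Δ) ^ j * (h + 1) := by
        intro j
        induction j with
        | zero =>
          intro x hx hd hxS
          by_contra hcon
          push Not at hcon
          have := hmax x (Finset.mem_filter.2 ⟨hxS, by simpa using hd, by simp at hcon; omega⟩)
          omega
        | succ j ih =>
          intro x hx hd hxS
          have hsub : (S.filter fun y => x ∈ anc y) ⊆
              insert x ((Finset.univ.filter fun c => F.par c = some x).biUnion
                fun c => if c ∈ S then S.filter fun y => c ∈ anc y else ∅) := by
            intro y hy
            rw [Finset.mem_filter] at hy
            obtain ⟨hyS, hxy⟩ := hy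
            rw [Finset.mem_insert]
            induction y using F.ind with
            | root y hy =>
              left
              rw [ha1 y hy, Finset.mem_singleton] at hxy
              exact hxy.symm
            | child y u hyu ihy =>
              rw [ha2 y u hyu, Finset.mem_insert] at hxy
              rcases hxy with hxy | hxy
              · left; exact hxy.symm
              · right
                rcases ihy (hS y hyS u hyu) hxy with rfl | h3
                · rw [Finset.mem_biUnion]
                  refine ⟨y, by simp [hyu], ?_⟩
                  simp [hyS, hself]
                · rw [Finset.mem_biUnion] at h3 ⊢
                  obtain ⟨c, hc, hu⟩ := h3
                  refine ⟨c, hc, ?_⟩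
                  by_cases hcS : c ∈ S
                  · simp only [hcS, if_true, Finset.mem_filter] at hu ⊢
                    refine ⟨hyS, ?_⟩
                    rw [ha2 y u hyu]
                    exact Finset.mem_insert_of_mem hu.2
                  · simp [hcS] at hu
          refine le_trans (Finset.card_le_card hsub) (le_trans (Finset.card_insert_le _ _) ?_)
          have h4 : ((Finset.univ.filter fun c => F.par c = some x).biUnion
                fun c => if c ∈ S then S.filter fun y => c ∈ anc y else ∅).card ≤
              Δ * ((2 * Δ) ^ j * (h + 1)) := by
            refine le_trans (Finset.card_biUnion_le_card_mul _ _ ((2 * Δ) ^ j * (h + 1)) ?_)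
              (Nat.mul_le_mul_right _ (F.child_le x))
            intro c hc
            rw [Finset.mem_filter] at hc
            split_ifs with hcS
            · have := F.dep_some c x hc.2
              apply ih c (by omega) _ hcS
              rw [this]; convert hd using 1; ring
            · simp
          have h5 : 1 ≤ Δ * ((2 * Δ) ^ j * (h + 1)) := Nat.one_le_iff_ne_zero.2 (by positivity)
          calc _ ≤ Δ * ((2 * Δ) ^ j * (h + 1)) + Δ * ((2 * Δ) ^ j * (h + 1)) := by omega
            _ = _ := by ring
      set D := S.filter fun x => v ∈ anc x ∧ x ≠ v with hD
      have hDc : h ≤ D.card := by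
        have : (S.filter fun x => v ∈ anc x) ⊆ insert v D := by
          intro x hx
          rw [Finset.mem_filter] at hx
          by_cases hxv : x = v
          · simp [hxv]
          · apply Finset.mem_insert_of_mem
            rw [hD, Finset.mem_filter]; exact ⟨hx.1, hx.2, hxv⟩
        have h1 := Finset.card_le_card this
        have h2 := Finset.card_insert_le v D
        omega
      have hDS : D ⊆ S := Finset.filter_subset _ _
      have hcl : ∀ x ∈ S \ D, ∀ u, F.par x = some u → u ∈ S \ D := by
        intro x hx u hu
        rw [Finset.mem_sdiff] at hx ⊢
        refine ⟨hS x hx.1 u hu, fun huD => hx.2 ?_⟩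
        rw [hD, Finset.mem_filter] at huD ⊢
        refine ⟨hx.1, ?_, ?_⟩
        · rw [ha2 x u hu]; exact Finset.mem_insert_of_mem huD.2.1
        · rintro rfl
          have := (hdep _ _ huD.2.1).1
          have := F.dep_some x u hu
          omega
      have hcard : (S \ D).card < c := by
        rw [Finset.card_sdiff_of_subset hDS]
        have := Finset.card_le_card hDS
        omega
      obtain ⟨Z', hZ'S, hZ'ℓ, hZ'b, hZ'q⟩ := IH _ hcard (S \ D) rfl hcl
      have hcidS' : ∀ x ∈ S \ D, F.cid (insert v Z') x = F.cid Z' x := by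
        intro x
        induction x using F.ind with
        | root x hx => intro _; rw [F.cid_root _ _ hx, F.cid_root _ _ hx]
        | child x u hxu ih =>
          intro hx
          rw [F.cid_some _ _ _ hxu, F.cid_some _ _ _ hxu, ih (hcl x hx u hxu)]
          have huv : u ≠ v := by
            rintro rfl
            rw [Finset.mem_sdiff] at hx
            apply hx.2
            rw [hD, Finset.mem_filter]
            refine ⟨hx.1, ?_, ?_⟩
            · rw [ha2 x u hxu]; exact Finset.mem_insert_of_mem (hself u)
            · rintro rfl
              have := F.dep_some _ _ hxu
              omega
          simp [huv]
      have hDmem : ∀ x ∈ D, F.dep v < F.dep x := by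
        intro x hx
        rw [hD, Finset.mem_filter] at hx
        have := hdep _ _ hx.2.1
        rcases this.1.lt_or_eq with h | h
        · exact h
        · exact absurd (this.2 h).symm hx.2.2
      have hcidD : ∀ x ∈ D, F.par (F.cid (insert v Z') x) = some v ∧ F.cid (insert v Z') x ∈ D := by
        intro x
        induction x using F.ind with
        | root x hx =>
          intro hxD
          have := hDmem x hxD
          have := F.dep_none x hx
          omega
        | child x u hxu ih =>
          intro hxD
          rw [F.cid_some _ _ _ hxu]
          by_cases huv : u = v
          · simp [huv, hxD]
            rw [← huv]; exact hxu
          · have huD : u ∈ D := by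
              rw [hD, Finset.mem_filter] at hxD ⊢
              refine ⟨hS x hxD.1 u hxu, ?_, huv⟩
              have := hxD.2.1
              rw [ha2 x u hxu, Finset.mem_insert] at this
              rcases this with h | h
              · exact absurd h.symm hxD.2.2
              · exact h
            have : u ∉ insert v Z' := by
              rw [Finset.mem_insert]
              rintro (h | h)
              · exact huv h
              · exact (Finset.mem_sdiff.1 (hZ'S h)).2 huD
            rw [if_neg this]
            exact ih huD
      refine ⟨insert v Z', ?_, ?_, ?_, ?_⟩
      · intro x hx
        rcases Finset.mem_insert.1 hx with rfl | hx
        · exact hvS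
        · exact (Finset.mem_sdiff.1 (hZ'S hx)).1
      · intro z hz
        rcases Finset.mem_insert.1 hz with rfl | hz
        · exact hvℓ
        · exact hZ'ℓ z hz
      · intro b
        have h1 := hZ'b b
        have hsplit : (S.filter fun v => F.bd v = b).card =
            ((S \ D).filter fun v => F.bd v = b).card + (D.filter fun v => F.bd v = b).card := by
          rw [← Finset.card_union_of_disjoint]
          · rw [← Finset.filter_union, Finset.sdiff_union_of_subset hDS]
          · exact Finset.disjoint_filter_filter (Finset.sdiff_disjoint)
        rw [hsplit, Finset.filter_insert]
        split_ifs with hb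
        · have : D.filter (fun v => F.bd v = b) = D := by
            apply Finset.filter_true_of_mem
            intro x hx
            rw [hD, Finset.mem_filter] at hx
            rw [← hb]; exact (hbd _ _ hx.2.1).symm
          rw [this]
          have h3 := Finset.card_insert_le v (Z'.filter fun v => F.bd v = b)
          calc _ ≤ ((Z'.filter fun v => F.bd v = b).card + 1) * h := Nat.mul_le_mul_right _ h3
            _ ≤ _ := by rw [add_mul]; omega
        · omega
      · intro q
        by_cases hq : q ∈ D
        · by_cases hqv : F.par q = some v
          · have hsub : (S.filter fun x => F.cid (insert v Z') x = q) ⊆ S.filter fun y => q ∈ anc y := by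
              intro x hx
              rw [Finset.mem_filter] at hx ⊢
              refine ⟨hx.1, ?_⟩
              rw [← hx.2]; exact hcidanc _ _
            refine le_trans (Finset.card_le_card hsub) ?_
            obtain ⟨m, hm⟩ := hvℓ
            have h7 := F.dep_some q v hqv
            refine le_trans (hsz (ℓ - 1) q (hDmem q hq) ?_ (hDS hq)) ?_
            · rw [h7, hm]
              refine ⟨m + 1, ?_⟩
              rw [mul_add, mul_one]; omega
            · apply Nat.mul_le_mul_right
              apply Nat.pow_le_pow_right (by omega) (by omega)
          · have : (S.filter fun x => F.cid (insert v Z') x = q) = ∅ := by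
              apply Finset.filter_false_of_mem
              intro x hx hxq
              by_cases hxD : x ∈ D
              · have := (hcidD x hxD).1
                rw [hxq] at this; exact hqv this
              · apply hxD
                have h1 : q ∈ anc x := by rw [← hxq]; exact hcidanc _ _
                rw [hD, Finset.mem_filter] at hq ⊢
                refine ⟨hx, htr _ _ _ hq.2.1 h1, ?_⟩
                rintro rfl
                have := hDmem q (by rw [hD, Finset.mem_filter]; exact hq)
                have := (hdep _ _ h1).1
                omega
            rw [this]; simp
        · refine le_trans (Finset.card_le_card ?_) (hZ'q q)
          intro x hx
          rw [Finset.mem_filter] at hx ⊢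
          have hxD : x ∉ D := by
            intro hxD
            have := (hcidD x hxD).2
            rw [hx.2] at this; exact hq this
          have hxS : x ∈ S \ D := Finset.mem_sdiff.2 ⟨hx.1, hxD⟩
          exact ⟨hxS, by rw [← hcidS' x hxS]; exact hx.2⟩
    · refine ⟨∅, by simp, by simp, by simp, ?_⟩
      intro q
      by_contra hcon
      push Not at hcon
      have hcr : ∀ x, F.dep (F.cid ∅ x) = 0 := by
        intro x
        induction x using F.ind with
        | root x hx => rw [F.cid_root _ _ hx]; exact F.dep_none x hx
        | child x u hxu ih => rw [F.cid_some _ _ _ hxu]; simpa using ih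
      have hcS : ∀ x ∈ S, F.cid ∅ x ∈ S := by
        intro x
        induction x using F.ind with
        | root x hx => intro h; rw [F.cid_root _ _ hx]; exact h
        | child x u hxu ih => intro h; rw [F.cid_some _ _ _ hxu]; simpa using ih (hS x h u hxu)
      have hpos : 0 < (S.filter fun v => F.cid ∅ v = q).card := by omega
      obtain ⟨x, hx⟩ := Finset.card_pos.1 hpos
      rw [Finset.mem_filter] at hx
      apply hex
      refine ⟨q, by rw [← hx.2]; exact hcS x hx.1, by rw [← hx.2, hcr]; simp, ?_⟩
      have h1 : (S.filter fun v => F.cid ∅ v = q).card ≤ (S.filter fun x => q ∈ anc x).card := by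
        apply Finset.card_le_card
        intro y hy
        rw [Finset.mem_filter] at hy ⊢
        refine ⟨hy.1, ?_⟩
        rw [← hy.2]; exact hcidanc _ _
      have h2 : 1 ≤ (2 * Δ) ^ ℓ := Nat.one_le_iff_ne_zero.2 (by positivity)
      nlinarith
  obtain ⟨Z, _, h1, h2, h3⟩ := key _ Finset.univ rfl (by simp)
  exact ⟨Z, h1, h2, h3⟩

end
end ApproxDecomp

namespace ApproxDecomp
section
open scoped Classical

lemma binpack {α : Type*} (a : α → Fin 2 → ℕ) (B T r : ℕ) (hr : 0 < r) (Q : Finset α)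
    (hB : ∀ q ∈ Q, a q 0 + a q 1 ≤ B) (hT : ∑ q ∈ Q, (a q 0 + a q 1) ≤ T) :
    ∃ (sec : α → Fin r) (o : α → Fin 2), ∀ s i,
      2 * r * (∑ q ∈ Q.filter (fun q => sec q = s), a q (i + o q)) ≤ T + 2 * r * B := by
  have : Nonempty (Fin r) := ⟨⟨0, hr⟩⟩
  have key : ∃ (sec : α → Fin r) (o : α → Fin 2), ∀ s,
      (r * ((∑ q ∈ Q.filter (fun q => sec q = s), a q (0 + o q)) +
        (∑ q ∈ Q.filter (fun q => sec q = s), a q (1 + o q))) ≤ T + r * B) ∧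
      (∑ q ∈ Q.filter (fun q => sec q = s), a q (0 + o q)) ≤
        (∑ q ∈ Q.filter (fun q => sec q = s), a q (1 + o q)) + B ∧
      (∑ q ∈ Q.filter (fun q => sec q = s), a q (1 + o q)) ≤
        (∑ q ∈ Q.filter (fun q => sec q = s), a q (0 + o q)) + B := by
    induction Q using Finset.induction_on with
    | empty => exact ⟨fun _ => Classical.arbitrary _, fun _ => 0, by simp⟩
    | insert x Q hx ih =>
      rw [Finset.sum_insert hx] at hT
      obtain ⟨sec, o, hso⟩ := ih (fun q hq => hB q (Finset.mem_insert_of_mem hq)) (by omega)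
      set L : Fin r → Fin 2 → ℕ := fun s i => ∑ q ∈ Q.filter (fun q => sec q = s), a q (i + o q) with hL
      have hmin := Finset.exists_min_image (Finset.univ : Finset (Fin r)) (fun s => L s 0 + L s 1)
        Finset.univ_nonempty
      obtain ⟨s₀, _, hs₀⟩ := hmin
      have hsum : ∑ s, (L s 0 + L s 1) = ∑ q ∈ Q, (a q 0 + a q 1) := by
        rw [← Finset.sum_fiberwise Q sec]
        apply Finset.sum_congr rfl
        intro s _
        rw [hL]
        rw [← Finset.sum_add_distrib]
        apply Finset.sum_congr rfl
        intro q _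
        have : ∀ z : Fin 2, a q (0 + z) + a q (1 + z) = a q 0 + a q 1 := by
          intro z; fin_cases z
          · simp
          · simp [add_comm]
        exact this _
      have hmin2 : r * (L s₀ 0 + L s₀ 1) ≤ T - (a x 0 + a x 1) := by
        have h1 : (Finset.univ : Finset (Fin r)).card • (L s₀ 0 + L s₀ 1) ≤ ∑ s, (L s 0 + L s 1) :=
          Finset.card_nsmul_le_sum _ _ _ (fun s hs => hs₀ s hs)
        simp only [Finset.card_univ, Fintype.card_fin, smul_eq_mul] at h1
        omega
      have hxB := hB x (Finset.mem_insert_self _ _)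
      -- choose orientation
      obtain ⟨ox, hox⟩ : ∃ ox : Fin 2, L s₀ 0 + a x (0 + ox) ≤ L s₀ 1 + a x (1 + ox) + B ∧
          L s₀ 1 + a x (1 + ox) ≤ L s₀ 0 + a x (0 + ox) + B := by
        have h1 := hso s₀
        have h2 := h1.2
        change L s₀ 0 ≤ L s₀ 1 + B ∧ L s₀ 1 ≤ L s₀ 0 + B at h2
        by_cases hc : L s₀ 0 ≤ L s₀ 1
        · by_cases hd : a x 0 ≤ a x 1
          · refine ⟨1, ?_⟩
            simp only [zero_add, show (1 : Fin 2) + 1 = 0 from rfl]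
            omega
          · refine ⟨0, ?_⟩
            simp only [add_zero]
            omega
        · by_cases hd : a x 0 ≤ a x 1
          · refine ⟨0, ?_⟩
            simp only [add_zero]
            omega
          · refine ⟨1, ?_⟩
            simp only [zero_add, show (1 : Fin 2) + 1 = 0 from rfl]
            omega
      refine ⟨Function.update sec x s₀, Function.update o x ox, ?_⟩
      have hnew : ∀ s i, ∑ q ∈ (insert x Q).filter (fun q => Function.update sec x s₀ q = s),
          a q (i + Function.update o x ox q) = L s i + if s = s₀ then a x (i + ox) else 0 := by
        intro s i
        have hQ : ∑ q ∈ Q.filter (fun q => Function.update sec x s₀ q = s),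
          a q (i + Function.update o x ox q) = L s i := by
          have : Q.filter (fun q => Function.update sec x s₀ q = s) = Q.filter (fun q => sec q = s) := by
            apply Finset.filter_congr
            intro q hq
            have : q ≠ x := fun h => hx (h ▸ hq)
            simp [this]
          rw [this, hL]
          apply Finset.sum_congr rfl
          intro q hq
          have : q ≠ x := fun h => hx (h ▸ (Finset.mem_filter.1 hq).1)
          simp [this]
        rw [Finset.filter_insert]
        by_cases hs : s = s₀
        · subst hs
          simp only [Function.update_self, if_true]
          rw [Finset.sum_insert (by simp [hx]), hQ]
          simp [add_comm]
        · have hs' : ¬ s₀ = s := fun h => hs h.symm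
          simp only [Function.update_self, hs', hs, if_false, add_zero]
          exact hQ
      intro s
      rw [hnew, hnew]
      by_cases hs : s = s₀
      · subst hs
        simp only [if_true]
        refine ⟨?_, hox.1, hox.2⟩
        have h3 : a x (0 + ox) + a x (1 + ox) = a x 0 + a x 1 := by
          have : ∀ z : Fin 2, a x (0 + z) + a x (1 + z) = a x 0 + a x 1 := by
            intro z; fin_cases z
            · simp
            · simp [add_comm]
          exact this _
        have h4 : L s 0 + a x (0 + ox) + (L s 1 + a x (1 + ox)) = (L s 0 + L s 1) + (a x 0 + a x 1) := by omega
        rw [h4, mul_add]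
        have h5 : r * (a x 0 + a x 1) ≤ r * B := Nat.mul_le_mul_left _ hxB
        omega
      · simp only [hs, if_false, add_zero]
        exact hso s
  obtain ⟨sec, o, h⟩ := key
  refine ⟨sec, o, fun s i => ?_⟩
  obtain ⟨h1, h2, h3⟩ := h s
  have hi : i = 0 ∨ i = 1 := by fin_cases i <;> simp
  rcases hi with rfl | rfl <;> nlinarith

variable {N : Type} [Fintype N] {t Δ : ℕ}

lemma Forest.exists_kinds (F : Forest N t Δ) (ℓ h : ℕ) (hℓ : 6 ≤ ℓ) (hh : 0 < h) (hΔ : 0 < Δ) :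
    ∃ (kind : N → Fin 4) (cid : N → N) (pd : N → ℕ),
      (∀ v u, F.par v = some u → (kind v = 0 ∧ kind u = 0) ∨ (kind v = 0 ∧ kind u = 1) ∨
        (kind v = 0 ∧ kind u = 3) ∨ (kind v = 1 ∧ kind u = 0) ∨ (kind v = 2 ∧ kind u = 0) ∨
        (kind v = 3 ∧ kind u = 2)) ∧
      (∀ v u, F.par v = some u → kind v ≠ 3 → cid v = cid u) ∧
      (∀ v, F.bd (cid v) = F.bd v) ∧
      (∀ q, (Finset.univ.filter fun v => cid v = q).card ≤ (2 * Δ) ^ ℓ * (h + 1)) ∧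
      (∀ q, (Finset.univ.filter fun v => cid v = q ∧ kind v = 1).card * (ℓ - 4) ≤
        (Finset.univ.filter fun v => cid v = q).card) ∧
      (∀ b, (Finset.univ.filter fun v => F.bd v = b ∧ kind v = 2).card * h ≤
        (Finset.univ.filter fun v => F.bd v = b).card) ∧
      (∀ v, pd v < ℓ) ∧
      (∀ v u, F.par v = some u → kind v = 0 → kind u = 0 → pd v = pd u + 1) ∧
      (∀ v, kind v = 3 → ∃ u, F.par v = some u) := by
  obtain ⟨Z, hZ1, hZ2, hZ3⟩ := F.exists_cut ℓ h (by omega) hh hΔ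
  have hc : ∀ q, ∃ c, 3 ≤ c ∧ c ≤ ℓ - 2 ∧
      (Finset.univ.filter fun v => F.cid Z v = q ∧ F.dep v % ℓ = c).card * (ℓ - 4) ≤
        (Finset.univ.filter fun v => F.cid Z v = q).card := by
    intro q
    obtain ⟨c, hc, hmin⟩ := Finset.exists_min_image (Finset.Icc 3 (ℓ - 2))
      (fun c => (Finset.univ.filter fun v => F.cid Z v = q ∧ F.dep v % ℓ = c).card)
      ⟨3, by rw [Finset.mem_Icc]; omega⟩
    rw [Finset.mem_Icc] at hc
    refine ⟨c, hc.1, hc.2, ?_⟩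
    have h1 : (Finset.Icc 3 (ℓ - 2)).card • (Finset.univ.filter fun v => F.cid Z v = q ∧ F.dep v % ℓ = c).card
        ≤ ∑ c ∈ Finset.Icc 3 (ℓ - 2), (Finset.univ.filter fun v => F.cid Z v = q ∧ F.dep v % ℓ = c).card :=
      Finset.card_nsmul_le_sum _ _ _ hmin
    have h2 : ∑ c ∈ Finset.Icc 3 (ℓ - 2), (Finset.univ.filter fun v => F.cid Z v = q ∧ F.dep v % ℓ = c).card
        ≤ (Finset.univ.filter fun v => F.cid Z v = q).card := by
      rw [← Finset.card_biUnion]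
      · apply Finset.card_le_card
        intro v hv
        simp only [Finset.mem_biUnion, Finset.mem_filter, Finset.mem_univ, true_and] at hv ⊢
        obtain ⟨_, _, h, _⟩ := hv
        exact h
      · intro x _ y _ hxy
        rw [Function.onFun, Finset.disjoint_left]
        intro v hv hv'
        simp only [Finset.mem_filter, Finset.mem_univ, true_and] at hv hv'
        exact hxy (hv.2.symm.trans hv'.2)
    have h3 : (Finset.Icc 3 (ℓ - 2)).card = ℓ - 4 := by rw [Nat.card_Icc]; omega
    rw [h3, smul_eq_mul] at h1
    rw [mul_comm]; exact le_trans h1 h2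
  choose c hc3 hcl hcc using hc
  obtain ⟨kind, hk⟩ : ∃ kind : N → Fin 4, ∀ v, kind v = if v ∈ Z then 2 else
      if (∃ u, F.par v = some u ∧ u ∈ Z) then 3 else if F.dep v % ℓ = c (F.cid Z v) then 1 else 0 :=
    ⟨_, fun _ => rfl⟩
  have hk2 : ∀ v, kind v = 2 ↔ v ∈ Z := by
    intro v; rw [hk]; split_ifs <;> simp_all
  have hZr : ∀ v, v ∈ Z → F.dep v % ℓ = 0 := fun v hv => Nat.mod_eq_zero_of_dvd (hZ1 v hv)
  have hcr : ∀ v, v ∈ Z → ∀ u, F.par u = some v → F.dep u % ℓ = 1 := by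
    intro v hv u hu
    rw [F.dep_some u v hu, Nat.add_mod, hZr v hv, zero_add, Nat.mod_mod, Nat.mod_eq_of_lt (by omega)]
  have hstep : ∀ v u, F.par v = some u → F.dep v % ℓ = F.dep u % ℓ + 1 ∨
      (F.dep v % ℓ = 0 ∧ F.dep u % ℓ + 1 = ℓ) := by
    intro v u hu
    rw [F.dep_some v u hu]
    have h1 := Nat.mod_lt (F.dep u) (show 0 < ℓ by omega)
    rw [Nat.add_mod, Nat.mod_eq_of_lt (show 1 < ℓ by omega)]
    rcases Nat.lt_or_ge (F.dep u % ℓ + 1) ℓ with h | h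
    · left; exact Nat.mod_eq_of_lt h
    · right
      have : F.dep u % ℓ + 1 = ℓ := by omega
      rw [this]; simp
  have hcid : ∀ v u, F.par v = some u → kind v ≠ 3 → F.cid Z v = F.cid Z u := by
    intro v u hu hv
    rw [F.cid_some Z v u hu]
    split_ifs with huZ
    · exfalso
      rw [hk] at hv
      by_cases hvZ : v ∈ Z
      · have := hcr u huZ v hu
        have := hZr v hvZ
        omega
      · rw [if_neg hvZ, if_pos ⟨u, hu, huZ⟩] at hv
        exact hv rfl
    · rfl
  refine ⟨kind, F.cid Z, fun v => (F.dep v + (ℓ - 1 - c (F.cid Z v))) % ℓ, ?_, hcid, ?_, hZ3, ?_, ?_, ?_, ?_, ?_⟩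
  · intro v u hu
    have hs := hstep v u hu
    by_cases huZ : u ∈ Z
    · have h1 := hcr u huZ v hu
      have hvZ : v ∉ Z := fun h => by have := hZr v h; omega
      have : kind v = 3 := by rw [hk, if_neg hvZ, if_pos ⟨u, hu, huZ⟩]
      have := (hk2 u).2 huZ
      simp_all
    · have h3 : ¬ ∃ u, F.par v = some u ∧ u ∈ Z := by
        rintro ⟨u', h1, h2⟩
        rw [hu] at h1
        cases h1
        exact huZ h2
      have hv3 : kind v ≠ 3 := by
        rw [hk]; simp only [h3, if_false]; split_ifs <;> simp
      have hcc := hcid v u hu hv3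
      have hcl' := hcl (F.cid Z u)
      have hc3' := hc3 (F.cid Z u)
      by_cases hvZ : v ∈ Z
      · have h0 := hZr v hvZ
        have hu0 : kind u = 0 := by
          rw [hk, if_neg huZ]
          have : ¬ ∃ u', F.par u = some u' ∧ u' ∈ Z := by
            rintro ⟨u', h1, h2⟩
            have := hcr u' h2 u h1
            omega
          rw [if_neg this, if_neg]
          omega
        have := (hk2 v).2 hvZ
        simp_all
      · have hv : kind v = if F.dep v % ℓ = c (F.cid Z v) then 1 else 0 := by
          rw [hk, if_neg hvZ, if_neg h3]
        have huu : kind u = if (∃ u', F.par u = some u' ∧ u' ∈ Z) then 3 else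
            if F.dep u % ℓ = c (F.cid Z u) then 1 else 0 := by
          rw [hk, if_neg huZ]
        by_cases hu3 : ∃ u', F.par u = some u' ∧ u' ∈ Z
        · obtain ⟨u', h1, h2⟩ := hu3
          have h4 := hcr u' h2 u h1
          rw [if_pos ⟨u', h1, h2⟩] at huu
          rw [if_neg (by rw [hcc]; omega)] at hv
          simp [hv, huu]
        · rw [if_neg hu3] at huu
          rw [hv, huu, hcc]
          by_cases e1 : F.dep v % ℓ = c (F.cid Z u)
          · have e2 : ¬ F.dep u % ℓ = c (F.cid Z u) := by omega
            simp [e1, e2]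
          · by_cases e2 : F.dep u % ℓ = c (F.cid Z u) <;> simp [e1, e2]
  · intro v
    induction v using F.ind with
    | root v hv => rw [F.cid_root Z v hv]
    | child v u hv ih =>
      rw [F.cid_some Z v u hv]
      split_ifs
      · rfl
      · rw [ih, F.bd_par v u hv]
  · intro q
    refine le_trans (Nat.mul_le_mul_right _ (Finset.card_le_card ?_)) (hcc q)
    intro v hv
    simp only [Finset.mem_filter, Finset.mem_univ, true_and] at hv ⊢
    refine ⟨hv.1, ?_⟩
    have h1 := hv.2
    rw [hk, hv.1] at h1
    split_ifs at h1 <;> simp_all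
  · intro b
    refine le_trans (Nat.mul_le_mul_right _ (Finset.card_le_card ?_)) (hZ2 b)
    intro v hv
    simp only [Finset.mem_filter, Finset.mem_univ, true_and] at hv ⊢
    exact ⟨(hk2 v).1 hv.2, hv.1⟩
  · intro v
    exact Nat.mod_lt _ (by omega)
  · intro v u hu hv0 hu0
    have hcc := hcid v u hu (by rw [hv0]; decide)
    simp only [hcc, F.dep_some v u hu]
    have hne : F.dep u % ℓ ≠ c (F.cid Z u) := by
      intro h
      rw [hk] at hu0
      split_ifs at hu0 <;> simp_all
    have hcl' := hcl (F.cid Z u)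
    have hc3' := hc3 (F.cid Z u)
    set x := F.dep u
    set e := ℓ - 1 - c (F.cid Z u) with he
    have h1 : (x + e) % ℓ + 1 ≠ ℓ := by
      intro h
      apply hne
      have h2 : (x + e + 1) % ℓ = 0 := by
        rw [Nat.add_mod, Nat.mod_eq_of_lt (show 1 < ℓ by omega), h, Nat.mod_self]
      have h3 : (x + e + 1 + c (F.cid Z u)) % ℓ = c (F.cid Z u) := by
        rw [Nat.add_mod, h2, zero_add, Nat.mod_mod, Nat.mod_eq_of_lt (by omega)]
      have h4 : x + e + 1 + c (F.cid Z u) = x + ℓ := by omega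
      rw [h4, Nat.add_mod_right] at h3
      exact h3
    have h2 := Nat.mod_lt (x + e) (show 0 < ℓ by omega)
    rw [show x + 1 + e = (x + e) + 1 by ring, Nat.add_mod, Nat.mod_eq_of_lt (show 1 < ℓ by omega)]
    exact Nat.mod_eq_of_lt (by omega)
  · intro v hv
    rw [hk] at hv
    split_ifs at hv with h1 h2 h3
    all_goals first | (obtain ⟨u, hu, _⟩ := h2; exact ⟨u, hu⟩) | simp at hv

/-- The combined structure produced by cutting and bin packing. -/
structure Cut {N : Type} [Fintype N] {t Δ : ℕ} (F : Forest N t Δ) (ℓ r : ℕ) where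
  kind : N → Fin 4
  sec : N → Fin r
  side : N → Fin 2
  pd : N → ℕ
  kinds : ∀ v u, F.par v = some u → (kind v = 0 ∧ kind u = 0) ∨ (kind v = 0 ∧ kind u = 1) ∨
        (kind v = 0 ∧ kind u = 3) ∨ (kind v = 1 ∧ kind u = 0) ∨ (kind v = 2 ∧ kind u = 0) ∨
        (kind v = 3 ∧ kind u = 2)
  kind3 : ∀ v, kind v = 3 → ∃ u, F.par v = some u
  sec_eq : ∀ v u, F.par v = some u → kind v ≠ 3 → sec v = sec u
  side_ne : ∀ v u, F.par v = some u → kind v ≠ 3 → side v ≠ side u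
  pd_lt : ∀ v, pd v < ℓ
  pd_succ : ∀ v u, F.par v = some u → kind v = 0 → kind u = 0 → pd v = pd u + 1

lemma Forest.exists_Cut (F : Forest N t Δ) (ℓ h r T : ℕ) (hℓ : 6 ≤ ℓ) (hh : 0 < h) (hΔ : 0 < Δ)
    (hr : 0 < r) (hT : ∀ b, (Finset.univ.filter fun v => F.bd v = b).card ≤ T) :
    ∃ C : Cut F ℓ r,
      (∀ b s o, 2 * r * (Finset.univ.filter fun v => F.bd v = b ∧ C.sec v = s ∧ C.side v = o).card
        ≤ T + 2 * r * ((2 * Δ) ^ ℓ * (h + 1))) ∧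
      (∀ b s, (Finset.univ.filter fun v => F.bd v = b ∧ C.sec v = s ∧ C.kind v = 1).card * (ℓ - 4) ≤
        (Finset.univ.filter fun v => F.bd v = b ∧ C.sec v = s).card) ∧
      (∀ b, (Finset.univ.filter fun v => F.bd v = b ∧ C.kind v = 2).card * h ≤ T) := by
  obtain ⟨kind, cid, pd, h1, h2, h3, h4, h5, h6, h7, h8, h9⟩ := F.exists_kinds ℓ h hℓ hh hΔ
  obtain ⟨prt, hprt⟩ : ∃ prt : N → Fin 2, ∀ v, prt v = Fin.ofNat 2 (F.dep v) := ⟨_, fun _ => rfl⟩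
  have hprt' : ∀ v u, F.par v = some u → prt v = prt u + 1 := by
    intro v u hu
    rw [hprt, hprt, F.dep_some v u hu]
    ext
    simp [Fin.val_add]
  have hb : ∀ b, ∃ (sec : N → Fin r) (o : N → Fin 2), ∀ s i,
      2 * r * (∑ q ∈ (Finset.univ.filter fun q => F.bd q = b).filter (fun q => sec q = s),
        (Finset.univ.filter fun v => cid v = q ∧ prt v = i + o q).card) ≤
        T + 2 * r * ((2 * Δ) ^ ℓ * (h + 1)) := by
    intro b
    apply binpack (fun q i => (Finset.univ.filter fun v => cid v = q ∧ prt v = i).card) _ T r hr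
    · intro q _
      refine le_trans (le_of_eq ?_) (h4 q)
      rw [← Finset.card_union_of_disjoint]
      · congr 1
        ext v
        have : prt v = 0 ∨ prt v = 1 := by
          generalize prt v = z; fin_cases z <;> simp
        simp only [Finset.mem_union, Finset.mem_filter, Finset.mem_univ, true_and]
        tauto
      · rw [Finset.disjoint_left]
        intro v hv hv'
        simp only [Finset.mem_filter, Finset.mem_univ, true_and] at hv hv'
        rw [hv.2] at hv'
        exact absurd hv'.2 (by decide)
    · refine le_trans ?_ (hT b)
      have e1 : ∀ q, (Finset.univ.filter fun v => cid v = q ∧ prt v = 0).card +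
          (Finset.univ.filter fun v => cid v = q ∧ prt v = 1).card =
          (Finset.univ.filter fun v => cid v = q).card := by
        intro q
        rw [← Finset.card_union_of_disjoint]
        · congr 1
          ext v
          have : prt v = 0 ∨ prt v = 1 := by
            generalize prt v = z; fin_cases z <;> simp
          simp only [Finset.mem_union, Finset.mem_filter, Finset.mem_univ, true_and]
          tauto
        · rw [Finset.disjoint_left]
          intro v hv hv'
          simp only [Finset.mem_filter, Finset.mem_univ, true_and] at hv hv'
          rw [hv.2] at hv'
          exact absurd hv'.2 (by decide)
      rw [Finset.sum_congr rfl (fun q _ => e1 q)]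
      rw [← Finset.card_biUnion]
      · apply Finset.card_le_card
        intro v hv
        simp only [Finset.mem_biUnion, Finset.mem_filter, Finset.mem_univ, true_and] at hv ⊢
        obtain ⟨q, hq, hv⟩ := hv
        rw [← h3 v, hv, hq]
      · intro x _ y _ hxy
        rw [Function.onFun, Finset.disjoint_left]
        intro v hv hv'
        simp only [Finset.mem_filter, Finset.mem_univ, true_and] at hv hv'
        exact hxy (hv.symm.trans hv')
  choose sec o hso using hb
  refine ⟨⟨kind, fun v => sec (F.bd v) (cid v), fun v => prt v + o (F.bd v) (cid v), pd, h1, h9,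
    ?_, ?_, h7, h8⟩, ?_, ?_, ?_⟩
  · intro v u hu hv
    simp only [h2 v u hu hv, F.bd_par v u hu]
  · intro v u hu hv
    simp only [h2 v u hu hv, F.bd_par v u hu, hprt' v u hu]
    generalize prt u = x
    generalize o (F.bd u) (cid u) = y
    fin_cases x <;> fin_cases y <;> decide
  · intro b s i
    refine le_trans (Nat.mul_le_mul_left _ ?_) (hso b s i)
    rw [← Finset.card_biUnion]
    · apply Finset.card_le_card
      intro v hv
      simp only [Finset.mem_biUnion, Finset.mem_filter, Finset.mem_univ, true_and] at hv ⊢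
      obtain ⟨rfl, hs, hi⟩ := hv
      refine ⟨cid v, ⟨h3 v, hs⟩, rfl, ?_⟩
      rw [← hi]
      generalize prt v = x
      generalize o (F.bd v) (cid v) = y
      fin_cases x <;> fin_cases y <;> decide
    · intro x _ y _ hxy
      rw [Function.onFun, Finset.disjoint_left]
      intro v hv hv'
      simp only [Finset.mem_filter, Finset.mem_univ, true_and] at hv hv'
      exact hxy (hv.1.symm.trans hv'.1)
  · intro b s
    have e1 : ∀ (P : N → Prop), (Finset.univ.filter fun v => F.bd v = b ∧ sec (F.bd v) (cid v) = s ∧ P v).card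
        = ∑ q ∈ Finset.univ.filter (fun q => F.bd q = b ∧ sec b q = s),
          (Finset.univ.filter fun v => cid v = q ∧ P v).card := by
      intro P
      rw [← Finset.card_biUnion]
      · congr 1
        ext v
        simp only [Finset.mem_biUnion, Finset.mem_filter, Finset.mem_univ, true_and]
        constructor
        · rintro ⟨rfl, hs, hP⟩
          exact ⟨cid v, ⟨h3 v, hs⟩, rfl, hP⟩
        · rintro ⟨q, ⟨hq, hs⟩, rfl, hP⟩
          rw [← hq, h3 v] at hs ⊢
          exact ⟨rfl, hs, hP⟩
      · intro x _ y _ hxy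
        rw [Function.onFun, Finset.disjoint_left]
        intro v hv hv'
        simp only [Finset.mem_filter, Finset.mem_univ, true_and] at hv hv'
        exact hxy (hv.1.symm.trans hv'.1)
    have e2 : (Finset.univ.filter fun v => F.bd v = b ∧ sec (F.bd v) (cid v) = s).card
        = ∑ q ∈ Finset.univ.filter (fun q => F.bd q = b ∧ sec b q = s),
          (Finset.univ.filter fun v => cid v = q).card := by
      have := e1 (fun _ => True)
      simp only [and_true] at this
      convert this
    have e3 : (Finset.univ.filter fun v => F.bd v = b ∧ sec (F.bd v) (cid v) = s ∧ kind v = 1).card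
        = ∑ q ∈ Finset.univ.filter (fun q => F.bd q = b ∧ sec b q = s),
          (Finset.univ.filter fun v => cid v = q ∧ kind v = 1).card := by
      convert e1 (fun v => kind v = 1)
    simp only
    rw [e3, e2, Finset.sum_mul]
    exact Finset.sum_le_sum fun q _ => h5 q
  · intro b
    exact le_trans (h6 b) (hT b)

end
end ApproxDecomp

namespace ApproxDecomp
section
open scoped Classical
variable {N : Type} [Fintype N] {t Δ : ℕ}

lemma Cut.exists_pieces {F : Forest N t Δ} {ℓ r : ℕ} (C : Cut F ℓ r) (hΔ : 0 < Δ) :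
    ∃ (rt : N → N) (wd : N → List (Fin Δ)),
      (∀ v, C.kind v = 0 → C.kind (rt v) = 0 ∧ rt (rt v) = rt v ∧ F.bd (rt v) = F.bd v ∧
        C.sec (rt v) = C.sec v) ∧
      (∀ v, (wd v).length < ℓ) ∧
      (∀ v v', rt v = rt v' → wd v = wd v' → v = v') ∧
      (∀ v u, F.par v = some u → C.kind v = 0 → C.kind u = 0 → rt v = rt u ∧ ∃ a, wd v = a :: wd u) ∧
      (∀ v, wd v ≠ [] → ∃ u, F.par v = some u ∧ C.kind u = 0 ∧ C.kind v = 0) := by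
  have hlab : ∃ lab : N → Fin Δ, ∀ v v' u, F.par v = some u → F.par v' = some u → lab v = lab v' → v = v' := by
    have := fun u => exists_injOn_fin (Finset.univ.filter fun v => F.par v = some u) Δ hΔ (F.child_le u)
    choose f hf using this
    refine ⟨fun v => match F.par v with
      | none => ⟨0, hΔ⟩
      | some u => f u v, ?_⟩
    intro v v' u hv hv' h
    simp only [hv, hv'] at h
    exact hf u (by simp [hv]) (by simp [hv']) h
  obtain ⟨lab, hlab⟩ := hlab
  obtain ⟨g, hg1, hg2⟩ := F.exists_rec (fun v => (v, ([] : List (Fin Δ))))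
    (fun v u x => if C.kind v = 0 ∧ C.kind u = 0 then (x.1, lab v :: x.2) else (v, []))
  have hnil : ∀ v, (g v).2 = [] → (g v).1 = v := by
    intro v
    rcases h : F.par v with _ | u
    · simp [hg1 v h]
    · rw [hg2 v u h]
      split_ifs <;> simp
  have hcons : ∀ v a w, (g v).2 = a :: w → ∃ u, F.par v = some u ∧ C.kind u = 0 ∧ C.kind v = 0 ∧
      (g v).1 = (g u).1 ∧ lab v = a ∧ (g u).2 = w := by
    intro v a w
    rcases h : F.par v with _ | u
    · simp [hg1 v h]
    · rw [hg2 v u h]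
      split_ifs with hk
      · intro hw
        simp only [List.cons.injEq] at hw
        exact ⟨u, rfl, hk.2, hk.1, rfl, hw.1, hw.2⟩
      · simp
  refine ⟨fun v => (g v).1, fun v => (g v).2, ?_, ?_, ?_, ?_, ?_⟩
  · intro v
    induction v using F.ind with
    | root v hv => intro h; simp [hg1 v hv, h]
    | child v u hv ih =>
      intro h
      have e := hg2 v u hv
      by_cases hk : C.kind v = 0 ∧ C.kind u = 0
      · rw [if_pos hk] at e
        simp only [e]
        have := ih hk.2
        refine ⟨this.1, this.2.1, ?_, ?_⟩
        · rw [F.bd_par v u hv]; exact this.2.2.1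
        · rw [C.sec_eq v u hv (by rw [h]; decide)]; exact this.2.2.2
      · rw [if_neg hk] at e
        simp [h, e]
  · intro v
    have : (g v).2.length ≤ C.pd v := by
      induction v using F.ind with
      | root v hv => simp [hg1 v hv]
      | child v u hv ih =>
        rw [hg2 v u hv]
        split_ifs with hk
        · have := C.pd_succ v u hv hk.1 hk.2
          simp; omega
        · simp
    exact lt_of_le_of_lt this (C.pd_lt v)
  · have : ∀ (w : List (Fin Δ)) v v', (g v).2 = w → (g v').2 = w → (g v).1 = (g v').1 → v = v' := by
      intro w
      induction w with
      | nil =>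
        intro v v' h1 h2 h3
        rw [← hnil v h1, ← hnil v' h2]; exact h3
      | cons a w ih =>
        intro v v' h1 h2 h3
        obtain ⟨u, hu, _, _, hu1, hu2, hu3⟩ := hcons v a w h1
        obtain ⟨u', hu', _, _, hu1', hu2', hu3'⟩ := hcons v' a w h2
        have : u = u' := ih u u' hu3 hu3' (by rw [← hu1, ← hu1', h3])
        subst this
        exact hlab v v' u hu hu' (hu2.trans hu2'.symm)
    intro v v' h1 h2
    exact this _ v v' rfl h2.symm h1
  · intro v u hu hv hu0
    simp only [hg2 v u hu]
    simp [hv, hu0]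
  · intro v hv
    obtain ⟨a, w, h⟩ := List.exists_cons_of_ne_nil hv
    obtain ⟨u, h1, h2, h3, _⟩ := hcons v a w h
    exact ⟨u, h1, h2, h3⟩

/-- words of length less than `ℓ` -/
noncomputable def Wds (Δ ℓ : ℕ) : Finset (List (Fin Δ)) := (List.finite_length_lt (Fin Δ) ℓ).toFinset

lemma mem_Wds {Δ ℓ : ℕ} (w : List (Fin Δ)) : w ∈ Wds Δ ℓ ↔ w.length < ℓ := by
  simp [Wds]

/-- number of (class, word) pairs -/
noncomputable def Hw (Δ ℓ : ℕ) : ℕ := 2 ^ ((Wds Δ ℓ).card * 4) * (Wds Δ ℓ).card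

lemma grouping {β : Type} (P : Finset N) (rt : N → N) (wd : N → List (Fin Δ)) (bs : N → β)
    (tag : N → Bool × Fin 2) (ℓ n'' : ℕ) (hn : 0 < n'')
    (hrt : ∀ v ∈ P, rt v ∈ P ∧ rt (rt v) = rt v ∧ bs (rt v) = bs v)
    (hlen : ∀ v, (wd v).length < ℓ)
    (hinj : ∀ v v', rt v = rt v' → wd v = wd v' → v = v') :
    ∃ (Sl : Type) (sl : N → Sl),
      (∀ v ∈ P, ∀ v' ∈ P, sl (rt v) = sl (rt v') → bs v = bs v') ∧
      (∀ v ∈ P, ∀ v' ∈ P, sl (rt v) = sl (rt v') → wd v = wd v' → tag v = tag v') ∧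
      (∀ x, (P.filter fun q => rt q = q ∧ sl q = x).card ≤ n'') ∧
      (∀ b (T : List (Fin Δ) → Bool × Fin 2 → Prop),
        ((P.filter fun v => bs v = b ∧ T (wd v) (tag v)).image fun v => (sl (rt v), wd v)).card * n'' ≤
          (P.filter fun v => bs v = b ∧ T (wd v) (tag v)).card + Hw Δ ℓ * n'') := by
  set γ : N → Finset (List (Fin Δ) × (Bool × Fin 2)) := fun q =>
    (P.filter fun v => rt v = q).image fun v => (wd v, tag v) with hγ
  have hgr := fun (b : β) (g : Finset (List (Fin Δ) × (Bool × Fin 2))) =>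
    exists_groups (P.filter fun q => rt q = q ∧ bs q = b ∧ γ q = g) n'' hn
  choose j hj1 hj2 using hgr
  have hγmem : ∀ v ∈ P, (wd v, tag v) ∈ γ (rt v) := by
    intro v hv
    rw [hγ]
    exact Finset.mem_image.2 ⟨v, Finset.mem_filter.2 ⟨hv, rfl⟩, rfl⟩
  refine ⟨β × Finset (List (Fin Δ) × (Bool × Fin 2)) × ℕ,
    fun q => (bs q, γ q, j (bs q) (γ q) q), ?_, ?_, ?_, ?_⟩
  · intro v hv v' hv' h
    simp only [Prod.mk.injEq] at h
    rw [← (hrt v hv).2.2, ← (hrt v' hv').2.2]; exact h.1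
  · intro v hv v' hv' h hw
    simp only [Prod.mk.injEq] at h
    have h1 := hγmem v hv
    rw [h.2.1] at h1
    obtain ⟨v'', hv'', h2⟩ := Finset.mem_image.1 h1
    rw [Finset.mem_filter] at hv''
    simp only [Prod.mk.injEq] at h2
    have : v'' = v' := hinj _ _ hv''.2 (by rw [h2.1, hw])
    rw [← h2.2, this]
  · rintro ⟨b, g, m⟩
    refine le_trans (Finset.card_le_card ?_) (hj1 b g m)
    intro q hq
    simp only [Finset.mem_filter, Prod.mk.injEq] at hq ⊢
    obtain ⟨h1, h2, h3, h4, h5⟩ := hq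
    subst h3 h4
    exact ⟨⟨h1, h2, rfl, rfl⟩, h5⟩
  · intro b T
    set A := P.filter fun v => bs v = b ∧ T (wd v) (tag v) with hA
    set KS := A.image fun v => ((bs (rt v), γ (rt v), j (bs (rt v)) (γ (rt v)) (rt v)), wd v) with hKS
    set I := (Finset.powerset (Wds Δ ℓ ×ˢ (Finset.univ : Finset (Bool × Fin 2)))) ×ˢ Wds Δ ℓ with hI
    have hIc : I.card = Hw Δ ℓ := by
      rw [hI, Finset.card_product, Finset.card_powerset, Finset.card_product]
      simp [Hw]
    have hmapK : ∀ κ ∈ KS, (κ.1.2.1, κ.2) ∈ I := by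
      intro κ hκ
      obtain ⟨v, hv, rfl⟩ := Finset.mem_image.1 hκ
      rw [hI, Finset.mem_product, Finset.mem_powerset]
      refine ⟨?_, (mem_Wds _).2 (hlen v)⟩
      intro x hx
      obtain ⟨u, _, rfl⟩ := Finset.mem_image.1 hx
      simp [mem_Wds, hlen]
    have hmapA : ∀ v ∈ A, (γ (rt v), wd v) ∈ I := by
      intro v hv
      exact hmapK _ (Finset.mem_image_of_mem _ hv)
    rw [Finset.card_eq_sum_card_fiberwise hmapK, Finset.card_eq_sum_card_fiberwise hmapA, ← hIc,
      Finset.sum_mul, Finset.card_eq_sum_ones I, Finset.sum_mul, ← Finset.sum_add_distrib]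
    apply Finset.sum_le_sum
    rintro ⟨g, w⟩ _
    rcases (A.filter fun v => (γ (rt v), wd v) = (g, w)).eq_empty_or_nonempty with he | ⟨v0, hv0⟩
    · have : (KS.filter fun κ => (κ.1.2.1, κ.2) = (g, w)) = ∅ := by
        apply Finset.filter_false_of_mem
        intro κ hκ h
        obtain ⟨v, hv, rfl⟩ := Finset.mem_image.1 hκ
        have : v ∈ (A.filter fun v => (γ (rt v), wd v) = (g, w)) := Finset.mem_filter.2 ⟨hv, h⟩
        rw [he] at this; simp at this
      rw [this]; simp
    · rw [Finset.mem_filter, hA, Finset.mem_filter, Prod.mk.injEq] at hv0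
      obtain ⟨⟨hv0P, hv0b, hv0T⟩, hv0g, hv0w⟩ := hv0
      set Gq := P.filter fun q => rt q = q ∧ bs q = b ∧ γ q = g with hGq
      have h1 : Gq.card ≤ (A.filter fun v => (γ (rt v), wd v) = (g, w)).card := by
        have : Gq ⊆ (A.filter fun v => (γ (rt v), wd v) = (g, w)).image rt := by
          intro q hq
          rw [hGq, Finset.mem_filter] at hq
          obtain ⟨hqP, hqr, hqb, hqg⟩ := hq
          have h2 := hγmem v0 hv0P
          rw [hv0g, ← hqg] at h2
          obtain ⟨v, hv, h3⟩ := Finset.mem_image.1 h2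
          rw [Finset.mem_filter] at hv
          simp only [Prod.mk.injEq] at h3
          rw [Finset.mem_image]
          refine ⟨v, ?_, hv.2⟩
          rw [Finset.mem_filter, hA, Finset.mem_filter, Prod.mk.injEq]
          refine ⟨⟨hv.1, ?_, ?_⟩, ?_, ?_⟩
          · rw [← (hrt v hv.1).2.2, hv.2, hqb]
          · rw [h3.1, h3.2]; exact hv0T
          · rw [hv.2, hqg]
          · rw [h3.1, hv0w]
        exact le_trans (Finset.card_le_card this) Finset.card_image_le
      have h2 : (KS.filter fun κ => (κ.1.2.1, κ.2) = (g, w)).card ≤ Gq.card / n'' + 1 := by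
        rw [← Finset.card_range (Gq.card / n'' + 1)]
        apply Finset.card_le_card_of_injOn (fun κ => κ.1.2.2)
        · intro κ hκ
          rw [Finset.mem_coe, Finset.mem_filter] at hκ
          obtain ⟨hκ, hκ2⟩ := hκ
          obtain ⟨v, hv, rfl⟩ := Finset.mem_image.1 hκ
          simp only [Prod.mk.injEq] at hκ2
          rw [hA, Finset.mem_filter] at hv
          obtain ⟨hvP, hvb, _⟩ := hv
          have h5 := hrt v hvP
          simp only [Finset.coe_range, Set.mem_Iio]
          rw [h5.2.2, hvb, hκ2.1]
          apply hj2 b g (rt v)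
          rw [Finset.mem_filter]
          exact ⟨h5.1, h5.2.1, by rw [h5.2.2, hvb], hκ2.1⟩
        · intro κ hκ κ' hκ' h
          rw [Finset.mem_coe, Finset.mem_filter] at hκ hκ'
          obtain ⟨hκ, hκ2⟩ := hκ
          obtain ⟨hκ', hκ2'⟩ := hκ'
          obtain ⟨v, hv, rfl⟩ := Finset.mem_image.1 hκ
          obtain ⟨v', hv', rfl⟩ := Finset.mem_image.1 hκ'
          simp only [Prod.mk.injEq] at hκ2 hκ2' h ⊢
          rw [hA, Finset.mem_filter] at hv hv'
          refine ⟨⟨?_, ?_, h⟩, ?_⟩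
          · rw [(hrt v hv.1).2.2, (hrt v' hv'.1).2.2, hv.2.1, hv'.2.1]
          · rw [hκ2.1, hκ2'.1]
          · rw [hκ2.2, hκ2'.2]
      calc _ ≤ (Gq.card / n'' + 1) * n'' := Nat.mul_le_mul_right _ h2
        _ ≤ Gq.card + n'' := by rw [add_mul, one_mul]; have := Nat.div_mul_le_self Gq.card n''; omega
        _ ≤ _ := by omega

end
end ApproxDecomp

namespace ApproxDecomp
section
open scoped Classical

lemma sum_card_le {Sh K : Type*} [Fintype Sh] (S : Sh → Finset K) (T : Finset K) (c : ℕ)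
    (hS : ∀ sh, S sh ⊆ T) (h : ∀ κ ∈ T, (Finset.univ.filter fun sh => κ ∈ S sh).card ≤ c) :
    ∑ sh, (S sh).card ≤ T.card * c := by
  have h1 : ∀ sh, (S sh).card = ∑ κ ∈ T, if κ ∈ S sh then 1 else 0 := by
    intro sh
    rw [← Finset.card_filter]
    congr 1
    ext κ
    simp only [Finset.mem_filter]
    exact ⟨fun hκ => ⟨hS sh hκ, hκ⟩, fun hκ => hκ.2⟩
  simp only [h1]
  rw [Finset.sum_comm]
  have h2 := Finset.sum_le_card_nsmul T (fun κ => ∑ sh, if κ ∈ S sh then 1 else 0) c (by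
    intro κ hκ
    rw [← Finset.card_filter]
    exact h κ hκ)
  simpa using h2

lemma arrange {N K : Type} {t r k D₁ : ℕ} (P E M : Finset N) (hE : E ⊆ P) (hM : M ⊆ P)
    (ek : N → K) (bd : N → Fin t) (sec : N → Fin r) (side : N → Fin 2) (pr : N → N)
    (hr : 0 < r) (hk : 0 < k) (hD₁ : 0 < D₁)
    (h1 : ∀ v ∈ P, ∀ v' ∈ P, ek v = ek v' → bd v = bd v' ∧ sec v = sec v' ∧ side v = side v')
    (h2 : ∀ v ∈ E, ∀ v' ∈ P, ek v = ek v' → v' ∈ E ∧ ek (pr v) = ek (pr v'))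
    (hM2 : ∀ v ∈ M, ∀ v' ∈ P, ek v = ek v' → v' ∈ M)
    (h3 : ∀ v ∈ E, pr v ∈ P ∧ bd (pr v) = bd v ∧ sec (pr v) = sec v ∧ side (pr v) ≠ side v)
    (hkeys : ∀ b s o, ((P.filter fun v => bd v = b ∧ sec v = s ∧ side v = o).image ek).card ≤ k)
    (hload : (∑ b, ((E.filter fun v => bd v = b).image ek).card : ℝ) / (r * k ^ 2) +
      Real.sqrt (t * (r * k * k + r * 2 * k)) * (2 * r * k) ≤ D₁) :
    ∃ (sec' : N → Fin r) (part : N → Fin k) (col : N → Fin D₁) (z : Fin t → Fin r),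
      (∀ v, sec' v = sec v + z (bd v)) ∧
      (∀ v ∈ P, ∀ v' ∈ P, ek v = ek v' → part v = part v' ∧ col v = col v') ∧
      (∀ v ∈ P, ∀ v' ∈ P, bd v = bd v' → sec' v = sec' v' → side v = side v' → part v = part v' →
        ek v = ek v') ∧
      (∀ v ∈ E, ∀ v' ∈ E, sec' v = sec' v' →
        (if side v = 0 then part v else part (pr v)) = (if side v' = 0 then part v' else part (pr v')) →
        (if side v = 0 then part (pr v) else part v) = (if side v' = 0 then part (pr v') else part v') →
        col v = col v' → ek v = ek v') ∧
      (∀ s o a, (((M.filter fun v => sec' v = s ∧ side v = o ∧ part v = a).image ek).card : ℝ) ≤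
        (∑ b, ((M.filter fun v => bd v = b).image ek).card : ℝ) / (r * k) +
        Real.sqrt (t * (r * k * k + r * 2 * k)) * (2 * r * k)) := by
  haveI : NeZero r := ⟨hr.ne'⟩
  haveI : NeZero k := ⟨hk.ne'⟩
  have hf := fun b s o => exists_injOn_fin _ k hk (hkeys b s o)
  choose f hf using hf
  obtain ⟨part0, hpart0⟩ : ∃ part0 : N → Fin k, ∀ v, part0 v = f (bd v) (sec v) (side v) (ek v) :=
    ⟨_, fun _ => rfl⟩
  have hp0 : ∀ v ∈ P, ∀ v' ∈ P, ek v = ek v' → part0 v = part0 v' := by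
    intro v hv v' hv' h
    obtain ⟨e1, e2, e3⟩ := h1 v hv v' hv' h
    rw [hpart0, hpart0, e1, e2, e3, h]
  have hp0' : ∀ v ∈ P, ∀ v' ∈ P, bd v = bd v' → sec v = sec v' → side v = side v' → part0 v = part0 v' →
      ek v = ek v' := by
    intro v hv v' hv' e1 e2 e3 h
    rw [hpart0, hpart0, e1, e2, e3] at h
    exact hf (bd v') (sec v') (side v') (Finset.mem_coe.2 (Finset.mem_image_of_mem _ (by simp [hv, e1, e2, e3])))
      (Finset.mem_coe.2 (Finset.mem_image_of_mem _ (by simp [hv']))) h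
  -- the part (before shift) of the end on the given side
  obtain ⟨pe, hpe⟩ : ∃ pe : N → Fin 2 → Fin k, ∀ v o, pe v o = if side v = o then part0 v else part0 (pr v) :=
    ⟨_, fun _ _ => rfl⟩
  have hpe' : ∀ v ∈ E, ∀ v' ∈ E, ek v = ek v' → ∀ o, pe v o = pe v' o := by
    intro v hv v' hv' h o
    have e1 := hp0 v (hE hv) v' (hE hv') h
    have e2 := hp0 (pr v) (h3 v hv).1 (pr v') (h3 v' hv').1 (h2 v hv v' (hE hv') h).2
    rw [hpe, hpe, e1, e2, (h1 v (hE hv) v' (hE hv') h).2.2]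
  -- the counters
  let Sh := Fin r × (Fin 2 → Fin k)
  let Cn := (Fin r × Fin k × Fin k) ⊕ (Fin r × Fin 2 × Fin k)
  let SE : Fin t → Sh → (Fin r × Fin k × Fin k) → Finset K := fun b sh c =>
    (E.filter fun v => bd v = b ∧ sec v + sh.1 = c.1 ∧ pe v 0 + sh.2 0 = c.2.1 ∧ pe v 1 + sh.2 1 = c.2.2).image ek
  let SM : Fin t → Sh → (Fin r × Fin 2 × Fin k) → Finset K := fun b sh c =>
    (M.filter fun v => bd v = b ∧ sec v + sh.1 = c.1 ∧ side v = c.2.1 ∧ part0 v + sh.2 c.2.1 = c.2.2).image ek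
  let x : Fin t → Sh → Cn → ℝ := fun b sh c => match c with
    | Sum.inl c => ((SE b sh c).card : ℝ)
    | Sum.inr c => ((SM b sh c).card : ℝ)
  have hbK : ∀ b, ((P.filter fun v => bd v = b).image ek).card ≤ 2 * r * k := by
    intro b
    have : (P.filter fun v => bd v = b).image ek ⊆ (Finset.univ : Finset (Fin r × Fin 2)).biUnion
        fun so => (P.filter fun v => bd v = b ∧ sec v = so.1 ∧ side v = so.2).image ek := by
      intro κ hκ
      obtain ⟨v, hv, rfl⟩ := Finset.mem_image.1 hκ
      rw [Finset.mem_filter] at hv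
      rw [Finset.mem_biUnion]
      exact ⟨(sec v, side v), Finset.mem_univ _, Finset.mem_image_of_mem _ (by simp [hv])⟩
    refine le_trans (Finset.card_le_card this) (le_trans (Finset.card_biUnion_le_card_mul _ _ k
      (fun so _ => hkeys b so.1 so.2)) ?_)
    simp [mul_comm]
  have hSEsub : ∀ b sh c, SE b sh c ⊆ (E.filter fun v => bd v = b).image ek := by
    intro b sh c
    apply Finset.image_subset_image
    exact Finset.monotone_filter_right _ (fun v _ hv => hv.1)
  have hSMsub : ∀ b sh c, SM b sh c ⊆ (M.filter fun v => bd v = b).image ek := by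
    intro b sh c
    apply Finset.image_subset_image
    exact Finset.monotone_filter_right _ (fun v _ hv => hv.1)
  have hx : ∀ b sh c, 0 ≤ x b sh c ∧ x b sh c ≤ 2 * r * k := by
    intro b sh c
    rcases c with c | c
    · refine ⟨Nat.cast_nonneg _, ?_⟩
      have : (SE b sh c).card ≤ 2 * r * k := le_trans (Finset.card_le_card
        ((hSEsub b sh c).trans (Finset.image_subset_image (Finset.filter_subset_filter _ hE)))) (hbK b)
      show ((SE b sh c).card : ℝ) ≤ 2 * r * k
      exact_mod_cast this
    · refine ⟨Nat.cast_nonneg _, ?_⟩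
      have : (SM b sh c).card ≤ 2 * r * k := le_trans (Finset.card_le_card
        ((hSMsub b sh c).trans (Finset.image_subset_image (Finset.filter_subset_filter _ hM)))) (hbK b)
      show ((SM b sh c).card : ℝ) ≤ 2 * r * k
      exact_mod_cast this
  haveI : Nonempty Sh := ⟨(0, fun _ => 0)⟩
  obtain ⟨sh, hsh⟩ := balance x (2 * r * k) hx
  have hcSh : (Fintype.card Sh : ℝ) = r * k ^ 2 := by simp [Sh]
  have hcCn : (Fintype.card Cn : ℝ) = r * k * k + r * 2 * k := by simp [Cn]; ring
  rw [hcSh, hcCn] at hsh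
  have hrR : (0:ℝ) < r := by exact_mod_cast hr
  have hkR : (0:ℝ) < k := by exact_mod_cast hk
  obtain ⟨sec', hsec'⟩ : ∃ sec' : N → Fin r, ∀ v, sec' v = sec v + (sh (bd v)).1 := ⟨_, fun _ => rfl⟩
  obtain ⟨part, hpart⟩ : ∃ part : N → Fin k, ∀ v, part v = part0 v + (sh (bd v)).2 (side v) := ⟨_, fun _ => rfl⟩
  obtain ⟨ty, hty⟩ : ∃ ty : N → Fin r × Fin k × Fin k, ∀ v, ty v = (sec' v,
      (if side v = 0 then part v else part (pr v)), (if side v = 0 then part (pr v) else part v)) :=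
    ⟨_, fun _ => rfl⟩
  have hside : ∀ x : Fin 2, x = 0 ∨ x = 1 := by intro x; fin_cases x <;> simp
  have htyE : ∀ v ∈ E, ty v = (sec v + (sh (bd v)).1, pe v 0 + (sh (bd v)).2 0, pe v 1 + (sh (bd v)).2 1) := by
    intro v hv
    obtain ⟨e1, e2, e3, e4⟩ := h3 v hv
    rw [hty, hsec', hpe, hpe, hpart, hpart, e2]
    rcases hside (side v) with hs | hs
    · have : side (pr v) = 1 := by
        rcases hside (side (pr v)) with h | h
        · rw [hs, h] at e4; exact absurd rfl e4
        · exact h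
      simp [hs, this]
    · have : side (pr v) = 0 := by
        rcases hside (side (pr v)) with h | h
        · exact h
        · rw [hs, h] at e4; exact absurd rfl e4
      simp [hs, this]
  have hloadE : ∀ c, ((E.filter fun v => ty v = c).image ek).card ≤ D₁ := by
    intro c
    have e1 : (E.filter fun v => ty v = c).image ek ⊆ Finset.univ.biUnion fun b => SE b (sh b) c := by
      intro κ hκ
      obtain ⟨v, hv, rfl⟩ := Finset.mem_image.1 hκ
      rw [Finset.mem_filter] at hv
      obtain ⟨hv, hvc⟩ := hv
      rw [htyE v hv] at hvc
      rw [Finset.mem_biUnion]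
      refine ⟨bd v, Finset.mem_univ _, Finset.mem_image_of_mem _ ?_⟩
      rw [Finset.mem_filter]
      subst hvc
      exact ⟨hv, rfl, rfl, rfl, rfl⟩
    have e2 : ((E.filter fun v => ty v = c).image ek).card ≤ ∑ b, (SE b (sh b) c).card :=
      le_trans (Finset.card_le_card e1) Finset.card_biUnion_le
    have e3 : (((E.filter fun v => ty v = c).image ek).card : ℝ) ≤ ∑ b, ((SE b (sh b) c).card : ℝ) := by
      exact_mod_cast e2
    have e4 := hsh (Sum.inl c)
    have e5 : ∀ b, (∑ s, x b s (Sum.inl c)) ≤ (((E.filter fun v => bd v = b).image ek).card : ℝ) := by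
      intro b
      have := sum_card_le (fun s => SE b s c) ((E.filter fun v => bd v = b).image ek) 1
        (fun s => hSEsub b s c) (by
          intro κ _
          rw [Finset.card_le_one]
          intro s hs s' hs'
          rw [Finset.mem_filter] at hs hs'
          obtain ⟨v, hv, hvκ⟩ := Finset.mem_image.1 hs.2
          obtain ⟨v', hv', hvκ'⟩ := Finset.mem_image.1 hs'.2
          rw [Finset.mem_filter] at hv hv'
          obtain ⟨hvE, _, a1, a2, a3⟩ := hv
          obtain ⟨hvE', _, a1', a2', a3'⟩ := hv'
          have hek : ek v = ek v' := hvκ.trans hvκ'.symm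
          rw [← (h1 v (hE hvE) v' (hE hvE') hek).2.1, ← a1] at a1'
          rw [← hpe' v hvE v' hvE' hek, ← a2] at a2'
          rw [← hpe' v hvE v' hvE' hek, ← a3] at a3'
          refine Prod.ext (add_left_cancel a1').symm ?_
          funext o
          rcases hside o with rfl | rfl
          · exact (add_left_cancel a2').symm
          · exact (add_left_cancel a3').symm)
      rw [mul_one] at this
      simp only [x]
      exact_mod_cast this
    have e6 : ∑ b, (∑ s, x b s (Sum.inl c)) / ((r:ℝ) * k ^ 2) ≤
        (∑ b, ((E.filter fun v => bd v = b).image ek).card : ℝ) / (r * k ^ 2) := by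
      rw [Finset.sum_div]
      apply Finset.sum_le_sum
      intro b _
      apply div_le_div_of_nonneg_right (e5 b) (by positivity)
    have e7 : (((E.filter fun v => ty v = c).image ek).card : ℝ) ≤ D₁ := by
      have : ∑ b, x b (sh b) (Sum.inl c) = ∑ b, ((SE b (sh b) c).card : ℝ) := rfl
      linarith
    exact_mod_cast e7
  have hcol := fun c => exists_injOn_fin _ D₁ hD₁ (hloadE c)
  choose g hg using hcol
  have htyek : ∀ v ∈ E, ∀ v' ∈ E, ek v = ek v' → ty v = ty v' := by
    intro v hv v' hv' h
    obtain ⟨a1, a2, a3⟩ := h1 v (hE hv) v' (hE hv') h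
    rw [htyE v hv, htyE v' hv', a1, a2, hpe' v hv v' hv' h, hpe' v hv v' hv' h]
  refine ⟨sec', part, fun v => if v ∈ E then g (ty v) (ek v) else ⟨0, hD₁⟩, fun b => (sh b).1, hsec', ?_, ?_, ?_, ?_⟩
  · intro v hv v' hv' h
    obtain ⟨a1, a2, a3⟩ := h1 v hv v' hv' h
    refine ⟨?_, ?_⟩
    · rw [hpart, hpart, hp0 v hv v' hv' h, a1, a3]
    · by_cases hvE : v ∈ E
      · have hvE' := (h2 v hvE v' hv' h).1
        simp only [hvE, hvE', if_true]
        rw [htyek v hvE v' hvE' h, h]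
      · have hvE' : v' ∉ E := fun hh => hvE (h2 v' hh v hv h.symm).1
        simp [hvE, hvE']
  · intro v hv v' hv' a1 a2 a3 a4
    rw [hsec', hsec', a1] at a2
    rw [hpart, hpart, a1, a3] at a4
    exact hp0' v hv v' hv' a1 (add_right_cancel a2) a3 (add_right_cancel a4)
  · intro v hv v' hv' a1 a2 a3 a4
    simp only [hv, hv', if_true] at a4
    have : ty v = ty v' := by rw [hty, hty, a1, a2, a3]
    rw [this] at a4
    exact hg (ty v') (Finset.mem_coe.2 (Finset.mem_image_of_mem _ (by simp [hv, this])))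
      (Finset.mem_coe.2 (Finset.mem_image_of_mem _ (by simp [hv']))) a4
  · intro s o a
    set c : Fin r × Fin 2 × Fin k := (s, o, a) with hc
    have e1 : (M.filter fun v => sec' v = s ∧ side v = o ∧ part v = a).image ek ⊆
        Finset.univ.biUnion fun b => SM b (sh b) c := by
      intro κ hκ
      obtain ⟨v, hv, rfl⟩ := Finset.mem_image.1 hκ
      rw [Finset.mem_filter] at hv
      obtain ⟨hv, hv1, hv2, hv3⟩ := hv
      rw [Finset.mem_biUnion]
      refine ⟨bd v, Finset.mem_univ _, Finset.mem_image_of_mem _ ?_⟩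
      rw [Finset.mem_filter]
      refine ⟨hv, rfl, ?_, hv2, ?_⟩
      · rw [← hsec']; exact hv1
      · rw [hc]; simp only; rw [← hv2, ← hpart]; exact hv3
    have e2 := le_trans (Finset.card_le_card e1) Finset.card_biUnion_le
    have e3 : (((M.filter fun v => sec' v = s ∧ side v = o ∧ part v = a).image ek).card : ℝ) ≤
        ∑ b, ((SM b (sh b) c).card : ℝ) := by exact_mod_cast e2
    have e4 := hsh (Sum.inr c)
    have e5 : ∀ b, (∑ s, x b s (Sum.inr c)) ≤ (((M.filter fun v => bd v = b).image ek).card : ℝ) * k := by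
      intro b
      have := sum_card_le (fun s => SM b s c) ((M.filter fun v => bd v = b).image ek) k
        (fun s => hSMsub b s c) (by
          intro κ _
          refine le_trans (Finset.card_le_card_of_injOn (t := (Finset.univ : Finset (Fin k)))
            (fun s => s.2 (1 + o)) (by simp) ?_) (by simp)
          intro s hs s' hs' hss
          rw [Finset.mem_coe, Finset.mem_filter] at hs hs'
          obtain ⟨v, hv, hvκ⟩ := Finset.mem_image.1 hs.2
          obtain ⟨v', hv', hvκ'⟩ := Finset.mem_image.1 hs'.2
          rw [Finset.mem_filter] at hv hv'
          obtain ⟨hvE, _, a1, a2, a3⟩ := hv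
          obtain ⟨hvE', _, a1', a2', a3'⟩ := hv'
          have hek : ek v = ek v' := hvκ.trans hvκ'.symm
          rw [← (h1 v (hM hvE) v' (hM hvE') hek).2.1, ← a1] at a1'
          rw [← hp0 v (hM hvE) v' (hM hvE') hek, ← a3] at a3'
          refine Prod.ext (add_left_cancel a1').symm ?_
          have a4 := (add_left_cancel a3').symm
          simp only [hc] at a4 hss
          funext o'
          rcases hside o with rfl | rfl <;> rcases hside o' with rfl | rfl
          · exact a4
          · exact hss
          · exact hss
          · exact a4)
      simp only [x]
      exact_mod_cast this
    have e6 : ∑ b, (∑ s, x b s (Sum.inr c)) / ((r:ℝ) * k ^ 2) ≤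
        (∑ b, ((M.filter fun v => bd v = b).image ek).card : ℝ) / (r * k) := by
      rw [Finset.sum_div]
      apply Finset.sum_le_sum
      intro b _
      refine le_trans (div_le_div_of_nonneg_right (e5 b) (by positivity)) (le_of_eq ?_)
      field_simp
    have : ∑ b, x b (sh b) (Sum.inr c) = ∑ b, ((SM b (sh b) c).card : ℝ) := rfl
    linarith

end
end ApproxDecomp

namespace ApproxDecomp
section
open scoped Classical

variable {N : Type} [Fintype N] {t Δ : ℕ}

/-- neighbours in the forest -/
noncomputable def Forest.nbr (F : Forest N t Δ) (x : N) : Finset N :=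
  Finset.univ.filter fun v => F.par v = some x ∨ F.par x = some v

lemma Forest.mem_nbr (F : Forest N t Δ) (x v : N) :
    v ∈ F.nbr x ↔ F.par v = some x ∨ F.par x = some v := by simp [Forest.nbr]

lemma Forest.nbr_card (F : Forest N t Δ) (x : N) : (F.nbr x).card ≤ Δ + 1 := by
  unfold Forest.nbr
  rw [Finset.filter_or]
  refine le_trans (Finset.card_union_le _ _) (add_le_add (F.child_le x) ?_)
  rw [Finset.card_le_one]
  intro a ha b hb
  rw [Finset.mem_filter] at ha hb
  have := ha.2.symm.trans hb.2
  exact Option.some.inj this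

/-- kind-0 vertices with a kind-1 neighbour -/
def Cut.marked {F : Forest N t Δ} {ℓ r : ℕ} (C : Cut F ℓ r) (v : N) : Prop :=
  C.kind v = 0 ∧ ∃ x, C.kind x = 1 ∧ v ∈ F.nbr x

lemma Cut.marked_card {F : Forest N t Δ} {ℓ r : ℕ} (C : Cut F ℓ r) :
    (Finset.univ.filter fun v => C.marked v).card ≤
      (Finset.univ.filter fun x => C.kind x = 1).card * (Δ + 1) := by
  have : (Finset.univ.filter fun v => C.marked v) ⊆
      (Finset.univ.filter fun x => C.kind x = 1).biUnion fun x => F.nbr x := by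
    intro v hv
    obtain ⟨_, x, hx, hv⟩ := (Finset.mem_filter.1 hv).2
    exact Finset.mem_biUnion.2 ⟨x, by simp [hx], hv⟩
  exact le_trans (Finset.card_le_card this) (Finset.card_biUnion_le_card_mul _ _ _ fun x _ => F.nbr_card x)

structure Placement {W : Type} (G : SimpleGraph W) {F : Forest N t Δ} {ℓ r : ℕ} (C : Cut F ℓ r)
    (rt : N → N) (wd : N → List (Fin Δ)) (Vs : Fin r → Fin 2 → Finset W) (n k n' n'' : ℕ) (β θ : ℝ) where
  Sl : Type
  sl : N → Sl
  sec' : N → Fin r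
  place : N → Fin n' → W
  bad : N → Finset (Fin n')
  R : Fin r → Fin 2 → Finset W
  sec_iff : ∀ v v', F.bd v = F.bd v' → (C.sec v = C.sec v' ↔ sec' v = sec' v')
  R_sub : ∀ s o, R s o ⊆ Vs s o
  R_card : ∀ s o, (R s o).card + k * n' = n
  place_mem : ∀ v y, place v y ∈ Vs (sec' v) (C.side v)
  place_not : ∀ v y s o, place v y ∉ R s o
  place_inj : ∀ v, Function.Injective (place v)
  bundle_inj : ∀ v v' y y', C.kind v = 0 → C.kind v' = 0 → F.bd v = F.bd v' → place v y = place v' y' →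
    sl (rt v) = sl (rt v') ∧ wd v = wd v' ∧ y = y'
  fiber : ∀ x, (Finset.univ.filter fun q => C.kind q = 0 ∧ rt q = q ∧ sl q = x).card ≤ n''
  bad_card : ∀ v, ((bad v).card : ℝ) ≤ β * n'
  adj : ∀ v u y, F.par v = some u → C.kind v = 0 → C.kind u = 0 → y ∉ bad v → G.Adj (place v y) (place u y)
  edge_inj : ∀ v u v' u' y y', F.par v = some u → C.kind v = 0 → C.kind u = 0 →
    F.par v' = some u' → C.kind v' = 0 → C.kind u' = 0 → y ∉ bad v → y' ∉ bad v' →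
    s(place v y, place u y) = s(place v' y', place u' y') →
    sl (rt v) = sl (rt v') ∧ wd v = wd v' ∧ y = y'
  mark : ∀ w, ((Finset.univ.filter fun b => ∃ v, C.marked v ∧ F.bd v = b ∧ ∃ y, place v y = w).card : ℝ) ≤ θ * n

lemma exists_pt {W : Type} (A : Finset W) (n k n' : ℕ) (hA : A.card = n) (h : k * n' ≤ n) :
    ∃ (p : Fin k → Fin n' → W), (∀ a i, p a i ∈ A) ∧ (∀ a i a' i', p a i = p a' i' → a = a' ∧ i = i') := by
  have : Fintype.card (Fin k × Fin n') ≤ Fintype.card A := by simp [hA, h]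
  obtain ⟨e⟩ := Function.Embedding.nonempty_of_card_le this
  refine ⟨fun a i => (e (a, i)).1, fun a i => (e (a, i)).2, ?_⟩
  intro a i a' i' h
  have := e.injective (Subtype.ext h)
  exact Prod.mk.inj this

set_option maxHeartbeats 1000000 in
lemma exists_placement {W : Type} (G : SimpleGraph W) {F : Forest N t Δ} {ℓ r : ℕ} (C : Cut F ℓ r)
    (rt : N → N) (wd : N → List (Fin Δ))
    (hp1 : ∀ v, C.kind v = 0 → C.kind (rt v) = 0 ∧ rt (rt v) = rt v ∧ F.bd (rt v) = F.bd v ∧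
        C.sec (rt v) = C.sec v)
    (hp2 : ∀ v, (wd v).length < ℓ)
    (hp3 : ∀ v v', rt v = rt v' → wd v = wd v' → v = v')
    (hp4 : ∀ v u, F.par v = some u → C.kind v = 0 → C.kind u = 0 → rt v = rt u ∧ ∃ a, wd v = a :: wd u)
    (hp5 : ∀ v, wd v ≠ [] → ∃ u, F.par v = some u ∧ C.kind u = 0 ∧ C.kind v = 0)
    (Vs : Fin r → Fin 2 → Finset W) (n k n' n'' D₁ : ℕ) (ε d β θ : ℝ)
    (hdisj : ∀ (s : Fin r) (i : Fin 2) (s' : Fin r) (i' : Fin 2),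
            (s, i) ≠ (s', i') → Disjoint (Vs s i) (Vs s' i'))
    (hcard : ∀ s i, (Vs s i).card = n)
    (hreg : ∀ s, IsRegularPair G (Vs s 0) (Vs s 1) ε d)
    (hr : 0 < r) (hk : 0 < k) (hn' : 0 < n') (hn'' : 0 < n'') (hD₁ : 0 < D₁) (hkn : k * n' ≤ n)
    (hε : 0 < ε) (hd : 0 < d) (hβ : 0 < β) (hεn : ε * n ≤ n')
    (hDβ : D₁ + 4 * ε * n / β ≤ d * n' - 1)
    (hsz : ∀ b s o, (Finset.univ.filter fun v => F.bd v = b ∧ C.sec v = s ∧ C.side v = o).card + Hw Δ ℓ * n''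
      ≤ k * n'')
    (hload : ((Finset.univ.filter fun v => F.par v ≠ none).card / n'' + t * r * Hw Δ ℓ : ℝ) / (r * k ^ 2) +
      Real.sqrt (t * (r * k * k + r * 2 * k)) * (2 * r * k) ≤ D₁)
    (hmark : ((Finset.univ.filter fun x => C.kind x = 1).card * (Δ + 1) / n'' + t * r * Hw Δ ℓ : ℝ) / (r * k) +
      Real.sqrt (t * (r * k * k + r * 2 * k)) * (2 * r * k) ≤ θ * n) :
    Nonempty (Placement G C rt wd Vs n k n' n'' β θ) := by
  have hrR : (0:ℝ) < r := by exact_mod_cast hr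
  have hkR : (0:ℝ) < k := by exact_mod_cast hk
  have hnR : (0:ℝ) < n'' := by exact_mod_cast hn''
  have hside : ∀ x : Fin 2, x = 0 ∨ x = 1 := by intro x; fin_cases x <;> simp
  obtain ⟨P, hP⟩ : ∃ P : Finset N, ∀ v, v ∈ P ↔ C.kind v = 0 :=
    ⟨Finset.univ.filter fun v => C.kind v = 0, fun v => by simp⟩
  obtain ⟨tag, htag⟩ : ∃ tag : N → Bool × Fin 2, ∀ v, tag v = (decide (C.marked v), C.side v) :=
    ⟨_, fun _ => rfl⟩
  obtain ⟨bs, hbs⟩ : ∃ bs : N → Fin t × Fin r, ∀ v, bs v = (F.bd v, C.sec v) := ⟨_, fun _ => rfl⟩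
  obtain ⟨Sl, sl, hs1, hs2, hs3, hs4⟩ := grouping P rt wd bs tag ℓ n'' hn'' (by
    intro v hv
    rw [hP] at hv
    obtain ⟨a1, a2, a3, a4⟩ := hp1 v hv
    exact ⟨(hP _).2 a1, a2, by rw [hbs, hbs, a3, a4]⟩) hp2 hp3
  obtain ⟨K, ek, hek, hs4⟩ : ∃ (K : Type) (ek : N → K),
      (∀ v v', ek v = ek v' ↔ sl (rt v) = sl (rt v') ∧ wd v = wd v') ∧
      (∀ b (T : N → Prop) (_ : ∃ T' : List (Fin Δ) → Bool × Fin 2 → Prop, ∀ v, T v ↔ T' (wd v) (tag v)),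
        ((P.filter fun v => bs v = b ∧ T v).image ek).card * n'' ≤
          (P.filter fun v => bs v = b ∧ T v).card + Hw Δ ℓ * n'') := by
    refine ⟨Sl × List (Fin Δ), fun v => (sl (rt v), wd v), fun v v' => Prod.mk.injEq _ _ _ _ ▸ Iff.rfl, ?_⟩
    rintro b T ⟨T', hT⟩
    have := hs4 b T'
    simp only [hT]
    convert this
  obtain ⟨pr, hpr⟩ : ∃ pr : N → N, ∀ v u, F.par v = some u → pr v = u := by
    refine ⟨fun v => (F.par v).getD v, fun v u h => ?_⟩
    simp [h]
  obtain ⟨E, hE⟩ : ∃ E : Finset N, ∀ v, v ∈ E ↔ wd v ≠ [] :=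
    ⟨Finset.univ.filter fun v => wd v ≠ [], fun v => by simp⟩
  obtain ⟨Mk, hMk⟩ : ∃ Mk : Finset N, ∀ v, v ∈ Mk ↔ C.marked v :=
    ⟨Finset.univ.filter fun v => C.marked v, fun v => by simp⟩
  have hEE : ∀ v ∈ E, F.par v = some (pr v) ∧ C.kind (pr v) = 0 ∧ C.kind v = 0 := by
    intro v hv
    obtain ⟨u, h1, h2, h3⟩ := hp5 v ((hE v).1 hv)
    rw [hpr v u h1]
    exact ⟨h1, h2, h3⟩
  have hEE' : ∀ v u, F.par v = some u → C.kind v = 0 → C.kind u = 0 → v ∈ E ∧ pr v = u := by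
    intro v u h1 h2 h3
    obtain ⟨_, a, ha⟩ := hp4 v u h1 h2 h3
    exact ⟨(hE v).2 (by rw [ha]; simp), hpr v u h1⟩
  have hEP : E ⊆ P := fun v hv => (hP v).2 (hEE v hv).2.2
  have hMP : Mk ⊆ P := fun v hv => (hP v).2 ((hMk v).1 hv).1
  have hA1 : ∀ v ∈ P, ∀ v' ∈ P, ek v = ek v' → F.bd v = F.bd v' ∧ C.sec v = C.sec v' ∧
      tag v = tag v' := by
    intro v hv v' hv' h
    rw [hek] at h
    have h1 := hs1 v hv v' hv' h.1
    rw [hbs, hbs, Prod.mk.injEq] at h1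
    exact ⟨h1.1, h1.2, hs2 v hv v' hv' h.1 h.2⟩
  have hA1' : ∀ v ∈ P, ∀ v' ∈ P, ek v = ek v' → F.bd v = F.bd v' ∧ C.sec v = C.sec v' ∧
      C.side v = C.side v' := by
    intro v hv v' hv' h
    obtain ⟨a, b, c⟩ := hA1 v hv v' hv' h
    rw [htag, htag, Prod.mk.injEq] at c
    exact ⟨a, b, c.2⟩
  have hA2 : ∀ v ∈ E, ∀ v' ∈ P, ek v = ek v' → v' ∈ E ∧ ek (pr v) = ek (pr v') := by
    intro v hv v' hv' h
    rw [hek] at h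
    have hv'E : v' ∈ E := by rw [hE, ← h.2, ← hE]; exact hv
    obtain ⟨a1, a2, a3⟩ := hEE v hv
    obtain ⟨b1, b2, b3⟩ := hEE v' hv'E
    obtain ⟨c1, c, c2⟩ := hp4 _ _ a1 a3 a2
    obtain ⟨e1, e, e2⟩ := hp4 _ _ b1 b3 b2
    refine ⟨hv'E, ?_⟩
    rw [hek, ← c1, ← e1]
    have := h.2
    rw [c2, e2] at this
    exact ⟨h.1, (List.cons.inj this).2⟩
  have hA3 : ∀ v ∈ Mk, ∀ v' ∈ P, ek v = ek v' → v' ∈ Mk := by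
    intro v hv v' hv' h
    obtain ⟨_, _, c⟩ := hA1 v (hMP hv) v' hv' h
    rw [htag, htag, Prod.mk.injEq, decide_eq_decide] at c
    rw [hMk, ← c.1, ← hMk]; exact hv
  have hA4 : ∀ v ∈ E, pr v ∈ P ∧ F.bd (pr v) = F.bd v ∧ C.sec (pr v) = C.sec v ∧ C.side (pr v) ≠ C.side v := by
    intro v hv
    obtain ⟨a1, a2, a3⟩ := hEE v hv
    have hne : C.kind v ≠ 3 := by rw [a3]; decide
    exact ⟨(hP _).2 a2, (F.bd_par _ _ a1).symm, (C.sec_eq _ _ a1 hne).symm, (C.side_ne _ _ a1 hne).symm⟩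
  have hkeys : ∀ b s o, ((P.filter fun v => F.bd v = b ∧ C.sec v = s ∧ C.side v = o).image ek).card ≤ k := by
    intro b s o
    have h1 := hs4 (b, s) (fun v => C.side v = o) ⟨fun _ tg => tg.2 = o, fun v => by rw [htag]⟩
    have e : (P.filter fun v => bs v = (b, s) ∧ C.side v = o) =
        P.filter fun v => F.bd v = b ∧ C.sec v = s ∧ C.side v = o := by
      apply Finset.filter_congr
      intro v _
      rw [hbs, Prod.mk.injEq, and_assoc]
    have h1 : ((P.filter fun v => F.bd v = b ∧ C.sec v = s ∧ C.side v = o).image ek).card * n'' ≤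
        (P.filter fun v => F.bd v = b ∧ C.sec v = s ∧ C.side v = o).card + Hw Δ ℓ * n'' := by
      rw [← e]; convert h1
    have h2 : (P.filter fun v => F.bd v = b ∧ C.sec v = s ∧ C.side v = o).card ≤
        (Finset.univ.filter fun v => F.bd v = b ∧ C.sec v = s ∧ C.side v = o).card :=
      Finset.card_le_card (Finset.filter_subset_filter _ (Finset.subset_univ _))
    have h3 := hsz b s o
    exact Nat.le_of_mul_le_mul_right (h1.trans (by omega)) hn''
  have hgen : ∀ (Q : Finset N) (T : N → Prop)
      (_ : ∃ T' : List (Fin Δ) → Bool × Fin 2 → Prop, ∀ v, T v ↔ T' (wd v) (tag v))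
      (_ : ∀ v, v ∈ Q ↔ v ∈ P ∧ T v),
      (∑ b, ((Q.filter fun v => F.bd v = b).image ek).card : ℝ) ≤ Q.card / n'' + t * r * Hw Δ ℓ := by
    intro Q T hT hQ
    have e1 : ∀ b, ((Q.filter fun v => F.bd v = b).image ek).card * n'' ≤
        ∑ s, ((Q.filter fun v => bs v = (b, s)).card + Hw Δ ℓ * n'') := by
      intro b
      have e2 : (Q.filter fun v => F.bd v = b).image ek ⊆ Finset.univ.biUnion fun s =>
          ((P.filter fun v => bs v = (b, s) ∧ T v).image ek) := by
        intro κ hκ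
        obtain ⟨v, hv, rfl⟩ := Finset.mem_image.1 hκ
        rw [Finset.mem_filter] at hv
        rw [Finset.mem_biUnion]
        refine ⟨C.sec v, Finset.mem_univ _, Finset.mem_image_of_mem _ ?_⟩
        rw [Finset.mem_filter]
        obtain ⟨q1, q2⟩ := (hQ v).1 hv.1
        exact ⟨q1, by rw [hbs, hv.2], q2⟩
      have e3 := (Finset.card_le_card e2).trans Finset.card_biUnion_le
      refine (Nat.mul_le_mul_right n'' e3).trans ?_
      rw [Finset.sum_mul]
      apply Finset.sum_le_sum
      intro s _
      refine (hs4 (b, s) T hT).trans ?_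
      apply Nat.add_le_add_right
      apply Finset.card_le_card
      intro v hv
      rw [Finset.mem_filter] at hv ⊢
      exact ⟨(hQ v).2 ⟨hv.1, hv.2.2⟩, hv.2.1⟩
    have e4 : (∑ b, ((Q.filter fun v => F.bd v = b).image ek).card) * n'' ≤ Q.card + t * r * Hw Δ ℓ * n'' := by
      rw [Finset.sum_mul]
      refine (Finset.sum_le_sum fun b _ => e1 b).trans ?_
      simp only [Finset.sum_add_distrib]
      apply add_le_add
      · rw [← Fintype.sum_prod_type' (f := fun b s => (Q.filter fun v => bs v = (b, s)).card)]
        exact le_of_eq (Finset.card_eq_sum_card_fiberwise (f := bs) (t := Finset.univ) (by simp)).symm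
      · simp only [Finset.sum_const, Finset.card_univ, Fintype.card_fin, smul_eq_mul]
        exact le_of_eq (by ring)
    have e5 : ((∑ b, ((Q.filter fun v => F.bd v = b).image ek).card : ℕ) : ℝ) * n'' ≤
        Q.card + t * r * Hw Δ ℓ * n'' := by exact_mod_cast e4
    push_cast at e5
    rw [div_add' _ _ _ hnR.ne', le_div_iff₀ hnR]
    exact e5
  have hE1 := hgen E (fun v => wd v ≠ []) ⟨fun w _ => w ≠ [], fun v => Iff.rfl⟩ (by
    intro v
    rw [hE]
    exact ⟨fun h => ⟨hEP ((hE v).2 h), h⟩, fun h => h.2⟩)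
  have hM1 := hgen Mk (fun v => C.marked v) ⟨fun _ tg => tg.1 = true, fun v => by rw [htag]; simp⟩ (by
    intro v
    rw [hMk]
    exact ⟨fun h => ⟨hMP ((hMk v).2 h), h⟩, fun h => h.2⟩)
  have hEc : (E.card : ℝ) ≤ (Finset.univ.filter fun v => F.par v ≠ none).card := by
    have : E ⊆ Finset.univ.filter fun v => F.par v ≠ none := by
      intro v hv
      rw [Finset.mem_filter, (hEE v hv).1]
      simp
    exact_mod_cast Finset.card_le_card this
  have hMc : (Mk.card : ℝ) ≤ (Finset.univ.filter fun x => C.kind x = 1).card * (Δ + 1) := by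
    have : Mk = Finset.univ.filter fun v => C.marked v := by ext v; simp [hMk]
    rw [this]
    exact_mod_cast C.marked_card
  obtain ⟨sec', part, col, z, g1, g2, g3, g4, g5⟩ := arrange (D₁ := D₁) P E Mk hEP hMP ek F.bd C.sec C.side pr hr hk hD₁
    hA1' hA2 hA3 hA4 hkeys (by
      refine le_trans ?_ hload
      have : (E.card : ℝ) / n'' ≤ (Finset.univ.filter fun v => F.par v ≠ none).card / n'' :=
        div_le_div_of_nonneg_right hEc hnR.le
      gcongr
      linarith)
  have g5' : ∀ s o a, (((Mk.filter fun v => sec' v = s ∧ C.side v = o ∧ part v = a).image ek).card : ℝ) ≤ θ * n := by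
    intro s o a
    refine (g5 s o a).trans (le_trans ?_ hmark)
    have : (Mk.card : ℝ) / n'' ≤ (Finset.univ.filter fun x => C.kind x = 1).card * (Δ + 1) / n'' :=
        div_le_div_of_nonneg_right hMc hnR.le
    gcongr
    linarith
  -- host
  have hpt := fun s o => exists_pt (Vs s o) n k n' (hcard s o) hkn
  choose pt hpt1 hpt2 using hpt
  have hVdet : ∀ w s o s' o', w ∈ Vs s o → w ∈ Vs s' o' → s = s' ∧ o = o' := by
    intro w s o s' o' h h'
    by_contra hne
    have : (s, o) ≠ (s', o') := by
      intro h; rw [Prod.mk.injEq] at h; exact hne h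
    exact Finset.disjoint_left.1 (hdisj _ _ _ _ this) h h'
  have hptinj : ∀ s o a i s' o' a' i', pt s o a i = pt s' o' a' i' → s = s' ∧ o = o' ∧ a = a' ∧ i = i' := by
    intro s o a i s' o' a' i' h
    obtain ⟨rfl, rfl⟩ := hVdet _ _ _ _ _ (hpt1 s o a i) (h ▸ hpt1 s' o' a' i')
    exact ⟨rfl, rfl, hpt2 _ _ _ _ _ _ h⟩
  have hpc := fun (s : Fin r) (a a' : Fin k) => pair_colors (hreg s) n n' D₁ (hcard s 0) (hcard s 1) hε hd
    (pt s 0 a) (pt s 1 a') (fun i i' h => (hpt2 _ _ _ _ _ _ h).2) (fun i i' h => (hpt2 _ _ _ _ _ _ h).2)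
    (hpt1 s 0 a) (hpt1 s 1 a') hεn hn' β hβ hDβ
  choose τ bd0 hb1 hb2 hb3 using hpc
  -- lower and upper end of the edge at `v`
  obtain ⟨lo, hlo⟩ : ∃ lo : N → N, ∀ v, lo v = if C.side v = 0 then v else pr v := ⟨_, fun _ => rfl⟩
  obtain ⟨hi, hhi⟩ : ∃ hi : N → N, ∀ v, hi v = if C.side v = 0 then pr v else v := ⟨_, fun _ => rfl⟩
  obtain ⟨tt, htt⟩ : ∃ tt : N → Equiv.Perm (Fin n'), ∀ v, tt v = τ (sec' v) (part (lo v)) (part (hi v)) (col v) :=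
    ⟨_, fun _ => rfl⟩
  obtain ⟨perm, hm1, hm2⟩ := F.exists_rec (fun _ => (1 : Equiv.Perm (Fin n')))
    (fun v u x => if v ∈ E then (if C.side v = 0 then (tt v)⁻¹ else tt v) * x else 1)
  have hm3 : ∀ v, v ∉ E → perm v = 1 := by
    intro v hv
    rcases h : F.par v with _ | u
    · exact hm1 v h
    · rw [hm2 v u h]; simp [hv]
  have hm4 : ∀ v ∈ E, ∀ y, perm (hi v) y = tt v (perm (lo v) y) := by
    intro v hv y
    have h1 := hm2 v (pr v) (hEE v hv).1
    simp only [hv, if_true] at h1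
    rw [hhi, hlo]
    by_cases h0 : C.side v = 0
    · simp only [h0, if_true] at h1 ⊢
      rw [h1]; simp
    · simp only [h0, if_false] at h1 ⊢
      rw [h1]; simp
  have hlohi : ∀ v ∈ E, (lo v ∈ P ∧ hi v ∈ P) ∧ (sec' (lo v) = sec' v ∧ sec' (hi v) = sec' v) ∧
      C.side (lo v) = 0 ∧ C.side (hi v) = 1 := by
    intro v hv
    obtain ⟨a1, a2, a3, a4⟩ := hA4 v hv
    have a5 : sec' (pr v) = sec' v := by rw [g1, g1, a2, a3]
    rw [hlo, hhi]
    rcases hside (C.side v) with h0 | h0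
    · have : C.side (pr v) = 1 := by
        rcases hside (C.side (pr v)) with h | h
        · rw [h0, h] at a4; exact absurd rfl a4
        · exact h
      simp only [h0, if_true]
      exact ⟨⟨hEP hv, a1⟩, ⟨trivial, a5⟩, trivial, this⟩
    · have : C.side (pr v) = 0 := by
        rcases hside (C.side (pr v)) with h | h
        · exact h
        · rw [h0, h] at a4; exact absurd rfl a4
      have h01 : ¬ ((1 : Fin 2) = 0) := by decide
      simp only [h0, h01, if_false]
      exact ⟨⟨a1, hEP hv⟩, ⟨a5, trivial⟩, this, trivial⟩
  have hsame : ∀ v v', F.bd v = F.bd v' → (C.sec v = C.sec v' ↔ sec' v = sec' v') := by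
    have : NeZero r := ⟨hr.ne'⟩
    intro v v' h
    rw [g1, g1, h]
    constructor
    · intro h; rw [h]
    · exact fun h => add_right_cancel h
  have hlohiek : ∀ v ∈ E, ∀ v' ∈ E, ek v = ek v' → ek (lo v) = ek (lo v') ∧ ek (hi v) = ek (hi v') := by
    intro v hv v' hv' h
    have e1 := (hA2 v hv v' (hEP hv') h).2
    have e2 := (hA1' v (hEP hv) v' (hEP hv') h).2.2
    rw [hlo, hlo, hhi, hhi, e2]
    by_cases h0 : C.side v' = 0 <;> simp [h0, e1, h]
  have hperm : ∀ v, ∀ v' ∈ P, v ∈ P → ek v = ek v' → perm v = perm v' := by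
    intro v
    induction v using F.ind with
    | root v hv =>
      intro v' hv' hvP h
      have h1 : v ∉ E := by
        intro h1; rw [(hEE v h1).1] at hv; exact absurd hv (by simp)
      have h2 : v' ∉ E := by
        intro h2; exact h1 (hA2 v' h2 v hvP h.symm).1
      rw [hm3 v h1, hm3 v' h2]
    | child v u hv ih =>
      intro v' hv' hvP h
      by_cases h1 : v ∈ E
      · obtain ⟨h2, h3⟩ := hA2 v h1 v' hv' h
        have hu := hpr v u hv
        have h4 := hm2 v u hv
        have h5 := hm2 v' (pr v') (hEE v' h2).1
        rw [h4, h5]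
        obtain ⟨c1, c2⟩ := hlohiek v h1 v' h2 h
        obtain ⟨⟨d1, d2⟩, _, _⟩ := hlohi v h1
        obtain ⟨⟨d1', d2'⟩, _, _⟩ := hlohi v' h2
        obtain ⟨f1, f2, f3⟩ := hA1' v hvP v' hv' h
        have htt' : tt v = tt v' := by
          rw [htt, htt, (g2 _ d1 _ d1' c1).1, (g2 _ d2 _ d2' c2).1, (g2 _ hvP _ hv' h).2,
            (hsame v v' f1).1 f2]
        have h6 := ih (pr v') (hA4 v' h2).1 (hu ▸ (hA4 v h1).1) (by rw [← hu]; exact h3)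
        simp only [h1, h2, if_true]
        rw [htt', f3, h6]
      · have h2 : v' ∉ E := by
          intro h2; exact h1 (hA2 v' h2 v hvP h.symm).1
        rw [hm3 v h1, hm3 v' h2]
  obtain ⟨place, hplace⟩ : ∃ place : N → Fin n' → W, ∀ v y, place v y = pt (sec' v) (C.side v) (part v) (perm v y) :=
    ⟨_, fun _ _ => rfl⟩
  obtain ⟨bad, hbad⟩ : ∃ bad : N → Finset (Fin n'), ∀ v, bad v =
      (bd0 (sec' v) (part (lo v)) (part (hi v)) (col v)).image (fun i => (perm (lo v))⁻¹ i) := ⟨_, fun _ => rfl⟩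
  have hbadm : ∀ v y, y ∉ bad v → perm (lo v) y ∉ bd0 (sec' v) (part (lo v)) (part (hi v)) (col v) := by
    intro v y hy h
    apply hy
    rw [hbad]
    exact Finset.mem_image.2 ⟨_, h, by simp⟩
  have hpair : ∀ v ∈ E, ∀ y, s(place v y, place (pr v) y) =
      s(pt (sec' v) 0 (part (lo v)) (perm (lo v) y), pt (sec' v) 1 (part (hi v)) (tt v (perm (lo v) y))) := by
    intro v hv y
    obtain ⟨_, ⟨b1, b2⟩, c1, c2⟩ := hlohi v hv
    rw [← hm4 v hv y]
    have e1 : pt (sec' v) 0 (part (lo v)) (perm (lo v) y) = place (lo v) y := by rw [hplace, b1, c1]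
    have e2 : pt (sec' v) 1 (part (hi v)) (perm (hi v) y) = place (hi v) y := by rw [hplace, b2, c2]
    rw [e1, e2, hlo, hhi]
    by_cases h0 : C.side v = 0
    · simp only [h0, if_true]
    · simp only [h0, if_false]
      exact Sym2.eq_swap
  refine ⟨{
    Sl := Sl, sl := sl, sec' := sec', place := place, bad := bad
    R := fun s o => Vs s o \ (Finset.univ.image fun ai : Fin k × Fin n' => pt s o ai.1 ai.2)
    sec_iff := hsame
    R_sub := fun s o => Finset.sdiff_subset
    R_card := ?_
    place_mem := ?_
    place_not := ?_
    place_inj := ?_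
    bundle_inj := ?_
    fiber := ?_
    bad_card := ?_
    adj := ?_
    edge_inj := ?_
    mark := ?_ }⟩
  · intro s o
    have h1 : (Finset.univ.image fun ai : Fin k × Fin n' => pt s o ai.1 ai.2) ⊆ Vs s o := by
      intro w hw
      obtain ⟨ai, _, rfl⟩ := Finset.mem_image.1 hw
      exact hpt1 _ _ _ _
    have h2 : (Finset.univ.image fun ai : Fin k × Fin n' => pt s o ai.1 ai.2).card = k * n' := by
      rw [Finset.card_image_of_injective]
      · simp
      · intro a b h
        obtain ⟨h1, h2⟩ := hpt2 _ _ _ _ _ _ h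
        exact Prod.ext h1 h2
    have h3 := Finset.card_sdiff_add_card_eq_card h1
    rw [h2, hcard] at h3
    exact h3
  · intro v y
    rw [hplace]; exact hpt1 _ _ _ _
  · intro v y s o h
    rw [Finset.mem_sdiff] at h
    have h1 := hpt1 (sec' v) (C.side v) (part v) (perm v y)
    rw [← hplace] at h1
    obtain ⟨a, b⟩ := hVdet _ _ _ _ _ h.1 h1
    apply h.2
    rw [a, b, hplace]
    exact Finset.mem_image.2 ⟨(part v, perm v y), Finset.mem_univ _, rfl⟩
  · intro v y y' h
    rw [hplace, hplace] at h
    exact (perm v).injective (hptinj _ _ _ _ _ _ _ _ h).2.2.2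
  · intro v v' y y' hv hv' hb h
    rw [hplace, hplace] at h
    obtain ⟨h1, h2, h3, h4⟩ := hptinj _ _ _ _ _ _ _ _ h
    have h5 := g3 v ((hP v).2 hv) v' ((hP v').2 hv') hb h1 h2 h3
    rw [hperm v v' ((hP v').2 hv') ((hP v).2 hv) h5] at h4
    rw [hek] at h5
    exact ⟨h5.1, h5.2, (perm v').injective h4⟩
  · intro x
    convert hs3 x using 2
    ext q
    simp [hP]
  · intro v
    rw [hbad]
    refine le_trans ?_ (hb1 (sec' v) (part (lo v)) (part (hi v)) (col v))
    exact_mod_cast Finset.card_image_le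
  · intro v u y hv hk1 hk2 hy
    obtain ⟨hvE, rfl⟩ := hEE' v u hv hk1 hk2
    have h1 := hb2 _ _ _ _ _ (hbadm v y hy)
    rw [← htt] at h1
    have h2 := hpair v hvE y
    rw [← SimpleGraph.mem_edgeSet] at h1 ⊢
    rw [h2]; exact h1
  · intro v u v' u' y y' hv hk1 hk2 hv' hk1' hk2' hy hy' h
    obtain ⟨hvE, rfl⟩ := hEE' v u hv hk1 hk2
    obtain ⟨hvE', rfl⟩ := hEE' v' u' hv' hk1' hk2'
    rw [hpair v hvE, hpair v' hvE', Sym2.eq_iff] at h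
    rcases h with ⟨e1, e2⟩ | ⟨e1, e2⟩
    swap
    · have := (hptinj _ _ _ _ _ _ _ _ e1).2.1
      exact absurd this (by decide)
    obtain ⟨a1, _, a2, a3⟩ := hptinj _ _ _ _ _ _ _ _ e1
    obtain ⟨_, _, b2, b3⟩ := hptinj _ _ _ _ _ _ _ _ e2
    have q1 := hbadm v y hy
    have q2 := hbadm v' y' hy'
    rw [htt, htt, a1, a2, b2, a3] at b3
    rw [a1, a2, b2, a3] at q1
    have hcol := hb3 _ _ _ _ _ _ q1 q2 b3
    have hekk := g4 v hvE v' hvE' a1 (by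
      rw [hlo, hlo] at a2
      split_ifs at a2 ⊢ <;> exact a2) (by
      rw [hhi, hhi] at b2
      split_ifs at b2 ⊢ <;> exact b2) hcol
    have h6 := (hlohiek v hvE v' hvE' hekk).1
    have h7 := hperm (lo v) (lo v') (hlohi v' hvE').1.1 (hlohi v hvE).1.1 h6
    rw [h7] at a3
    rw [hek] at hekk
    exact ⟨hekk.1, hekk.2, (perm _).injective a3⟩
  · intro w
    have hθ : 0 ≤ θ * n := le_trans (Nat.cast_nonneg _) (g5' ⟨0, hr⟩ 0 ⟨0, hk⟩)
    by_cases hw : ∃ v y, place v y = w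
    swap
    · have : (Finset.univ.filter fun b => ∃ v, C.marked v ∧ F.bd v = b ∧ ∃ y, place v y = w) = ∅ := by
        apply Finset.filter_false_of_mem
        rintro b _ ⟨v, _, _, y, h⟩
        exact hw ⟨v, y, h⟩
      rw [this, Finset.card_empty, Nat.cast_zero]
      exact hθ
    obtain ⟨v0, y0, hw⟩ := hw
    refine le_trans ?_ (g5' (sec' v0) (C.side v0) (part v0))
    have : (Finset.univ.filter fun b => ∃ v, C.marked v ∧ F.bd v = b ∧ ∃ y, place v y = w).card ≤
        ((Mk.filter fun v => sec' v = sec' v0 ∧ C.side v = C.side v0 ∧ part v = part v0).image ek).card := by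
      have hch : ∀ b : Fin t, ∃ v, (∃ v, C.marked v ∧ F.bd v = b ∧ ∃ y, place v y = w) →
          (C.marked v ∧ F.bd v = b ∧ ∃ y, place v y = w) := by
        intro b
        by_cases h : ∃ v, C.marked v ∧ F.bd v = b ∧ ∃ y, place v y = w
        · obtain ⟨v, hv⟩ := h; exact ⟨v, fun _ => hv⟩
        · exact ⟨v0, fun h' => absurd h' h⟩
      choose c hc using hch
      apply Finset.card_le_card_of_injOn (fun b => ek (c b))
      · intro b hb
        rw [Finset.mem_coe, Finset.mem_filter] at hb
        obtain ⟨k1, k2, y, k3⟩ := hc b hb.2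
        apply Finset.mem_image_of_mem
        rw [Finset.mem_filter, hMk]
        rw [← hw, hplace, hplace] at k3
        obtain ⟨l1, l2, l3, _⟩ := hptinj _ _ _ _ _ _ _ _ k3
        exact ⟨k1, l1, l2, l3⟩
      · intro b hb b' hb' h
        rw [Finset.mem_coe, Finset.mem_filter] at hb hb'
        obtain ⟨k1, k2, _⟩ := hc b hb.2
        obtain ⟨k1', k2', _⟩ := hc b' hb'.2
        rw [← k2, ← k2']
        exact (hA1' _ ((hP _).2 k1.1) _ ((hP _).2 k1'.1) h).1
    exact_mod_cast this

end
end ApproxDecomp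

namespace ApproxDecomp
section
open scoped Classical

variable {N : Type} [Fintype N] {t Δ : ℕ}

lemma Cut.one_per_piece {F : Forest N t Δ} {ℓ r : ℕ} (C : Cut F ℓ r)
    (rt : N → N) (wd : N → List (Fin Δ))
    (hp3 : ∀ v v', rt v = rt v' → wd v = wd v' → v = v')
    (hp4 : ∀ v u, F.par v = some u → C.kind v = 0 → C.kind u = 0 → rt v = rt u ∧ ∃ a, wd v = a :: wd u)
    (hp5 : ∀ v, wd v ≠ [] → ∃ u, F.par v = some u ∧ C.kind u = 0 ∧ C.kind v = 0)
    (x v v' : N) (hx : C.kind x ≠ 0) (hv : v ∈ F.nbr x) (hv' : v' ∈ F.nbr x)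
    (hk : C.kind v = 0) (hk' : C.kind v' = 0) (h : rt v = rt v') : v = v' := by
  have top : ∀ v, C.kind v = 0 → ∃ v0, wd v0 = [] ∧ rt v0 = rt v ∧ F.dep v0 ≤ F.dep v := by
    intro v
    induction v using F.ind with
    | root v hv =>
      intro _
      refine ⟨v, ?_, rfl, le_rfl⟩
      by_contra hne
      obtain ⟨u, hu, _⟩ := hp5 v hne
      rw [hv] at hu; exact absurd hu (by simp)
    | child v u hv ih =>
      intro hk
      by_cases hu : C.kind u = 0
      · obtain ⟨v0, a, b, c⟩ := ih hu
        exact ⟨v0, a, by rw [b, (hp4 v u hv hk hu).1], by have := F.dep_some v u hv; omega⟩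
      · refine ⟨v, ?_, rfl, le_rfl⟩
        by_contra hne
        obtain ⟨u', hu', hk', _⟩ := hp5 v hne
        rw [hv] at hu'
        exact hu (Option.some.inj hu' ▸ hk')
  have hnil : ∀ v, F.par v = some x → wd v = [] := by
    intro v hv
    by_contra hne
    obtain ⟨u, hu, hk, _⟩ := hp5 v hne
    rw [hv] at hu
    exact hx (Option.some.inj hu ▸ hk)
  have mix : ∀ v v', F.par v = some x → F.par x = some v' → C.kind v' = 0 → rt v = rt v' → False := by
    intro v v' h1 h2 h3 h4
    obtain ⟨v0, a, b, c⟩ := top v' h3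
    have : v0 = v := hp3 _ _ (b.trans h4.symm) (a.trans (hnil v h1).symm)
    rw [this] at c
    have := F.dep_some _ _ h1
    have := F.dep_some _ _ h2
    omega
  rw [F.mem_nbr] at hv hv'
  rcases hv with hv | hv <;> rcases hv' with hv' | hv'
  · exact hp3 _ _ h ((hnil _ hv).trans (hnil _ hv').symm)
  · exact (mix v v' hv hv' hk' h).elim
  · exact (mix v' v hv' hv hk h.symm).elim
  · exact Option.some.inj (hv.symm.trans hv')

set_option maxHeartbeats 1000000 in
lemma choose_roots {W : Type} {G : SimpleGraph W} {F : Forest N t Δ} {ℓ r : ℕ} {C : Cut F ℓ r}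
    {rt : N → N} {wd : N → List (Fin Δ)}
    (hp1 : ∀ v, C.kind v = 0 → C.kind (rt v) = 0 ∧ rt (rt v) = rt v ∧ F.bd (rt v) = F.bd v ∧
        C.sec (rt v) = C.sec v)
    (hp2 : ∀ v, (wd v).length < ℓ)
    (hp3 : ∀ v v', rt v = rt v' → wd v = wd v' → v = v')
    (hone : ∀ x v v', C.kind x ≠ 0 → v ∈ F.nbr x → v' ∈ F.nbr x → C.kind v = 0 → C.kind v' = 0 →
      rt v = rt v' → v = v')
    {Vs : Fin r → Fin 2 → Finset W} {n k n' n'' : ℕ} {β θ : ℝ}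
    (Pl : Placement G C rt wd Vs n k n' n'' β θ)
    (S : N → Finset W) (lam : N → ℝ) (p e0 : ℝ) (Mu : ℕ) (hMu : 0 < Mu) (hp0 : 0 < p) (hp : p ≤ 1)
    (hn' : 0 < n')
    (hlam : ∀ x, lam x ≤ p ^ (Δ + 1) * (S x).card)
    (hty : ∀ x v, C.kind x ≠ 0 → v ∈ F.nbr x → C.kind v = 0 → ∀ B' ⊆ S x, lam x ≤ B'.card →
      ((Finset.univ.filter fun y => ((B'.filter fun b => G.Adj (Pl.place v y) b).card : ℝ) < p * B'.card).card : ℝ) ≤ e0)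
    (spec : N → Prop) (ST : ℝ) (hspec : ((Finset.univ.filter fun v => spec v).card : ℝ) ≤ ST)
    (he0 : 0 ≤ e0) (hβ : 0 ≤ β)
    (hcount : n'' + (Wds Δ ℓ).card * (β * n' + (Δ + 1) * e0 + ST / Mu) < n') :
    ∃ y : N → Fin n',
      (∀ v, C.kind v = 0 → y (rt v) ∉ Pl.bad v) ∧
      (∀ v v', C.kind v = 0 → C.kind v' = 0 → Pl.sl (rt v) = Pl.sl (rt v') → y (rt v) = y (rt v') → rt v = rt v') ∧
      (∀ x, C.kind x ≠ 0 → p ^ (Δ + 1) * (S x).card ≤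
        (((S x).filter fun w => ∀ v ∈ F.nbr x, C.kind v = 0 → G.Adj (Pl.place v (y (rt v))) w).card : ℝ)) ∧
      (∀ w, (Finset.univ.filter fun v => spec v ∧ C.kind v = 0 ∧ Pl.place v (y (rt v)) = w).card ≤ Mu) := by
  have hMuR : (0:ℝ) < Mu := by exact_mod_cast hMu
  obtain ⟨cnt, hcnt⟩ : ∃ cnt : Finset N → N → ℕ, ∀ T x, cnt T x =
      ((F.nbr x).filter fun v => C.kind v = 0 ∧ rt v ∈ T).card := ⟨_, fun _ _ => rfl⟩
  obtain ⟨cand, hcand⟩ : ∃ cand : Finset N → (N → Fin n') → N → Finset W, ∀ T y x, cand T y x =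
      (S x).filter fun w => ∀ v ∈ F.nbr x, C.kind v = 0 → rt v ∈ T → G.Adj (Pl.place v (y (rt v))) w :=
    ⟨_, fun _ _ _ => rfl⟩
  obtain ⟨use, huse⟩ : ∃ use : Finset N → (N → Fin n') → W → Finset N, ∀ T y w, use T y w =
      Finset.univ.filter fun v => spec v ∧ C.kind v = 0 ∧ rt v ∈ T ∧ Pl.place v (y (rt v)) = w :=
    ⟨_, fun _ _ _ => rfl⟩
  have hcntle : ∀ T x, cnt T x ≤ Δ + 1 := by
    intro T x
    rw [hcnt]
    exact (Finset.card_filter_le _ _).trans (F.nbr_card x)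
  have key : ∀ T : Finset N, (∀ q ∈ T, C.kind q = 0 ∧ rt q = q) → ∃ y : N → Fin n',
      (∀ v, C.kind v = 0 → rt v ∈ T → y (rt v) ∉ Pl.bad v) ∧
      (∀ q ∈ T, ∀ q' ∈ T, Pl.sl q = Pl.sl q' → y q = y q' → q = q') ∧
      (∀ x, C.kind x ≠ 0 → p ^ (cnt T x) * (S x).card ≤ (cand T y x).card) ∧
      (∀ w, (use T y w).card ≤ Mu) := by
    intro T
    induction T using Finset.induction_on with
    | empty =>
      intro _
      refine ⟨fun _ => ⟨0, hn'⟩, by simp, by simp, ?_, ?_⟩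
      · intro x _
        rw [hcnt, hcand]
        simp
      · intro w; rw [huse]; simp
    | insert q T hq ih =>
      intro hT
      obtain ⟨y, i1, i2, i3, i4⟩ := ih (fun q' hq' => hT q' (Finset.mem_insert_of_mem hq'))
      have hqT := hT q (Finset.mem_insert_self q T)
      -- the piece
      obtain ⟨Pq, hPq⟩ : ∃ Pq : Finset N, ∀ v, v ∈ Pq ↔ C.kind v = 0 ∧ rt v = q :=
        ⟨Finset.univ.filter fun v => C.kind v = 0 ∧ rt v = q, fun v => by simp⟩
      have hPqc : Pq.card ≤ (Wds Δ ℓ).card := by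
        apply Finset.card_le_card_of_injOn wd
        · intro v _
          exact (mem_Wds _).2 (hp2 v)
        · intro v hv v' hv' h
          exact hp3 v v' (((hPq v).1 hv).2.trans ((hPq v').1 hv').2.symm) h
      -- saturated vertices
      obtain ⟨sat, hsat⟩ : ∃ sat : N → Finset (Fin n'), ∀ v, sat v =
          Finset.univ.filter fun y0 => Mu ≤ (use T y (Pl.place v y0)).card := ⟨_, fun _ => rfl⟩
      have hsatc : ∀ v, ((sat v).card : ℝ) ≤ ST / Mu := by
        intro v
        rw [le_div_iff₀ hMuR]
        have e1 : (sat v).card * Mu ≤ ∑ y0 ∈ sat v, (use T y (Pl.place v y0)).card := by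
          rw [← smul_eq_mul]
          apply Finset.card_nsmul_le_sum
          intro y0 hy0
          rw [hsat] at hy0
          exact (Finset.mem_filter.1 hy0).2
        have e2 : ∑ y0 ∈ sat v, (use T y (Pl.place v y0)).card ≤ (Finset.univ.filter fun v => spec v).card := by
          rw [← Finset.card_biUnion]
          · apply Finset.card_le_card
            intro v' hv'
            obtain ⟨y0, _, h⟩ := Finset.mem_biUnion.1 hv'
            rw [huse] at h
            simp only [Finset.mem_filter, Finset.mem_univ, true_and] at h ⊢
            exact h.1
          · intro y0 _ y1 _ hne
            show Disjoint (use T y (Pl.place v y0)) (use T y (Pl.place v y1))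
            rw [Finset.disjoint_left]
            intro v' h h'
            rw [huse] at h h'
            simp only [Finset.mem_filter, Finset.mem_univ, true_and] at h h'
            exact hne (Pl.place_inj v (h.2.2.2.symm.trans h'.2.2.2))
        have e3 : ((sat v).card : ℝ) * Mu ≤ ((Finset.univ.filter fun v => spec v).card : ℝ) := by
          exact_mod_cast e1.trans e2
        exact e3.trans hspec
      obtain ⟨aty, haty⟩ : ∃ aty : N → N → Finset (Fin n'), ∀ v x, aty v x = Finset.univ.filter fun y0 =>
          (((cand T y x).filter fun b => G.Adj (Pl.place v y0) b).card : ℝ) < p * (cand T y x).card :=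
        ⟨_, fun _ _ => rfl⟩
      have hatyc : ∀ v ∈ Pq, ∀ x ∈ (F.nbr v).filter (fun x => C.kind x ≠ 0), ((aty v x).card : ℝ) ≤ e0 := by
        intro v hv x hx
        rw [Finset.mem_filter] at hx
        have hvx : v ∈ F.nbr x := by
          have := hx.1
          rw [F.mem_nbr] at this ⊢
          exact this.symm
        rw [haty]
        apply hty x v hx.2 hvx ((hPq v).1 hv).1
        · rw [hcand]; exact Finset.filter_subset _ _
        · refine (hlam x).trans (le_trans ?_ (i3 x hx.2))
          apply mul_le_mul_of_nonneg_right _ (Nat.cast_nonneg _)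
          exact pow_le_pow_of_le_one hp0.le hp (hcntle T x)
      -- excluded set
      obtain ⟨ex, hex⟩ : ∃ ex : N → Finset (Fin n'), ∀ v, ex v = Pl.bad v ∪ sat v ∪
          ((F.nbr v).filter (fun x => C.kind x ≠ 0)).biUnion (aty v) := ⟨_, fun _ => rfl⟩
      have hexc : ∀ v ∈ Pq, ((ex v).card : ℝ) ≤ β * n' + (Δ + 1) * e0 + ST / Mu := by
        intro v hv
        have e1 : (ex v).card ≤ (Pl.bad v).card + (sat v).card +
            ∑ x ∈ (F.nbr v).filter (fun x => C.kind x ≠ 0), (aty v x).card := by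
          rw [hex]
          refine (Finset.card_union_le _ _).trans (add_le_add (Finset.card_union_le _ _) Finset.card_biUnion_le)
        have e2 : ((ex v).card : ℝ) ≤ (Pl.bad v).card + (sat v).card +
            ∑ x ∈ (F.nbr v).filter (fun x => C.kind x ≠ 0), ((aty v x).card : ℝ) := by exact_mod_cast e1
        have e3 : ∑ x ∈ (F.nbr v).filter (fun x => C.kind x ≠ 0), ((aty v x).card : ℝ) ≤ (Δ + 1) * e0 := by
          refine (Finset.sum_le_card_nsmul _ _ e0 (hatyc v hv)).trans ?_
          rw [nsmul_eq_mul]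
          apply mul_le_mul_of_nonneg_right _ he0
          exact_mod_cast (Finset.card_filter_le _ _).trans (F.nbr_card v)
        have e4 := hsatc v
        have e5 := Pl.bad_card v
        linarith
      obtain ⟨EX, hEX⟩ : ∃ EX : Finset (Fin n'), EX = Pq.biUnion ex ∪
          (T.filter fun q' => Pl.sl q' = Pl.sl q).image y := ⟨_, rfl⟩
      have hEXc : (EX.card : ℝ) < n' := by
        have e1 : EX.card ≤ ∑ v ∈ Pq, (ex v).card + n'' := by
          rw [hEX]
          refine (Finset.card_union_le _ _).trans (add_le_add Finset.card_biUnion_le ?_)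
          refine Finset.card_image_le.trans (le_trans (Finset.card_le_card ?_) (Pl.fiber (Pl.sl q)))
          intro q' hq'
          rw [Finset.mem_filter] at hq'
          obtain ⟨a, b⟩ := hT q' (Finset.mem_insert_of_mem hq'.1)
          simp [a, b, hq'.2]
        have e2 : (EX.card : ℝ) ≤ ∑ v ∈ Pq, ((ex v).card : ℝ) + n'' := by exact_mod_cast e1
        have hnn : 0 ≤ β * n' + (Δ + 1) * e0 + ST / Mu := by
          have : 0 ≤ ST := le_trans (Nat.cast_nonneg _) hspec
          positivity
        have e3 : ∑ v ∈ Pq, ((ex v).card : ℝ) ≤ (Wds Δ ℓ).card * (β * n' + (Δ + 1) * e0 + ST / Mu) := by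
          refine (Finset.sum_le_card_nsmul _ _ _ hexc).trans ?_
          rw [nsmul_eq_mul]
          apply mul_le_mul_of_nonneg_right _ hnn
          exact_mod_cast hPqc
        linarith
      obtain ⟨y0, hy0⟩ : ∃ y0, y0 ∉ EX := by
        by_contra hcon
        push Not at hcon
        have : EX = Finset.univ := by ext a; simp [hcon]
        rw [this] at hEXc
        simp at hEXc
      rw [hEX, Finset.mem_union, not_or] at hy0
      obtain ⟨hy0a, hy0b⟩ := hy0
      have hy0' : ∀ v ∈ Pq, y0 ∉ Pl.bad v ∧ y0 ∉ sat v ∧ ∀ x ∈ F.nbr v, C.kind x ≠ 0 → y0 ∉ aty v x := by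
        intro v hv
        have h1 : y0 ∉ ex v := fun h => hy0a (Finset.mem_biUnion.2 ⟨v, hv, h⟩)
        rw [hex, Finset.mem_union, Finset.mem_union, not_or, not_or] at h1
        refine ⟨h1.1.1, h1.1.2, ?_⟩
        intro x hx hk h
        exact h1.2 (Finset.mem_biUnion.2 ⟨x, Finset.mem_filter.2 ⟨hx, hk⟩, h⟩)
      obtain ⟨y', hy'⟩ : ∃ y', y' = Function.update y q y0 := ⟨_, rfl⟩
      have hyq : y' q = y0 := by rw [hy']; simp
      have hyT : ∀ q' ∈ T, y' q' = y q' := by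
        intro q' hq'
        have : q' ≠ q := by rintro rfl; exact hq hq'
        rw [hy', Function.update_of_ne this]
      refine ⟨y', ?_, ?_, ?_, ?_⟩
      · intro v hv hvT
        rcases Finset.mem_insert.1 hvT with h | h
        · rw [h, hyq]
          exact (hy0' v ((hPq v).2 ⟨hv, h⟩)).1
        · rw [hyT _ h]
          exact i1 v hv h
      · have hside : ∀ q' ∈ T, Pl.sl q' = Pl.sl q → y q' ≠ y0 := by
          intro q' hq' h1 h2
          exact hy0b (Finset.mem_image.2 ⟨q', Finset.mem_filter.2 ⟨hq', h1⟩, h2⟩)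
        intro q1 hq1 q2 hq2 h1 h2
        rcases Finset.mem_insert.1 hq1 with e1 | e1 <;> rcases Finset.mem_insert.1 hq2 with e2 | e2
        · rw [e1, e2]
        · rw [e1, hyq, hyT _ e2] at h2
          exact absurd h2.symm (hside q2 e2 (by rw [← h1, e1]))
        · rw [e2, hyq, hyT _ e1] at h2
          exact absurd h2 (hside q1 e1 (by rw [h1, e2]))
        · rw [hyT _ e1, hyT _ e2] at h2
          exact i2 _ e1 _ e2 h1 h2
      · intro x hx
        by_cases hv : ∃ v ∈ F.nbr x, C.kind v = 0 ∧ rt v = q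
        · obtain ⟨v, hv1, hv2, hv3⟩ := hv
          have huniq : ∀ v' ∈ F.nbr x, C.kind v' = 0 → rt v' = q → v' = v := by
            intro v' a b c
            exact hone x v' v hx a hv1 b hv2 (c.trans hv3.symm)
          have e1 : cnt (insert q T) x ≤ cnt T x + 1 ∧ cnt T x + 1 ≤ cnt (insert q T) x := by
            have : ((F.nbr x).filter fun v => C.kind v = 0 ∧ rt v ∈ insert q T) =
                insert v ((F.nbr x).filter fun v => C.kind v = 0 ∧ rt v ∈ T) := by
              ext v'
              simp only [Finset.mem_filter, Finset.mem_insert]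
              constructor
              · rintro ⟨a, b, c | c⟩
                · exact Or.inl (huniq v' a b c)
                · exact Or.inr ⟨a, b, c⟩
              · rintro (rfl | ⟨a, b, c⟩)
                · exact ⟨hv1, hv2, Or.inl hv3⟩
                · exact ⟨a, b, Or.inr c⟩
            rw [hcnt, hcnt, this, Finset.card_insert_of_notMem]
            · simp
            · rw [Finset.mem_filter, hv3]
              exact fun h => hq h.2.2
          have e1' : cnt (insert q T) x = cnt T x + 1 := le_antisymm e1.1 e1.2
          have e2 : ((cand T y x).filter fun b => G.Adj (Pl.place v y0) b) ⊆ cand (insert q T) y' x := by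
            intro w hw
            rw [Finset.mem_filter, hcand, Finset.mem_filter] at hw
            rw [hcand, Finset.mem_filter]
            refine ⟨hw.1.1, ?_⟩
            intro v' a b c
            rcases Finset.mem_insert.1 c with c | c
            · rw [c, hyq, huniq v' a b c]; exact hw.2
            · rw [hyT _ c]; exact hw.1.2 v' a b c
          have e3 : (((cand T y x).filter fun b => G.Adj (Pl.place v y0) b).card : ℝ) ≤ (cand (insert q T) y' x).card := by
            exact_mod_cast Finset.card_le_card e2
          have hxv : x ∈ F.nbr v := by
            rw [F.mem_nbr] at hv1 ⊢; exact hv1.symm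
          have e4 := (hy0' v ((hPq v).2 ⟨hv2, hv3⟩)).2.2 x hxv hx
          rw [haty, Finset.mem_filter, not_and] at e4
          have e5 := not_lt.1 (e4 (Finset.mem_univ _))
          rw [e1', pow_succ]
          have e6 := mul_le_mul_of_nonneg_left (i3 x hx) hp0.le
          calc p ^ cnt T x * p * (S x).card = p * (p ^ cnt T x * (S x).card) := by ring
            _ ≤ _ := e6
            _ ≤ _ := e5
            _ ≤ _ := e3
        · have e1 : cnt (insert q T) x = cnt T x := by
            rw [hcnt, hcnt]
            congr 1
            ext v
            simp only [Finset.mem_filter, Finset.mem_insert]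
            constructor
            · rintro ⟨a, b, c | c⟩
              · exact absurd ⟨v, a, b, c⟩ hv
              · exact ⟨a, b, c⟩
            · rintro ⟨a, b, c⟩
              exact ⟨a, b, Or.inr c⟩
          have e2 : cand T y x ⊆ cand (insert q T) y' x := by
            intro w hw
            rw [hcand, Finset.mem_filter] at hw ⊢
            refine ⟨hw.1, ?_⟩
            intro v a b c
            rcases Finset.mem_insert.1 c with c | c
            · exact absurd ⟨v, a, b, c⟩ hv
            · rw [hyT _ c]; exact hw.2 v a b c
          rw [e1]
          refine (i3 x hx).trans ?_
          exact_mod_cast Finset.card_le_card e2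
      · intro w
        by_cases hv : ∃ v ∈ Pq, Pl.place v y0 = w
        · obtain ⟨v, hv1, hv2⟩ := hv
          have e1 : use (insert q T) y' w ⊆ insert v (use T y w) := by
            intro v' hv'
            rw [huse] at hv'
            simp only [Finset.mem_filter, Finset.mem_univ, true_and, Finset.mem_insert] at hv'
            rw [Finset.mem_insert]
            obtain ⟨a, b, c | c, d⟩ := hv'
            · left
              rw [c, hyq, ← hv2] at d
              obtain ⟨k1, k2⟩ := (hPq v).1 hv1
              have hb : F.bd v' = F.bd v := by
                rw [← (hp1 v' b).2.2.1, ← (hp1 v k1).2.2.1, c, k2]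
              exact hp3 _ _ (c.trans k2.symm) (Pl.bundle_inj v' v y0 y0 b k1 hb d).2.1
            · right
              rw [huse]
              simp only [Finset.mem_filter, Finset.mem_univ, true_and]
              rw [hyT _ c] at d
              exact ⟨a, b, c, d⟩
          have e2 := (hy0' v hv1).2.1
          rw [hsat, Finset.mem_filter, not_and, hv2] at e2
          have e3 := e2 (Finset.mem_univ _)
          have e4 := (Finset.card_le_card e1).trans (Finset.card_insert_le _ _)
          omega
        · refine le_trans (Finset.card_le_card ?_) (i4 w)
          intro v' hv'
          rw [huse] at hv' ⊢
          simp only [Finset.mem_filter, Finset.mem_univ, true_and, Finset.mem_insert] at hv' ⊢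
          obtain ⟨a, b, c | c, d⟩ := hv'
          · rw [c, hyq] at d
            exact absurd ⟨v', (hPq v').2 ⟨b, c⟩, d⟩ hv
          · rw [hyT _ c] at d
            exact ⟨a, b, c, d⟩
  obtain ⟨y, i1, i2, i3, i4⟩ := key (Finset.univ.filter fun q => C.kind q = 0 ∧ rt q = q) (by
    intro q hq; exact (Finset.mem_filter.1 hq).2)
  have hmem : ∀ v, C.kind v = 0 → rt v ∈ Finset.univ.filter fun q => C.kind q = 0 ∧ rt q = q := by
    intro v hv
    simp [(hp1 v hv).1, (hp1 v hv).2.1]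
  refine ⟨y, ?_, ?_, ?_, ?_⟩
  · intro v hv; exact i1 v hv (hmem v hv)
  · intro v v' hv hv' h1 h2
    exact i2 _ (hmem v hv) _ (hmem v' hv') h1 h2
  · intro x hx
    have e1 : p ^ (Δ + 1) * (S x).card ≤ p ^ cnt (Finset.univ.filter fun q => C.kind q = 0 ∧ rt q = q) x * (S x).card := by
      apply mul_le_mul_of_nonneg_right _ (Nat.cast_nonneg _)
      exact pow_le_pow_of_le_one hp0.le hp (hcntle _ x)
    refine e1.trans ((i3 x hx).trans ?_)
    have : cand (Finset.univ.filter fun q => C.kind q = 0 ∧ rt q = q) y x ⊆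
        (S x).filter fun w => ∀ v ∈ F.nbr x, C.kind v = 0 → G.Adj (Pl.place v (y (rt v))) w := by
      rw [hcand]
      intro w hw
      rw [Finset.mem_filter] at hw ⊢
      exact ⟨hw.1, fun v a b => hw.2 v a b (hmem v b)⟩
    exact_mod_cast Finset.card_le_card this
  · intro w
    refine le_trans (Finset.card_le_card ?_) (i4 w)
    intro v hv
    rw [huse]
    simp only [Finset.mem_filter, Finset.mem_univ, true_and] at hv ⊢
    obtain ⟨a, b, c⟩ := hv
    have := hmem v b
    simp only [Finset.mem_filter, Finset.mem_univ, true_and] at this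
    exact ⟨a, b, this, c⟩

end
end ApproxDecomp

namespace ApproxDecomp
section
open scoped Classical

lemma hole_edge {W : Type} (G : SimpleGraph W) (U : Finset W) (S T : Finset W) (hS : S ⊆ U) (hT : T ⊆ U)
    (hd : Disjoint S T) (h0 : ℕ) (hh : biIndep (SimpleGraph.induce (↑U : Set W) G) < h0)
    (hSc : h0 ≤ S.card) (hTc : h0 ≤ T.card) : ∃ a ∈ S, ∃ b ∈ T, G.Adj a b := by
  have hbdd : BddAbove {r : ℕ | ∀ s t : ℕ, s + t = r → HasBipartiteHole (SimpleGraph.induce (↑U : Set W) G) s t} := by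
    refine ⟨U.card, ?_⟩
    intro r hr
    obtain ⟨A, B, _, hA, _, _⟩ := hr r 0 (by simp)
    have := Finset.card_le_univ A
    simp at this
    omega
  have hnot : h0 ∉ {r : ℕ | ∀ s t : ℕ, s + t = r → HasBipartiteHole (SimpleGraph.induce (↑U : Set W) G) s t} := by
    intro h
    have := le_csSup hbdd h
    unfold biIndep at hh
    omega
  simp only [Set.mem_setOf_eq] at hnot
  push Not at hnot
  obtain ⟨s, t, hst, hn⟩ := hnot
  by_contra hcon
  push Not at hcon
  apply hn
  obtain ⟨S', hS', hS'c⟩ := Finset.exists_subset_card_eq (show s ≤ S.card by omega)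
  obtain ⟨T', hT', hT'c⟩ := Finset.exists_subset_card_eq (show t ≤ T.card by omega)
  have hmap : ∀ A : Finset W, A ⊆ U → (A.subtype fun x => x ∈ (↑U : Set W)).card = A.card := by
    intro A hA
    rw [Finset.card_subtype, Finset.filter_true_of_mem]
    intro x hx; exact hA hx
  refine ⟨S'.subtype fun x => x ∈ (↑U : Set W), T'.subtype fun x => x ∈ (↑U : Set W), ?_, ?_, ?_, ?_⟩
  · rw [Finset.disjoint_left]
    intro a ha hb
    rw [Finset.mem_subtype] at ha hb
    exact Finset.disjoint_left.1 hd (hS' ha) (hT' hb)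
  · rw [hmap S' (hS'.trans hS), hS'c]
  · rw [hmap T' (hT'.trans hT), hT'c]
  · intro a ha b hb hab
    rw [Finset.mem_subtype] at ha hb
    exact hcon a (hS' ha) b (hT' hb) hab

lemma few_low {W : Type} (G : SimpleGraph W) (U : Finset W) (h0 : ℕ)
    (hh : biIndep (SimpleGraph.induce (↑U : Set W) G) < h0) (L : ℕ) (B : Finset W) (hB : B ⊆ U)
    (hBc : h0 * (L + 2) ≤ B.card) (A : Finset W) (hA : A ⊆ U) :
    (A.filter fun a => (B.filter fun b => G.Adj a b).card < L).card < h0 := by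
  by_contra hcon
  push Not at hcon
  obtain ⟨D, hD, hDc⟩ := Finset.exists_subset_card_eq hcon
  set B' := B \ (D ∪ D.biUnion fun a => B.filter fun b => G.Adj a b) with hB'
  have h1 : (D ∪ D.biUnion fun a => B.filter fun b => G.Adj a b).card ≤ h0 + h0 * L := by
    refine (Finset.card_union_le _ _).trans (add_le_add hDc.le ?_)
    rw [← hDc]
    apply Finset.card_biUnion_le_card_mul
    intro a ha
    exact (Finset.mem_filter.1 (hD ha)).2.le
  have h2 : h0 ≤ B'.card := by
    have := Finset.le_card_sdiff (D ∪ D.biUnion fun a => B.filter fun b => G.Adj a b) B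
    rw [← hB'] at this
    have : h0 * (L + 2) = h0 * L + 2 * h0 := by ring
    omega
  obtain ⟨a, ha, b, hb, hab⟩ := hole_edge G U D B' (hD.trans ((Finset.filter_subset _ _).trans hA))
    (Finset.sdiff_subset.trans hB) (by
      rw [Finset.disjoint_left]
      intro x hx hx'
      rw [hB', Finset.mem_sdiff, Finset.mem_union, not_or] at hx'
      exact hx'.2.1 hx) h0 hh hDc.ge h2
  rw [hB', Finset.mem_sdiff, Finset.mem_union, not_or] at hb
  exact hb.2.2 (Finset.mem_biUnion.2 ⟨a, ha, Finset.mem_filter.2 ⟨hb.1, hab⟩⟩)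

set_option maxHeartbeats 1000000 in
lemma stars {N W : Type} [Nonempty W] (G : SimpleGraph W) (U : Finset W) (h0 : ℕ)
    (hh : biIndep (SimpleGraph.induce (↑U : Set W) G) < h0)
    (Z : Finset N) (ch : N → Finset N) (own : N → N) (Δ M Kc Tt lam : ℕ) (hΔ : 0 < Δ) (hM : 0 < M)
    (hch : ∀ z ∈ Z, (ch z).card ≤ Δ) (hown : ∀ z ∈ Z, ∀ c ∈ ch z, own c = z ∧ c ∉ Z)
    (L : N → Finset W) (hLU : ∀ x, L x ⊆ U)
    (conf : N → N → Prop) (hsymm : ∀ x y, conf x y → conf y x)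
    (hstar : ∀ z ∈ Z, ∀ x ∈ insert z (ch z), ∀ y ∈ insert z (ch z), x ≠ y → conf x y)
    (hconf : ∀ x ∈ Z.biUnion fun z => insert z (ch z),
      ((Z.biUnion fun z => insert z (ch z)).filter fun y => conf x y).card ≤ Kc)
    (hTt : (Z.biUnion fun z => insert z (ch z)).card ≤ Tt)
    (hlam : ∀ x ∈ Z.biUnion fun z => insert z (ch z), lam ≤ (L x).card)
    (hnum : Kc + Tt / M + h0 * (Δ * M + Δ + 3) ≤ lam) :
    ∃ ψ : N → W, (∀ x ∈ Z.biUnion fun z => insert z (ch z), ψ x ∈ L x) ∧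
      (∀ x ∈ Z.biUnion fun z => insert z (ch z), ∀ y ∈ Z.biUnion fun z => insert z (ch z),
        x ≠ y → conf x y → ψ x ≠ ψ y) ∧
      (∀ z ∈ Z, ∀ c ∈ ch z, G.Adj (ψ c) (ψ z)) ∧
      (∀ z ∈ Z, ∀ c ∈ ch z, ∀ z' ∈ Z, ∀ c' ∈ ch z', s(ψ c, ψ z) = s(ψ c', ψ z') → c = c') ∧
      (∀ u, ((Z.biUnion fun z => insert z (ch z)).filter fun x => ψ x = u).card ≤ M) := by
  have hh0 : 0 < h0 := by omega
  suffices key : ∀ T : Finset N, T ⊆ Z → ∃ ψ : N → W, (∀ x ∈ T.biUnion fun z => insert z (ch z), ψ x ∈ L x) ∧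
      (∀ x ∈ T.biUnion fun z => insert z (ch z), ∀ y ∈ T.biUnion fun z => insert z (ch z),
        x ≠ y → conf x y → ψ x ≠ ψ y) ∧
      (∀ z ∈ T, ∀ c ∈ ch z, G.Adj (ψ c) (ψ z)) ∧
      (∀ z ∈ T, ∀ c ∈ ch z, ∀ z' ∈ T, ∀ c' ∈ ch z', s(ψ c, ψ z) = s(ψ c', ψ z') → c = c') ∧
      (∀ u, ((T.biUnion fun z => insert z (ch z)).filter fun x => ψ x = u).card ≤ M) from key Z subset_rfl
  intro T
  induction T using Finset.induction_on with
  | empty => intro _; exact ⟨fun _ => Classical.arbitrary W, by simp⟩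
  | insert z T hzT ih =>
    intro hTZ
    have hz : z ∈ Z := hTZ (Finset.mem_insert_self _ _)
    have hTZ' : T ⊆ Z := fun a ha => hTZ (Finset.mem_insert_of_mem ha)
    obtain ⟨ψ, i1, i2, i3, i4, i5⟩ := ih hTZ'
    obtain ⟨Y, hY⟩ : ∃ Y, Y = T.biUnion fun z => insert z (ch z) := ⟨_, rfl⟩
    rw [← hY] at i1 i2 i5
    obtain ⟨st, hst⟩ : ∃ st, st = insert z (ch z) := ⟨_, rfl⟩
    have hYins : (insert z T).biUnion (fun z => insert z (ch z)) = st ∪ Y := by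
      rw [Finset.biUnion_insert, hY, hst]
    have hYZ : Y ⊆ Z.biUnion fun z => insert z (ch z) := by
      rw [hY]; exact Finset.biUnion_subset_biUnion_of_subset_left _ hTZ'
    have hstZ : st ⊆ Z.biUnion fun z => insert z (ch z) := by
      intro x hx
      exact Finset.mem_biUnion.2 ⟨z, hz, hst ▸ hx⟩
    have hmemY : ∀ x, x ∈ Y ↔ (x ∈ T ∨ ∃ z' ∈ T, x ∈ ch z') := by
      intro x
      rw [hY, Finset.mem_biUnion]
      constructor
      · rintro ⟨z', h1, h2⟩
        rcases Finset.mem_insert.1 h2 with rfl | h2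
        · exact Or.inl h1
        · exact Or.inr ⟨z', h1, h2⟩
      · rintro (h | ⟨z', h1, h2⟩)
        · exact ⟨x, h, Finset.mem_insert_self _ _⟩
        · exact ⟨z', h1, Finset.mem_insert_of_mem h2⟩
    have hdis : ∀ x ∈ st, x ∉ Y := by
      intro x hx hxY
      rw [hst, Finset.mem_insert] at hx
      rw [hmemY] at hxY
      rcases hx with rfl | hx
      · rcases hxY with h | ⟨z', h1, h2⟩
        · exact hzT h
        · exact (hown z' (hTZ' h1) x h2).2 hz
      · rcases hxY with h | ⟨z', h1, h2⟩
        · exact (hown z hz x hx).2 (hTZ' h)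
        · have e1 := (hown z' (hTZ' h1) x h2).1
          have e2 := (hown z hz x hx).1
          rw [e1] at e2
          rw [e2] at h1; exact hzT h1
    -- saturated vertices
    obtain ⟨Sat, hSat⟩ : ∃ Sat : Finset W, Sat = U.filter fun u => M ≤ (Y.filter fun x => ψ x = u).card := ⟨_, rfl⟩
    have hSatc : Sat.card ≤ Tt / M := by
      rw [Nat.le_div_iff_mul_le hM]
      refine le_trans ?_ ((Finset.card_le_card hYZ).trans hTt)
      have e1 : Sat.card * M ≤ ∑ u ∈ Sat, (Y.filter fun x => ψ x = u).card := by
        rw [← smul_eq_mul]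
        apply Finset.card_nsmul_le_sum
        intro u hu
        rw [hSat] at hu
        exact (Finset.mem_filter.1 hu).2
      refine e1.trans ?_
      rw [← Finset.card_biUnion]
      · apply Finset.card_le_card
        intro x hx
        obtain ⟨u, _, h⟩ := Finset.mem_biUnion.1 hx
        exact (Finset.mem_filter.1 h).1
      · intro u _ u' _ hne
        show Disjoint (Y.filter fun x => ψ x = u) (Y.filter fun x => ψ x = u')
        rw [Finset.disjoint_left]
        intro x h h'
        exact hne ((Finset.mem_filter.1 h).2.symm.trans (Finset.mem_filter.1 h').2)
    obtain ⟨A, hA⟩ : ∃ A : N → Finset W, ∀ x, A x = L x \ (((Y.filter fun y => conf x y).image ψ) ∪ Sat) :=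
      ⟨_, fun _ => rfl⟩
    have hAc : ∀ x ∈ st, h0 * (Δ * M + Δ + 3) ≤ (A x).card := by
      intro x hx
      have e1 := Finset.le_card_sdiff (((Y.filter fun y => conf x y).image ψ) ∪ Sat) (L x)
      rw [← hA] at e1
      have e2 := Finset.card_union_le ((Y.filter fun y => conf x y).image ψ) Sat
      have e3 : ((Y.filter fun y => conf x y).image ψ).card ≤ Kc := by
        refine Finset.card_image_le.trans (le_trans (Finset.card_le_card ?_) (hconf x (hstZ hx)))
        exact Finset.filter_subset_filter _ hYZ
      have e4 := hlam x (hstZ hx)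
      omega
    have hAU : ∀ x, A x ⊆ U := by
      intro x
      rw [hA]; exact Finset.sdiff_subset.trans (hLU x)
    have hA' : ∀ x, ∀ a ∈ A x, a ∈ L x ∧ (∀ y ∈ Y, conf x y → ψ y ≠ a) ∧ (Y.filter fun x => ψ x = a).card < M := by
      intro x a ha
      have haU := hAU x ha
      rw [hA, Finset.mem_sdiff, Finset.mem_union, not_or] at ha
      refine ⟨ha.1, ?_, ?_⟩
      · intro y hy hxy h
        exact ha.2.1 (Finset.mem_image.2 ⟨y, Finset.mem_filter.2 ⟨hy, hxy⟩, h⟩)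
      · by_contra hcon
        push Not at hcon
        exact ha.2.2 (by rw [hSat]; exact Finset.mem_filter.2 ⟨haU, hcon⟩)
    have hzst : z ∈ st := by rw [hst]; exact Finset.mem_insert_self _ _
    have hcst : ∀ c ∈ ch z, c ∈ st := by
      intro c hc; rw [hst]; exact Finset.mem_insert_of_mem hc
    -- choose the centre
    obtain ⟨a, haA, ha⟩ : ∃ a ∈ A z, ∀ c ∈ ch z, Δ * M + Δ + 1 ≤ ((A c).filter fun b => G.Adj a b).card := by
      by_contra hcon
      push Not at hcon
      have e1 : A z ⊆ (ch z).biUnion fun c => (A z).filter fun a => ((A c).filter fun b => G.Adj a b).card < Δ * M + Δ + 1 := by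
        intro a ha
        obtain ⟨c, hc, h⟩ := hcon a ha
        exact Finset.mem_biUnion.2 ⟨c, hc, Finset.mem_filter.2 ⟨ha, h⟩⟩
      have e2 := (Finset.card_le_card e1).trans (Finset.card_biUnion_le_card_mul _ _ h0 (fun c hc =>
        (few_low G U h0 hh (Δ * M + Δ + 1) (A c) (hAU c) (hAc c (hcst c hc)) (A z) (hAU z)).le))
      have e3 := hAc z hzst
      have e4 : (ch z).card * h0 ≤ Δ * h0 := Nat.mul_le_mul_right _ (hch z hz)
      have e5 : h0 * (Δ * M + Δ + 3) = h0 * (Δ * M) + Δ * h0 + 3 * h0 := by ring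
      omega
    -- used neighbours at `a`
    obtain ⟨pt, hpt⟩ : ∃ pt : N → Finset W, ∀ x, pt x = if x ∈ Z then (ch x).image ψ else {ψ (own x)} :=
      ⟨_, fun _ => rfl⟩
    obtain ⟨Us, hUs⟩ : ∃ Us : Finset W, Us = (Y.filter fun x => ψ x = a).biUnion pt := ⟨_, rfl⟩
    have hUsc : Us.card ≤ Δ * M := by
      rw [hUs]
      refine (Finset.card_biUnion_le_card_mul _ _ Δ ?_).trans ?_
      · intro x _
        rw [hpt]
        split_ifs with hx
        · exact Finset.card_image_le.trans (hch x hx)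
        · simp; exact hΔ
      · rw [mul_comm]
        exact Nat.mul_le_mul_left _ (hA' z a haA).2.2.le
    have hUs' : ∀ w, w ∉ Us → ∀ z' ∈ T, ∀ c' ∈ ch z', s(w, a) ≠ s(ψ c', ψ z') := by
      intro w hw z' hz' c' hc' h
      apply hw
      rw [hUs, Finset.mem_biUnion]
      rcases Sym2.eq_iff.1 h with ⟨e1, e2⟩ | ⟨e1, e2⟩
      · refine ⟨z', Finset.mem_filter.2 ⟨(hmemY z').2 (Or.inl hz'), e2.symm⟩, ?_⟩
        rw [hpt, if_pos (hTZ' hz'), e1]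
        exact Finset.mem_image_of_mem _ hc'
      · obtain ⟨k1, k2⟩ := hown z' (hTZ' hz') c' hc'
        refine ⟨c', Finset.mem_filter.2 ⟨(hmemY c').2 (Or.inr ⟨z', hz', hc'⟩), e2.symm⟩, ?_⟩
        rw [hpt, if_neg k2, k1, e1]
        simp
    -- choose the leaves
    obtain ⟨f, hf1, hf2⟩ := greedy_list (α := {c // c ∈ ch z}) (fun _ _ => True) (fun _ _ _ => trivial)
      (fun c => ((A c.1).filter fun b => G.Adj a b) \ Us) (by
        intro c
        have e1 := Finset.le_card_sdiff Us ((A c.1).filter fun b => G.Adj a b)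
        have e2 := ha c.1 c.2
        refine lt_of_le_of_lt (b := Δ) ((Finset.card_le_univ _).trans ?_) ?_
        · simpa using hch z hz
        · omega)
    obtain ⟨ψ', hψ'⟩ : ∃ ψ' : N → W, ∀ x, ψ' x = if x = z then a else if h : x ∈ ch z then f ⟨x, h⟩ else ψ x :=
      ⟨_, fun _ => rfl⟩
    have hzch : z ∉ ch z := fun h => (hown z hz z h).2 hz
    have p1 : ψ' z = a := by rw [hψ']; simp
    have p2 : ∀ c (h : c ∈ ch z), ψ' c = f ⟨c, h⟩ := by
      intro c h
      have : c ≠ z := by rintro rfl; exact hzch h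
      rw [hψ', if_neg this, dif_pos h]
    have p3 : ∀ x ∈ Y, ψ' x = ψ x := by
      intro x hx
      have h1 : x ∉ st := fun h => hdis x h hx
      rw [hst, Finset.mem_insert, not_or] at h1
      rw [hψ', if_neg h1.1, dif_neg h1.2]
    have p4 : ∀ c (h : c ∈ ch z), f ⟨c, h⟩ ∈ A c ∧ G.Adj a (f ⟨c, h⟩) ∧ f ⟨c, h⟩ ∉ Us := by
      intro c h
      have := hf1 ⟨c, h⟩
      rw [Finset.mem_sdiff, Finset.mem_filter] at this
      exact ⟨this.1.1, this.1.2, this.2⟩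
    have p5 : ∀ x ∈ st, ψ' x ∈ A x := by
      intro x hx
      rw [hst, Finset.mem_insert] at hx
      rcases hx with rfl | hx
      · rw [p1]; exact haA
      · rw [p2 x hx]; exact (p4 x hx).1
    have p6 : ∀ x ∈ st, ∀ y ∈ st, x ≠ y → ψ' x ≠ ψ' y := by
      intro x hx y hy hne
      rw [hst, Finset.mem_insert] at hx hy
      rcases hx with rfl | hx <;> rcases hy with rfl | hy
      · exact absurd rfl hne
      · rw [p1, p2 y hy]; exact (p4 y hy).2.1.ne
      · rw [p1, p2 x hx]; exact (p4 x hx).2.1.ne.symm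
      · rw [p2 x hx, p2 y hy]
        exact hf2 _ _ (fun h => hne (Subtype.mk.inj h)) trivial
    rw [hYins]
    refine ⟨ψ', ?_, ?_, ?_, ?_, ?_⟩
    · intro x hx
      rcases Finset.mem_union.1 hx with h | h
      · exact (hA' x _ (p5 x h)).1
      · rw [p3 x h]; exact i1 x h
    · intro x hx y hy hne hc
      rcases Finset.mem_union.1 hx with h | h <;> rcases Finset.mem_union.1 hy with h' | h'
      · exact p6 x h y h' hne
      · rw [p3 y h']
        exact ((hA' x _ (p5 x h)).2.1 y h' hc).symm
      · rw [p3 x h]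
        exact (hA' y _ (p5 y h')).2.1 x h (hsymm _ _ hc)
      · rw [p3 x h, p3 y h']
        exact i2 x h y h' hne hc
    · intro z' hz' c hc
      rcases Finset.mem_insert.1 hz' with rfl | h
      · rw [p1, p2 c hc]; exact (p4 c hc).2.1.symm
      · rw [p3 z' ((hmemY z').2 (Or.inl h)), p3 c ((hmemY c).2 (Or.inr ⟨z', h, hc⟩))]
        exact i3 z' h c hc
    · intro z1 hz1 c1 hc1 z2 hz2 c2 hc2 h
      rcases Finset.mem_insert.1 hz1 with rfl | h1 <;> rcases Finset.mem_insert.1 hz2 with rfl | h2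
      · by_contra hne
        have := p6 c1 (hcst c1 hc1) c2 (hcst c2 hc2) hne
        rcases Sym2.eq_iff.1 h with ⟨e1, e2⟩ | ⟨e1, e2⟩
        · exact this e1
        · exact this (e1.trans e2)
      · rw [p1, p2 c1 hc1, p3 z2 ((hmemY z2).2 (Or.inl h2)), p3 c2 ((hmemY c2).2 (Or.inr ⟨z2, h2, hc2⟩))] at h
        exact absurd h (hUs' _ (p4 c1 hc1).2.2 z2 h2 c2 hc2)
      · rw [p1, p2 c2 hc2, p3 z1 ((hmemY z1).2 (Or.inl h1)), p3 c1 ((hmemY c1).2 (Or.inr ⟨z1, h1, hc1⟩))] at h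
        exact absurd h.symm (hUs' _ (p4 c2 hc2).2.2 z1 h1 c1 hc1)
      · rw [p3 z1 ((hmemY z1).2 (Or.inl h1)), p3 c1 ((hmemY c1).2 (Or.inr ⟨z1, h1, hc1⟩)),
          p3 z2 ((hmemY z2).2 (Or.inl h2)), p3 c2 ((hmemY c2).2 (Or.inr ⟨z2, h2, hc2⟩))] at h
        exact i4 z1 h1 c1 hc1 z2 h2 c2 hc2 h
    · intro u
      by_cases hu : ∃ x ∈ st, ψ' x = u
      · obtain ⟨x, hx, hxu⟩ := hu
        have e1 : (st ∪ Y).filter (fun x => ψ' x = u) ⊆ insert x (Y.filter fun x => ψ x = u) := by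
          intro y hy
          rw [Finset.mem_filter, Finset.mem_union] at hy
          rw [Finset.mem_insert, Finset.mem_filter]
          rcases hy with ⟨h | h, hyu⟩
          · left
            by_contra hne
            exact p6 y h x hx hne (hyu.trans hxu.symm)
          · right
            rw [p3 y h] at hyu
            exact ⟨h, hyu⟩
        have e2 := (Finset.card_le_card e1).trans (Finset.card_insert_le _ _)
        have e3 := (hA' x _ (p5 x hx)).2.2
        rw [hxu] at e3
        omega
      · refine le_trans (Finset.card_le_card ?_) (i5 u)
        intro y hy
        rw [Finset.mem_filter, Finset.mem_union] at hy
        rw [Finset.mem_filter]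
        rcases hy with ⟨h | h, hyu⟩
        · exact absurd ⟨y, h, hyu⟩ hu
        · rw [p3 y h] at hyu
          exact ⟨h, hyu⟩

end
end ApproxDecomp

namespace ApproxDecomp
section
open scoped Classical

variable {N : Type} [Fintype N] {t Δ : ℕ}

lemma Forest.nbr_symm (F : Forest N t Δ) {x v : N} (h : v ∈ F.nbr x) : x ∈ F.nbr v := by
  rw [F.mem_nbr] at h ⊢
  exact h.symm

lemma Forest.nbr_bd (F : Forest N t Δ) {x v : N} (h : v ∈ F.nbr x) : F.bd v = F.bd x := by
  rw [F.mem_nbr] at h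
  rcases h with h | h
  · exact F.bd_par _ _ h
  · exact (F.bd_par _ _ h).symm

lemma share_count {W : Type} (F : Forest N t Δ) (k0 A : N → Prop) (φ : N → W) (m : ℕ)
    (hm : ∀ w, (Finset.univ.filter fun v => k0 v ∧ φ v = w ∧ ∃ x, A x ∧ v ∈ F.nbr x).card ≤ m) (x : N) :
    (Finset.univ.filter fun x' => A x' ∧ ∃ v ∈ F.nbr x, k0 v ∧ ∃ v' ∈ F.nbr x', k0 v' ∧ φ v = φ v').card
      ≤ (Δ + 1) * (m * (Δ + 1)) := by
  have hsub : (Finset.univ.filter fun x' => A x' ∧ ∃ v ∈ F.nbr x, k0 v ∧ ∃ v' ∈ F.nbr x', k0 v' ∧ φ v = φ v') ⊆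
      (F.nbr x).biUnion fun v =>
        (Finset.univ.filter fun v' => k0 v' ∧ φ v' = φ v ∧ ∃ x, A x ∧ v' ∈ F.nbr x).biUnion fun v' => F.nbr v' := by
    intro x' hx'
    obtain ⟨hA, v, hv, _, v', hv', hk, he⟩ := (Finset.mem_filter.1 hx').2
    refine Finset.mem_biUnion.2 ⟨v, hv, Finset.mem_biUnion.2 ⟨v', ?_, F.nbr_symm hv'⟩⟩
    exact Finset.mem_filter.2 ⟨Finset.mem_univ _, hk, he.symm, x', hA, hv'⟩
  refine (Finset.card_le_card hsub).trans ?_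
  refine (Finset.card_biUnion_le_card_mul _ _ (m * (Δ + 1)) ?_).trans (Nat.mul_le_mul_right _ (F.nbr_card x))
  intro v _
  refine (Finset.card_biUnion_le_card_mul _ _ (Δ + 1) fun v' _ => F.nbr_card v').trans ?_
  exact Nat.mul_le_mul_right _ (hm _)

/-- the kind-1 vertices -/
lemma xverts {W : Type} [Nonempty W] {F : Forest N t Δ} {ℓ r : ℕ} (C : Cut F ℓ r) (φ : N → W)
    (same : N → N → Prop) (hsame : ∀ x y, same x y → same y x) (L : N → Finset W) (m m' : ℕ)
    (hm : ∀ w, (Finset.univ.filter fun v => C.kind v = 0 ∧ φ v = w ∧ ∃ x, C.kind x = 1 ∧ v ∈ F.nbr x).card ≤ m)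
    (hm' : ∀ x, C.kind x = 1 → (Finset.univ.filter fun y => C.kind y = 1 ∧ same x y).card ≤ m')
    (hL : ∀ x, C.kind x = 1 → m' + (Δ + 1) * (m * (Δ + 1)) < (L x).card) :
    ∃ ψ : N → W, (∀ x, C.kind x = 1 → ψ x ∈ L x) ∧
      (∀ x y, C.kind x = 1 → C.kind y = 1 → x ≠ y → same x y → ψ x ≠ ψ y) ∧
      (∀ x y, C.kind x = 1 → C.kind y = 1 → x ≠ y → ∀ v ∈ F.nbr x, ∀ v' ∈ F.nbr y, C.kind v = 0 → C.kind v' = 0 →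
        φ v = φ v' → ψ x ≠ ψ y) := by
  obtain ⟨cf, hcf⟩ : ∃ cf : N → N → Prop, ∀ x y, cf x y ↔ same x y ∨
    ∃ v ∈ F.nbr x, C.kind v = 0 ∧ ∃ v' ∈ F.nbr y, C.kind v' = 0 ∧ φ v = φ v' := ⟨_, fun _ _ => Iff.rfl⟩
  have hcfs : ∀ x y, cf x y → cf y x := by
    intro x y h
    rw [hcf] at h ⊢
    rcases h with h | ⟨v, a, b, v', c, d, e⟩
    · exact Or.inl (hsame _ _ h)
    · exact Or.inr ⟨v', c, d, v, a, b, e.symm⟩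
  obtain ⟨f, hf1, hf2⟩ := greedy_list (α := {x : N // C.kind x = 1}) (fun x y => cf x.1 y.1)
    (fun x y h => hcfs _ _ h) (fun x => L x.1) (by
      intro x
      refine lt_of_le_of_lt ?_ (hL x.1 x.2)
      have h1 := hm' x.1 x.2
      have h2 : (Finset.univ.filter fun x' => C.kind x' = 1 ∧
            ∃ v ∈ F.nbr x.1, C.kind v = 0 ∧ ∃ v' ∈ F.nbr x', C.kind v' = 0 ∧ φ v = φ v').card ≤ (Δ + 1) * (m * (Δ + 1)) := by
        convert share_count F (fun v => C.kind v = 0) (fun x => C.kind x = 1) φ m (by intro w; convert hm w) x.1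
      have h3 : ((Finset.univ.filter fun y : {x : N // C.kind x = 1} => cf x.1 y.1 ∧ y ≠ x).image Subtype.val) ⊆
          (Finset.univ.filter fun y => C.kind y = 1 ∧ same x.1 y) ∪
          (Finset.univ.filter fun x' => C.kind x' = 1 ∧
            ∃ v ∈ F.nbr x.1, C.kind v = 0 ∧ ∃ v' ∈ F.nbr x', C.kind v' = 0 ∧ φ v = φ v') := by
        intro y hy
        obtain ⟨⟨y, hy1⟩, hy2, rfl⟩ := Finset.mem_image.1 hy
        have := (Finset.mem_filter.1 hy2).2.1
        rw [hcf] at this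
        rw [Finset.mem_union, Finset.mem_filter, Finset.mem_filter]
        rcases this with h | h
        · exact Or.inl ⟨Finset.mem_univ _, hy1, h⟩
        · exact Or.inr ⟨Finset.mem_univ _, hy1, h⟩
      have h4 := Finset.card_le_card h3
      rw [Finset.card_image_of_injective _ Subtype.val_injective] at h4
      have h5 := h4.trans (Finset.card_union_le _ _)
      refine le_trans (le_of_eq ?_) (h5.trans (add_le_add h1 h2))
      congr)
  refine ⟨fun x => if h : C.kind x = 1 then f ⟨x, h⟩ else Classical.arbitrary W, ?_, ?_, ?_⟩
  · intro x hx
    simp only [hx, dite_true]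
    exact hf1 ⟨x, hx⟩
  · intro x y hx hy hne h
    simp only [hx, hy, dite_true]
    exact hf2 ⟨x, hx⟩ ⟨y, hy⟩ (fun h => hne (Subtype.mk.inj h)) ((hcf _ _).2 (Or.inl h))
  · intro x y hx hy hne v hv v' hv' hk hk' he
    simp only [hx, hy, dite_true]
    exact hf2 ⟨x, hx⟩ ⟨y, hy⟩ (fun h => hne (Subtype.mk.inj h))
      ((hcf _ _).2 (Or.inr ⟨v, hv, hk, v', hv', hk', he⟩))

/-- the vertices of kinds 2 and 3 -/
lemma zverts {W : Type} [Nonempty W] (G : SimpleGraph W) (U : Finset W) (h0 : ℕ)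
    (hh : biIndep (SimpleGraph.induce (↑U : Set W) G) < h0)
    {F : Forest N t Δ} {ℓ r : ℕ} (C : Cut F ℓ r) (φ : N → W)
    (L : N → Finset W) (hLU : ∀ x, L x ⊆ U) (m M K lam : ℕ) (hΔ : 0 < Δ) (hM : 0 < M)
    (hm : ∀ w, (Finset.univ.filter fun v => C.kind v = 0 ∧ φ v = w ∧
      ∃ x, (C.kind x = 2 ∨ C.kind x = 3) ∧ v ∈ F.nbr x).card ≤ m)
    (hK : ∀ b, (Finset.univ.filter fun v => F.bd v = b ∧ C.kind v = 2).card ≤ K)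
    (hlam : ∀ x, C.kind x = 2 ∨ C.kind x = 3 → lam ≤ (L x).card)
    (hnum : (K * (Δ + 1) + (Δ + 1) * (m * (Δ + 1))) + (t * K * (Δ + 1)) / M + h0 * (Δ * M + Δ + 3) ≤ lam) :
    ∃ ψ : N → W, (∀ x, C.kind x = 2 ∨ C.kind x = 3 → ψ x ∈ L x) ∧
      (∀ x y, C.kind x = 2 ∨ C.kind x = 3 → C.kind y = 2 ∨ C.kind y = 3 → x ≠ y → F.bd x = F.bd y → ψ x ≠ ψ y) ∧
      (∀ x y, C.kind x = 2 ∨ C.kind x = 3 → C.kind y = 2 ∨ C.kind y = 3 → x ≠ y →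
        ∀ v ∈ F.nbr x, ∀ v' ∈ F.nbr y, C.kind v = 0 → C.kind v' = 0 → φ v = φ v' → ψ x ≠ ψ y) ∧
      (∀ c z, C.kind c = 3 → F.par c = some z → G.Adj (ψ c) (ψ z)) ∧
      (∀ c z c' z', C.kind c = 3 → F.par c = some z → C.kind c' = 3 → F.par c' = some z' →
        s(ψ c, ψ z) = s(ψ c', ψ z') → c = c') ∧
      (∀ u, (Finset.univ.filter fun x => (C.kind x = 2 ∨ C.kind x = 3) ∧ ψ x = u).card ≤ M) := by
  obtain ⟨cf, hcf⟩ : ∃ cf : N → N → Prop, ∀ x y, cf x y ↔ F.bd x = F.bd y ∨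
    ∃ v ∈ F.nbr x, C.kind v = 0 ∧ ∃ v' ∈ F.nbr y, C.kind v' = 0 ∧ φ v = φ v' := ⟨_, fun _ _ => Iff.rfl⟩
  have hcfs : ∀ x y, cf x y → cf y x := by
    intro x y h
    rw [hcf] at h ⊢
    rcases h with h | ⟨v, a, b, v', c, d, e⟩
    · exact Or.inl h.symm
    · exact Or.inr ⟨v', c, d, v, a, b, e.symm⟩
  obtain ⟨Z, hZ⟩ : ∃ Z : Finset N, ∀ v, v ∈ Z ↔ C.kind v = 2 :=
    ⟨Finset.univ.filter fun v => C.kind v = 2, fun v => by simp⟩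
  obtain ⟨ch, hch⟩ : ∃ ch : N → Finset N, ∀ z, ch z = Finset.univ.filter fun c => F.par c = some z := ⟨_, fun _ => rfl⟩
  have hch' : ∀ z c, c ∈ ch z ↔ F.par c = some z := by intro z c; rw [hch]; simp
  have k3 : ∀ c z, F.par c = some z → C.kind z = 2 → C.kind c = 3 := by
    intro c z h hz
    rcases C.kinds c z h with h | h | h | h | h | h <;> simp_all
  have k2 : ∀ c z, F.par c = some z → C.kind c = 3 → C.kind z = 2 := by
    intro c z h hz
    rcases C.kinds c z h with h | h | h | h | h | h <;> simp_all
  obtain ⟨own, hownd⟩ : ∃ own : N → N, ∀ c z, F.par c = some z → own c = z :=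
    ⟨fun c => (F.par c).getD c, fun c z h => by simp [h]⟩
  obtain ⟨Y, hYdef⟩ : ∃ Y, Y = Z.biUnion fun z => insert z (ch z) := ⟨_, rfl⟩
  have hY : ∀ x, x ∈ Y ↔ C.kind x = 2 ∨ C.kind x = 3 := by
    intro x
    rw [hYdef, Finset.mem_biUnion]
    constructor
    · rintro ⟨z, hz, hx⟩
      rw [hZ] at hz
      rcases Finset.mem_insert.1 hx with rfl | hx
      · exact Or.inl hz
      · exact Or.inr (k3 x z ((hch' _ _).1 hx) hz)
    · rintro (h | h)
      · exact ⟨x, (hZ x).2 h, Finset.mem_insert_self _ _⟩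
      · obtain ⟨u, hu⟩ := C.kind3 x h
        exact ⟨u, (hZ u).2 (k2 x u hu h), Finset.mem_insert_of_mem ((hch' _ _).2 hu)⟩
  have hYb : ∀ b, (Finset.univ.filter fun x => (C.kind x = 2 ∨ C.kind x = 3) ∧ F.bd x = b).card ≤ K * (Δ + 1) := by
    intro b
    have hs : (Finset.univ.filter fun x => (C.kind x = 2 ∨ C.kind x = 3) ∧ F.bd x = b) ⊆
        (Finset.univ.filter fun v => F.bd v = b ∧ C.kind v = 2).biUnion fun z => insert z (ch z) := by
      intro x hx
      obtain ⟨h1, h2⟩ := (Finset.mem_filter.1 hx).2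
      rcases h1 with h | h
      · exact Finset.mem_biUnion.2 ⟨x, by simp [h, h2], Finset.mem_insert_self _ _⟩
      · obtain ⟨u, hu⟩ := C.kind3 x h
        refine Finset.mem_biUnion.2 ⟨u, ?_, Finset.mem_insert_of_mem ((hch' _ _).2 hu)⟩
        simp [k2 x u hu h, ← F.bd_par _ _ hu, h2]
    refine (Finset.card_le_card hs).trans ?_
    refine (Finset.card_biUnion_le_card_mul _ _ (Δ + 1) ?_).trans (Nat.mul_le_mul_right _ (hK b))
    intro z _
    refine (Finset.card_insert_le _ _).trans ?_
    rw [hch]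
    exact Nat.add_le_add_right (F.child_le z) 1
  have hYc : Y.card ≤ t * K * (Δ + 1) := by
    have hs : Y ⊆ Finset.univ.biUnion fun b => (Finset.univ.filter fun x => (C.kind x = 2 ∨ C.kind x = 3) ∧ F.bd x = b) := by
      intro x hx
      rw [hY] at hx
      exact Finset.mem_biUnion.2 ⟨F.bd x, Finset.mem_univ _, by simp [hx]⟩
    refine (Finset.card_le_card hs).trans ?_
    refine (Finset.card_biUnion_le_card_mul _ _ (K * (Δ + 1)) fun b _ => hYb b).trans ?_
    simp [mul_assoc]
  obtain ⟨ψ, s1, s2, s3, s4, s5⟩ := stars G U h0 hh Z ch own Δ M (K * (Δ + 1) + (Δ + 1) * (m * (Δ + 1)))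
    (t * K * (Δ + 1)) lam hΔ hM (fun z _ => by rw [hch]; exact F.child_le z) (by
      intro z hz c hc
      rw [hch'] at hc
      rw [hZ] at hz
      refine ⟨hownd c z hc, ?_⟩
      rw [hZ, k3 c z hc hz]; decide) L hLU cf hcfs (by
      intro z hz x hx y hy _
      have aux : ∀ x ∈ insert z (ch z), F.bd x = F.bd z := by
        intro x hx
        rcases Finset.mem_insert.1 hx with rfl | hx
        · rfl
        · exact F.bd_par _ _ ((hch' _ _).1 hx)
      rw [hcf]
      exact Or.inl ((aux x hx).trans (aux y hy).symm)) (by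
      rw [← hYdef]
      intro x hx
      have h2 : (Finset.univ.filter fun x' => (C.kind x' = 2 ∨ C.kind x' = 3) ∧
            ∃ v ∈ F.nbr x, C.kind v = 0 ∧ ∃ v' ∈ F.nbr x', C.kind v' = 0 ∧ φ v = φ v').card ≤ (Δ + 1) * (m * (Δ + 1)) := by
        convert share_count F (fun v => C.kind v = 0) (fun x => C.kind x = 2 ∨ C.kind x = 3) φ m
          (by intro w; convert hm w) x
      refine le_trans ?_ (add_le_add (hYb (F.bd x)) h2)
      refine le_trans (Finset.card_le_card ?_) (Finset.card_union_le _ _)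
      intro y hy
      obtain ⟨hy1, hy2⟩ := Finset.mem_filter.1 hy
      rw [hY] at hy1
      rw [hcf] at hy2
      rw [Finset.mem_union, Finset.mem_filter, Finset.mem_filter]
      rcases hy2 with h | h
      · exact Or.inl ⟨Finset.mem_univ _, hy1, h.symm⟩
      · exact Or.inr ⟨Finset.mem_univ _, hy1, h⟩) (by rw [← hYdef]; exact hYc) (by
      rw [← hYdef]
      intro x hx
      exact hlam x ((hY x).1 hx)) hnum
  rw [← hYdef] at s1 s2 s5
  refine ⟨ψ, fun x hx => s1 x ((hY x).2 hx), ?_, ?_, ?_, ?_, ?_⟩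
  · intro x y hx hy hne h
    exact s2 x ((hY x).2 hx) y ((hY y).2 hy) hne ((hcf _ _).2 (Or.inl h))
  · intro x y hx hy hne v hv v' hv' hk hk' he
    exact s2 x ((hY x).2 hx) y ((hY y).2 hy) hne ((hcf _ _).2 (Or.inr ⟨v, hv, hk, v', hv', hk', he⟩))
  · intro c z hc hz
    exact s3 z ((hZ z).2 (k2 c z hz hc)) c ((hch' _ _).2 hz)
  · intro c z c' z' hc hz hc' hz' h
    exact s4 z ((hZ z).2 (k2 c z hz hc)) c ((hch' _ _).2 hz) z' ((hZ z').2 (k2 c' z' hz' hc')) c' ((hch' _ _).2 hz') h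
  · intro u
    refine le_trans (Finset.card_le_card ?_) (s5 u)
    intro x hx
    obtain ⟨h1, h2⟩ := (Finset.mem_filter.1 hx).2
    exact Finset.mem_filter.2 ⟨(hY x).2 h1, h2⟩

end
end ApproxDecomp

namespace ApproxDecomp
section
open scoped Classical

variable {N : Type} [Fintype N] {t Δ : ℕ}

lemma glue {W : Type} (G : SimpleGraph W) {F : Forest N t Δ} {ℓ r : ℕ} (C : Cut F ℓ r)
    (inU inR : W → Prop) (φ0 ψ1 ψ2 : N → W) (M : ℕ)
    (r0 : ∀ v, C.kind v = 0 → ¬ inU (φ0 v) ∧ ¬ inR (φ0 v))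
    (r1 : ∀ v, C.kind v = 1 → ¬ inU (ψ1 v) ∧ inR (ψ1 v))
    (r2 : ∀ v, C.kind v = 2 ∨ C.kind v = 3 → inU (ψ2 v))
    (i0 : ∀ v v', C.kind v = 0 → C.kind v' = 0 → F.bd v = F.bd v' → φ0 v = φ0 v' → v = v')
    (i1 : ∀ v v', C.kind v = 1 → C.kind v' = 1 → v ≠ v' → F.bd v = F.bd v' → ψ1 v ≠ ψ1 v')
    (i2 : ∀ v v', C.kind v = 2 ∨ C.kind v = 3 → C.kind v' = 2 ∨ C.kind v' = 3 → v ≠ v' → F.bd v = F.bd v' →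
      ψ2 v ≠ ψ2 v')
    (a0 : ∀ v u, F.par v = some u → C.kind v = 0 → C.kind u = 0 → G.Adj (φ0 v) (φ0 u))
    (a1 : ∀ x v, C.kind x = 1 → v ∈ F.nbr x → C.kind v = 0 → G.Adj (φ0 v) (ψ1 x))
    (a2 : ∀ x v, C.kind x = 2 ∨ C.kind x = 3 → v ∈ F.nbr x → C.kind v = 0 → G.Adj (φ0 v) (ψ2 x))
    (a3 : ∀ c z, C.kind c = 3 → F.par c = some z → G.Adj (ψ2 c) (ψ2 z))
    (e0 : ∀ v u v' u', F.par v = some u → C.kind v = 0 → C.kind u = 0 →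
      F.par v' = some u' → C.kind v' = 0 → C.kind u' = 0 → s(φ0 v, φ0 u) = s(φ0 v', φ0 u') → v = v')
    (e1 : ∀ x y, C.kind x = 1 → C.kind y = 1 → x ≠ y → ∀ v ∈ F.nbr x, ∀ v' ∈ F.nbr y, C.kind v = 0 →
      C.kind v' = 0 → φ0 v = φ0 v' → ψ1 x ≠ ψ1 y)
    (e2 : ∀ x y, C.kind x = 2 ∨ C.kind x = 3 → C.kind y = 2 ∨ C.kind y = 3 → x ≠ y →
        ∀ v ∈ F.nbr x, ∀ v' ∈ F.nbr y, C.kind v = 0 → C.kind v' = 0 → φ0 v = φ0 v' → ψ2 x ≠ ψ2 y)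
    (e3 : ∀ c z c' z', C.kind c = 3 → F.par c = some z → C.kind c' = 3 → F.par c' = some z' →
        s(ψ2 c, ψ2 z) = s(ψ2 c', ψ2 z') → c = c')
    (us : ∀ u, (Finset.univ.filter fun x => (C.kind x = 2 ∨ C.kind x = 3) ∧ ψ2 x = u).card ≤ M) :
    ∃ φ : N → W, (∀ v v', F.bd v = F.bd v' → φ v = φ v' → v = v') ∧
      (∀ v u, F.par v = some u → G.Adj (φ v) (φ u)) ∧
      (∀ v u v' u', F.par v = some u → F.par v' = some u' → s(φ v, φ u) = s(φ v', φ u') → v = v') ∧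
      (∀ u, inU u → (Finset.univ.filter fun v => φ v = u).card ≤ M) := by
  obtain ⟨φ, hφ⟩ : ∃ φ : N → W, ∀ v, φ v = if C.kind v = 0 then φ0 v else if C.kind v = 1 then ψ1 v else ψ2 v :=
    ⟨_, fun _ => rfl⟩
  have q0 : ∀ v, C.kind v = 0 → φ v = φ0 v := by intro v h; rw [hφ, if_pos h]
  have q1 : ∀ v, C.kind v = 1 → φ v = ψ1 v := by intro v h; rw [hφ, if_neg (by rw [h]; decide), if_pos h]
  have q2 : ∀ v, C.kind v = 2 ∨ C.kind v = 3 → φ v = ψ2 v := by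
    intro v h
    rw [hφ, if_neg (by rcases h with h | h <;> rw [h] <;> decide),
      if_neg (by rcases h with h | h <;> rw [h] <;> decide)]
  have tri : ∀ v, C.kind v = 0 ∨ C.kind v = 1 ∨ (C.kind v = 2 ∨ C.kind v = 3) := by
    intro v
    generalize C.kind v = a
    fin_cases a <;> simp
  have c0 : ∀ v, C.kind v = 0 → ¬ inU (φ v) ∧ ¬ inR (φ v) := fun v h => by rw [q0 v h]; exact r0 v h
  have c1 : ∀ v, C.kind v = 1 → ¬ inU (φ v) ∧ inR (φ v) := fun v h => by rw [q1 v h]; exact r1 v h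
  have c2 : ∀ v, C.kind v = 2 ∨ C.kind v = 3 → inU (φ v) := fun v h => by rw [q2 v h]; exact r2 v h
  have same : ∀ v v', φ v = φ v' → (C.kind v = 0 ∧ C.kind v' = 0) ∨ (C.kind v = 1 ∧ C.kind v' = 1) ∨
      ((C.kind v = 2 ∨ C.kind v = 3) ∧ (C.kind v' = 2 ∨ C.kind v' = 3)) := by
    intro v v' h
    rcases tri v with a | a | a <;> rcases tri v' with b | b | b
    · exact Or.inl ⟨a, b⟩
    · exact absurd (h ▸ (c1 v' b).2) (c0 v a).2
    · exact absurd (h ▸ c2 v' b) (c0 v a).1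
    · exact absurd (h ▸ (c1 v a).2) (c0 v' b).2
    · exact Or.inr (Or.inl ⟨a, b⟩)
    · exact absurd (h ▸ c2 v' b) (c1 v a).1
    · exact absurd (h ▸ c2 v a) (c0 v' b).1
    · exact absurd (h ▸ c2 v a) (c1 v' b).1
    · exact Or.inr (Or.inr ⟨a, b⟩)
  have inj : ∀ v v', F.bd v = F.bd v' → φ v = φ v' → v = v' := by
    intro v v' hb h
    rcases same v v' h with ⟨a, b⟩ | ⟨a, b⟩ | ⟨a, b⟩
    · rw [q0 v a, q0 v' b] at h; exact i0 v v' a b hb h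
    · by_contra hne
      rw [q1 v a, q1 v' b] at h; exact i1 v v' a b hne hb h
    · by_contra hne
      rw [q2 v a, q2 v' b] at h; exact i2 v v' a b hne hb h
  have am : ∀ x v, C.kind x ≠ 0 → v ∈ F.nbr x → C.kind v = 0 → G.Adj (φ v) (φ x) := by
    intro x v hx hv hk
    rw [q0 v hk]
    rcases tri x with h | h | h
    · exact absurd h hx
    · rw [q1 x h]; exact a1 x v h hv hk
    · rw [q2 x h]; exact a2 x v h hv hk
  have cls : ∀ v u, F.par v = some u → (C.kind v = 0 ∧ C.kind u = 0) ∨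
      (∃ p x, C.kind p = 0 ∧ C.kind x ≠ 0 ∧ p ∈ F.nbr x ∧ s(v, u) = s(p, x)) ∨ (C.kind v = 3 ∧ C.kind u = 2) := by
    intro v u h
    rcases C.kinds v u h with a | a | a | a | a | a
    · exact Or.inl a
    · exact Or.inr (Or.inl ⟨v, u, a.1, by rw [a.2]; decide, (F.mem_nbr _ _).2 (Or.inl h), rfl⟩)
    · exact Or.inr (Or.inl ⟨v, u, a.1, by rw [a.2]; decide, (F.mem_nbr _ _).2 (Or.inl h), rfl⟩)
    · exact Or.inr (Or.inl ⟨u, v, a.2, by rw [a.1]; decide, (F.mem_nbr _ _).2 (Or.inr h), Sym2.eq_swap⟩)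
    · exact Or.inr (Or.inl ⟨u, v, a.2, by rw [a.1]; decide, (F.mem_nbr _ _).2 (Or.inr h), Sym2.eq_swap⟩)
    · exact Or.inr (Or.inr a)
  have k0 : ∀ v v', φ v = φ v' → C.kind v = 0 → C.kind v' = 0 := by
    intro v v' h hk
    rcases same v v' h with ⟨a, b⟩ | ⟨a, b⟩ | ⟨a, b⟩
    · exact b
    · rw [hk] at a; exact absurd a (by decide)
    · rw [hk] at a; exact absurd a (by decide)
  have msym : ∀ a b c d : N, s(a, b) = s(c, d) → s(φ a, φ b) = s(φ c, φ d) := by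
    intro a b c d h
    have := congrArg (Sym2.map φ) h
    simpa using this
  refine ⟨φ, inj, ?_, ?_, ?_⟩
  · intro v u h
    rcases cls v u h with ⟨a, b⟩ | ⟨p, x, hp, hx, hpx, he⟩ | ⟨a, b⟩
    · rw [q0 v a, q0 u b]; exact a0 v u h a b
    · have := am x p hx hpx hp
      rcases Sym2.eq_iff.1 he with ⟨rfl, rfl⟩ | ⟨rfl, rfl⟩
      · exact this
      · exact this.symm
    · rw [q2 v (Or.inr a), q2 u (Or.inl b)]; exact a3 v u a h
  · intro v u v' u' h h' he
    rcases cls v u h with ⟨a, b⟩ | ⟨p, x, hp, hx, hpx, hs⟩ | ⟨a, b⟩ <;>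
      rcases cls v' u' h' with ⟨a', b'⟩ | ⟨p', x', hp', hx', hpx', hs'⟩ | ⟨a', b'⟩
    · rw [q0 v a, q0 u b, q0 v' a', q0 u' b'] at he
      exact e0 v u v' u' h a b h' a' b' he
    · rw [msym _ _ _ _ hs'] at he
      exfalso
      rcases Sym2.eq_iff.1 he with ⟨_, e⟩ | ⟨e, _⟩
      · exact hx' (k0 _ _ e b)
      · exact hx' (k0 _ _ e a)
    · exfalso
      rcases Sym2.eq_iff.1 he with ⟨e, _⟩ | ⟨_, e⟩
      · have := k0 _ _ e a
        rw [a'] at this; exact absurd this (by decide)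
      · have := k0 _ _ e b
        rw [a'] at this; exact absurd this (by decide)
    · rw [msym _ _ _ _ hs] at he
      exfalso
      rcases Sym2.eq_iff.1 he with ⟨_, e⟩ | ⟨_, e⟩
      · exact hx (k0 _ _ e.symm b')
      · exact hx (k0 _ _ e.symm a')
    · rw [msym _ _ _ _ hs, msym _ _ _ _ hs'] at he
      rcases Sym2.eq_iff.1 he with ⟨ep, ex⟩ | ⟨e, _⟩
      · have hxx : x = x' := by
          by_contra hne
          have ep' := ep
          rw [q0 p hp, q0 p' hp'] at ep'
          rcases same x x' ex with ⟨a, b⟩ | ⟨a, b⟩ | ⟨a, b⟩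
          · exact hx a
          · rw [q1 x a, q1 x' b] at ex
            exact e1 x x' a b hne p hpx p' hpx' hp hp' ep' ex
          · rw [q2 x a, q2 x' b] at ex
            exact e2 x x' a b hne p hpx p' hpx' hp hp' ep' ex
        subst hxx
        have hpp : p = p' := inj p p' ((F.nbr_bd hpx).trans (F.nbr_bd hpx').symm) ep
        subst hpp
        rcases Sym2.eq_iff.1 (hs.trans hs'.symm) with ⟨e, _⟩ | ⟨g1, g2⟩
        · exact e
        · exfalso
          have d1 := F.dep_some _ _ h
          have d2 := F.dep_some _ _ h'
          rw [g1, g2] at d1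
          omega
      · exact absurd (k0 _ _ e hp) hx'
    · rw [msym _ _ _ _ hs] at he
      exfalso
      rcases Sym2.eq_iff.1 he with ⟨e, _⟩ | ⟨e, _⟩
      · have := k0 _ _ e hp
        rw [a'] at this; exact absurd this (by decide)
      · have := k0 _ _ e hp
        rw [b'] at this; exact absurd this (by decide)
    · exfalso
      rcases Sym2.eq_iff.1 he with ⟨e, _⟩ | ⟨e, _⟩
      · have := k0 _ _ e.symm a'
        rw [a] at this; exact absurd this (by decide)
      · have := k0 _ _ e.symm b'
        rw [a] at this; exact absurd this (by decide)
    · rw [msym _ _ _ _ hs'] at he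
      exfalso
      rcases Sym2.eq_iff.1 he with ⟨e, _⟩ | ⟨_, e⟩
      · have := k0 _ _ e.symm hp'
        rw [a] at this; exact absurd this (by decide)
      · have := k0 _ _ e.symm hp'
        rw [b] at this; exact absurd this (by decide)
    · rw [q2 v (Or.inr a), q2 u (Or.inl b), q2 v' (Or.inr a'), q2 u' (Or.inl b')] at he
      exact e3 v u v' u' a h a' h' he
  · intro u hu
    refine le_trans (Finset.card_le_card ?_) (us u)
    intro v hv
    have hv := (Finset.mem_filter.1 hv).2
    refine Finset.mem_filter.2 ⟨Finset.mem_univ _, ?_⟩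
    rcases tri v with h | h | h
    · exact absurd (hv ▸ hu) (c0 v h).1
    · exact absurd (hv ▸ hu) (c1 v h).1
    · exact ⟨h, by rw [← q2 v h]; exact hv⟩

end
end ApproxDecomp

namespace ApproxDecomp
section
open scoped Classical

variable {N : Type} [Fintype N] {t Δ : ℕ}

set_option maxHeartbeats 1000000 in
lemma core {W : Type} [Nonempty W] (G : SimpleGraph W) (F : Forest N t Δ)
    (U V : Finset W) (r : ℕ) (Us Vs : Fin r → Fin 2 → Finset W)
    (hUV : Disjoint U V) (hUs : ∀ s i, Us s i ⊆ U) (hVs : ∀ s i, Vs s i ⊆ V)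
    (hdisj : ∀ (s : Fin r) (i : Fin 2) (s' : Fin r) (i' : Fin 2),
            (s, i) ≠ (s', i') → Disjoint (Vs s i) (Vs s' i'))
    (n ℓ h k n' n'' D₁ T M K h0 lam : ℕ) (ε d β θ p ρ E : ℝ)
    (hcard : ∀ s i, (Vs s i).card = n) (hUcard : ∀ s i, ε * n ≤ ((Us s i).card : ℝ))
    (hVV : ∀ s o o', o ≠ o' → IsRegularPair G (Vs s o) (Vs s o') ε d)
    (hVU : ∀ s o o', o ≠ o' → IsRegularPair G (Vs s o) (Us s o') ε d)
    (hh0 : biIndep (SimpleGraph.induce (↑U : Set W) G) < h0)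
    (hT : ∀ b, (Finset.univ.filter fun v => F.bd v = b).card ≤ T)
    (hE : ((Finset.univ.filter fun v => F.par v ≠ none).card : ℝ) ≤ E)
    (hℓ : 6 ≤ ℓ) (hh : 0 < h) (hΔ : 0 < Δ) (hr : 0 < r) (hk : 0 < k) (hn' : 0 < n') (hn'' : 0 < n'')
    (hD₁ : 0 < D₁) (hM : 0 < M) (hkn : k * n' ≤ n) (hnn : n'' ≤ n')
    (hε : 0 < ε) (hd : 0 < d) (hβ : 0 < β) (hρ : 0 < ρ) (hρ1 : ρ ≤ 1) (hεn : ε * n ≤ n')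
    (hp0 : 0 < p) (hp1 : p ≤ 1) (hpd : p ≤ d - ε) (hεp : ε ≤ p ^ (Δ + 1) * ρ)
    (hDβ : D₁ + 4 * ε * n / β ≤ d * n' - 1)
    (hsz : T + 2 * r * ((2 * Δ) ^ ℓ * (h + 1)) + 2 * r * (Hw Δ ℓ * n'') ≤ 2 * r * (k * n''))
    (hload : (E / n'' + t * r * Hw Δ ℓ : ℝ) / (r * k ^ 2) +
      Real.sqrt (t * (r * k * k + r * 2 * k)) * (2 * r * k) ≤ D₁)
    (hmark : (t * T / ((ℓ - 4 : ℕ) : ℝ) * (Δ + 1) / n'' + t * r * Hw Δ ℓ : ℝ) / (r * k) +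
      Real.sqrt (t * (r * k * k + r * 2 * k)) * (2 * r * k) ≤ θ * n)
    (hρn : ρ * n + k * n' ≤ n)
    (hcount : n'' + (Wds Δ ℓ).card * (β * n' + (Δ + 1) * (ε * n) + (t * K * (Δ + 1) * (Δ + 1)) / M) < (n' : ℝ))
    (hL : 2 * n / ((ℓ - 4 : ℕ) : ℝ) + (Δ + 1) * (θ * n * (Δ + 1)) < p ^ (Δ + 1) * (ρ * n))
    (hK : T ≤ K * h) (hlam : (lam : ℝ) ≤ p ^ (Δ + 1) * (ε * n))
    (hnum : (K * (Δ + 1) + (Δ + 1) * (M * (Δ + 1))) + (t * K * (Δ + 1)) / M + h0 * (Δ * M + Δ + 3) ≤ lam) :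
    ∃ φ : N → W, (∀ v v', F.bd v = F.bd v' → φ v = φ v' → v = v') ∧
      (∀ v u, F.par v = some u → G.Adj (φ v) (φ u)) ∧
      (∀ v u v' u', F.par v = some u → F.par v' = some u' → s(φ v, φ u) = s(φ v', φ u') → v = v') ∧
      (∀ u ∈ U, (Finset.univ.filter fun v => φ v = u).card ≤ M) := by
  have hnpos : 0 < n := lt_of_lt_of_le (Nat.mul_pos hk hn') hkn
  have hnR : (0:ℝ) < n := by exact_mod_cast hnpos
  have hrR : (0:ℝ) < r := by exact_mod_cast hr
  have hkR : (0:ℝ) < k := by exact_mod_cast hk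
  have hn''R : (0:ℝ) < n'' := by exact_mod_cast hn''
  have hl4 : (0:ℝ) < ((ℓ - 4 : ℕ) : ℝ) := by
    have : 0 < ℓ - 4 := by omega
    exact_mod_cast this
  obtain ⟨C, hC1, hC2, hC3⟩ := F.exists_Cut ℓ h r T hℓ hh hΔ hr hT
  obtain ⟨rt, wd, g1, g2, g3, g4, g5⟩ := C.exists_pieces hΔ
  have hN : (Fintype.card N : ℝ) ≤ t * T := by
    have : Fintype.card N ≤ t * T := by
      rw [← Finset.card_univ]
      have hs : (Finset.univ : Finset N) ⊆ Finset.univ.biUnion fun b => Finset.univ.filter fun v => F.bd v = b := by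
        intro v _
        simp
      refine (Finset.card_le_card hs).trans ?_
      refine (Finset.card_biUnion_le_card_mul _ _ T fun b _ => hT b).trans ?_
      simp
    exact_mod_cast this
  -- total number of kind-1 vertices
  have hX : ((Finset.univ.filter fun x => C.kind x = 1).card : ℝ) ≤ t * T / ((ℓ - 4 : ℕ) : ℝ) := by
    rw [le_div_iff₀ hl4]
    refine le_trans ?_ hN
    have : (Finset.univ.filter fun x => C.kind x = 1).card * (ℓ - 4) ≤ Fintype.card N := by
      have e1 : (Finset.univ.filter fun x => C.kind x = 1).card =
          ∑ q : Fin t × Fin r, (Finset.univ.filter fun v => F.bd v = q.1 ∧ C.sec v = q.2 ∧ C.kind v = 1).card := by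
        rw [Finset.card_eq_sum_card_fiberwise (f := fun v => (F.bd v, C.sec v)) (t := Finset.univ) (by simp)]
        refine Finset.sum_congr rfl fun q _ => ?_
        congr 1
        ext v
        simp only [Finset.mem_filter, Finset.mem_univ, true_and, Prod.ext_iff]
        tauto
      have e2 : Fintype.card N =
          ∑ q : Fin t × Fin r, (Finset.univ.filter fun v => F.bd v = q.1 ∧ C.sec v = q.2).card := by
        rw [← Finset.card_univ,
          Finset.card_eq_sum_card_fiberwise (f := fun v => (F.bd v, C.sec v)) (t := Finset.univ) (by simp)]
        refine Finset.sum_congr rfl fun q _ => ?_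
        congr 1
        ext v
        simp only [Finset.mem_filter, Finset.mem_univ, true_and, Prod.ext_iff]
      rw [e1, e2, Finset.sum_mul]
      exact Finset.sum_le_sum fun q _ => hC2 q.1 q.2
    exact_mod_cast this
  have hsz' : ∀ b s o, (Finset.univ.filter fun v => F.bd v = b ∧ C.sec v = s ∧ C.side v = o).card + Hw Δ ℓ * n''
      ≤ k * n'' := by
    intro b s o
    have := hC1 b s o
    have h2 : 0 < 2 * r := by omega
    refine Nat.le_of_mul_le_mul_left ?_ h2
    rw [mul_add]
    omega
  have hside : ∀ x : Fin 2, x = 0 ∨ x = 1 := by intro x; fin_cases x <;> simp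
  have hbs : ∀ b s, (Finset.univ.filter fun v => F.bd v = b ∧ C.sec v = s).card ≤ 2 * n := by
    intro b s
    have e : (Finset.univ.filter fun v => F.bd v = b ∧ C.sec v = s) ⊆
        (Finset.univ.filter fun v => F.bd v = b ∧ C.sec v = s ∧ C.side v = 0) ∪
        (Finset.univ.filter fun v => F.bd v = b ∧ C.sec v = s ∧ C.side v = 1) := by
      intro v hv
      have hv := (Finset.mem_filter.1 hv).2
      rw [Finset.mem_union, Finset.mem_filter, Finset.mem_filter]
      rcases hside (C.side v) with e | e
      · exact Or.inl ⟨Finset.mem_univ _, hv.1, hv.2, e⟩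
      · exact Or.inr ⟨Finset.mem_univ _, hv.1, hv.2, e⟩
    have h1 := (Finset.card_le_card e).trans (Finset.card_union_le _ _)
    have h2 := hsz' b s 0
    have h3 := hsz' b s 1
    have h4 : k * n'' ≤ n := (Nat.mul_le_mul_left k hnn).trans hkn
    omega
  obtain ⟨Pl⟩ := exists_placement G C rt wd g1 g2 g3 g4 g5 Vs n k n' n'' D₁ ε d β θ hdisj hcard
    (fun s => hVV s 0 1 (by decide)) hr hk hn' hn'' hD₁ hkn hε hd hβ hεn hDβ hsz'
    (le_trans (by gcongr) hload) (le_trans (by gcongr) hmark)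
  -- list sets
  obtain ⟨S, hS⟩ : ∃ S : N → Finset W, ∀ x, S x = if C.kind x = 1 then Pl.R (Pl.sec' x) (C.side x) else
    Us (Pl.sec' x) (C.side x) := ⟨_, fun _ => rfl⟩
  have hS1 : ∀ x, C.kind x = 1 → S x = Pl.R (Pl.sec' x) (C.side x) := fun x hx => by rw [hS, if_pos hx]
  have hS2 : ∀ x, C.kind x = 2 ∨ C.kind x = 3 → S x = Us (Pl.sec' x) (C.side x) := fun x hx => by
    rw [hS, if_neg (by rcases hx with h | h <;> rw [h] <;> decide)]
  have tri : ∀ v, C.kind v = 0 ∨ C.kind v = 1 ∨ (C.kind v = 2 ∨ C.kind v = 3) := by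
    intro v
    generalize C.kind v = a
    fin_cases a <;> simp
  have hRc : ∀ s o, ρ * n ≤ ((Pl.R s o).card : ℝ) := by
    intro s o
    have : ((Pl.R s o).card : ℝ) + k * n' = n := by exact_mod_cast Pl.R_card s o
    linarith
  have hpp : 0 < p ^ (Δ + 1) := by positivity
  have hnb : ∀ x v, C.kind x ≠ 0 → v ∈ F.nbr x → C.kind v = 0 → Pl.sec' v = Pl.sec' x ∧ C.side v ≠ C.side x := by
    intro x v hx hv hk0
    have hbd := F.nbr_bd hv
    rw [F.mem_nbr] at hv
    rcases hv with hv | hv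
    · have hk3 : C.kind v ≠ 3 := by rw [hk0]; decide
      exact ⟨(Pl.sec_iff _ _ hbd).1 (C.sec_eq _ _ hv hk3), C.side_ne _ _ hv hk3⟩
    · have hk3 : C.kind x ≠ 3 := by
        intro h3
        rcases C.kinds x v hv with h | h | h | h | h | h <;> simp_all
      exact ⟨(Pl.sec_iff _ _ hbd).1 (C.sec_eq _ _ hv hk3).symm, (C.side_ne _ _ hv hk3).symm⟩
  obtain ⟨spec, hspecd⟩ : ∃ spec : N → Prop, ∀ v, spec v ↔ ∃ x, (C.kind x = 2 ∨ C.kind x = 3) ∧ v ∈ F.nbr x :=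
    ⟨_, fun _ => Iff.rfl⟩
  have hKb : ∀ b, (Finset.univ.filter fun v => F.bd v = b ∧ C.kind v = 2).card ≤ K := by
    intro b
    exact Nat.le_of_mul_le_mul_right ((hC3 b).trans hK) hh
  have k2 : ∀ c z, F.par c = some z → C.kind c = 3 → C.kind z = 2 := by
    intro c z h hz
    rcases C.kinds c z h with h | h | h | h | h | h <;> simp_all
  have hspec : ((Finset.univ.filter fun v => spec v).card : ℝ) ≤ t * K * (Δ + 1) * (Δ + 1) := by
    have h1 : (Finset.univ.filter fun v => spec v) ⊆
        ((Finset.univ.biUnion fun b => (Finset.univ.filter fun v => F.bd v = b ∧ C.kind v = 2)).biUnion fun z =>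
          insert z (Finset.univ.filter fun c => F.par c = some z)).biUnion fun x => F.nbr x := by
      intro v hv
      have hv := (Finset.mem_filter.1 hv).2
      rw [hspecd] at hv
      obtain ⟨x, hx, hv⟩ := hv
      refine Finset.mem_biUnion.2 ⟨x, ?_, hv⟩
      rcases hx with hx | hx
      · refine Finset.mem_biUnion.2 ⟨x, ?_, Finset.mem_insert_self _ _⟩
        exact Finset.mem_biUnion.2 ⟨F.bd x, Finset.mem_univ _, by simp [hx]⟩
      · obtain ⟨u, hu⟩ := C.kind3 x hx
        refine Finset.mem_biUnion.2 ⟨u, ?_, Finset.mem_insert_of_mem (by simp [hu])⟩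
        exact Finset.mem_biUnion.2 ⟨F.bd u, Finset.mem_univ _, by simp [k2 x u hu hx]⟩
    have h2 : (Finset.univ.filter fun v => spec v).card ≤ t * K * (Δ + 1) * (Δ + 1) := by
      refine (Finset.card_le_card h1).trans ?_
      refine (Finset.card_biUnion_le_card_mul _ _ (Δ + 1) fun x _ => F.nbr_card x).trans ?_
      refine Nat.mul_le_mul_right _ ?_
      refine (Finset.card_biUnion_le_card_mul _ _ (Δ + 1) ?_).trans ?_
      · intro z _
        exact (Finset.card_insert_le _ _).trans (Nat.add_le_add_right (F.child_le z) 1)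
      refine Nat.mul_le_mul_right _ ?_
      refine (Finset.card_biUnion_le_card_mul _ _ K fun b _ => hKb b).trans ?_
      simp
    exact_mod_cast h2
  obtain ⟨y, y1, y2, y3, y4⟩ := choose_roots g1 g2 g3
    (fun x v v' hx hv hv' hk hk' hh => C.one_per_piece rt wd g3 g4 g5 x v v' hx hv hv' hk hk' hh) Pl S
    (fun x => p ^ (Δ + 1) * (S x).card) p (ε * n) M hM hp0 hp1 hn' (fun x => le_rfl) (by
      intro x v hx hv hk0 B' hB' hlB
      obtain ⟨f1, f2⟩ := hnb x v hx hv hk0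
      have fin : ∀ B : Finset W, IsRegularPair G (Vs (Pl.sec' x) (C.side v)) B ε d → B' ⊆ B → ε * B.card ≤ B'.card →
          0 < B'.card →
          ((Finset.univ.filter fun y => ((B'.filter fun b => G.Adj (Pl.place v y) b).card : ℝ) < p * B'.card).card : ℝ)
          ≤ ε * n := by
        intro B hreg hsub hsz hpos
        have := reg_low hreg (by rw [hcard]; positivity) B' hsub hsz hpos
        rw [hcard] at this
        refine le_trans ?_ this.le
        rw [← Finset.card_image_of_injective _ (Pl.place_inj v)]
        norm_cast
        refine Finset.card_le_card ?_
        intro w hw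
        obtain ⟨y, hy, rfl⟩ := Finset.mem_image.1 hw
        have hy := (Finset.mem_filter.1 hy).2
        refine Finset.mem_filter.2 ⟨f1 ▸ Pl.place_mem v y, lt_of_lt_of_le hy ?_⟩
        gcongr
      rcases tri x with h | h | h
      · exact absurd h hx
      · rw [hS1 x h] at hB' hlB
        have hb := hRc (Pl.sec' x) (C.side x)
        have hb2 : p ^ (Δ + 1) * (ρ * n) ≤ B'.card := le_trans (by gcongr) hlB
        refine fin _ (hVV _ _ _ f2) (hB'.trans (Pl.R_sub _ _)) ?_ ?_
        · rw [hcard]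
          refine le_trans ?_ hb2
          rw [← mul_assoc]
          gcongr
        · have : 0 < p ^ (Δ + 1) * (ρ * n) := by positivity
          exact_mod_cast this.trans_le hb2
      · rw [hS2 x h] at hB' hlB
        have hb := hUcard (Pl.sec' x) (C.side x)
        have hb2 : p ^ (Δ + 1) * (ε * n) ≤ B'.card := le_trans (by gcongr) hlB
        refine fin _ (hVU _ _ _ f2) hB' ?_ ?_
        · refine le_trans ?_ hlB
          gcongr
          refine hεp.trans ?_
          nlinarith
        · have : 0 < p ^ (Δ + 1) * (ε * n) := by positivity
          exact_mod_cast this.trans_le hb2)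
    spec (t * K * (Δ + 1) * (Δ + 1)) hspec (by positivity) hβ.le hcount
  obtain ⟨φ, hφ⟩ : ∃ φ : N → W, ∀ v, φ v = Pl.place v (y (rt v)) := ⟨_, fun _ => rfl⟩
  have i0 : ∀ v v', C.kind v = 0 → C.kind v' = 0 → F.bd v = F.bd v' → φ v = φ v' → v = v' := by
    intro v v' hv hv' hb he
    rw [hφ, hφ] at he
    obtain ⟨q1, q2, q3⟩ := Pl.bundle_inj v v' _ _ hv hv' hb he
    exact g3 v v' (y2 v v' hv hv' q1 q3) q2
  have e0 : ∀ v u v' u', F.par v = some u → C.kind v = 0 → C.kind u = 0 →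
      F.par v' = some u' → C.kind v' = 0 → C.kind u' = 0 → s(φ v, φ u) = s(φ v', φ u') → v = v' := by
    intro v u v' u' h hv hu h' hv' hu' he
    rw [hφ, hφ, hφ, hφ, ← (g4 v u h hv hu).1, ← (g4 v' u' h' hv' hu').1] at he
    obtain ⟨q1, q2, q3⟩ := Pl.edge_inj v u v' u' _ _ h hv hu h' hv' hu' (y1 v hv) (y1 v' hv') he
    exact g3 v v' (y2 v v' hv hv' q1 q3) q2
  obtain ⟨L, hLd⟩ : ∃ L : N → Finset W, ∀ x, L x = (S x).filter fun w => ∀ v ∈ F.nbr x, C.kind v = 0 →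
      G.Adj (Pl.place v (y (rt v))) w := ⟨_, fun _ => rfl⟩
  have hLS : ∀ x, L x ⊆ S x := fun x => by rw [hLd]; exact Finset.filter_subset _ _
  have hLadj : ∀ x, ∀ w ∈ L x, ∀ v ∈ F.nbr x, C.kind v = 0 → G.Adj (φ v) w := by
    intro x w hw v hv hk0
    rw [hLd] at hw
    rw [hφ]
    exact (Finset.mem_filter.1 hw).2 v hv hk0
  have hLc : ∀ x, C.kind x ≠ 0 → p ^ (Δ + 1) * (S x).card ≤ ((L x).card : ℝ) := by
    intro x hx
    rw [hLd]
    exact y3 x hx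
  obtain ⟨same, hsame⟩ : ∃ same : N → N → Prop, ∀ x y, same x y ↔ F.bd x = F.bd y ∧ C.sec x = C.sec y :=
    ⟨_, fun _ _ => Iff.rfl⟩
  obtain ⟨ψ1, x1, x2, x3⟩ := xverts C φ
    same (fun x y h => by rw [hsame] at h ⊢; exact ⟨h.1.symm, h.2.symm⟩)
    L ⌊θ * n⌋₊ (2 * n / (ℓ - 4)) (by
      intro w
      refine Nat.le_floor ?_
      refine le_trans ?_ (Pl.mark w)
      norm_cast
      refine Finset.card_le_card_of_injOn F.bd ?_ ?_
      · intro v hv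
        have hv := (Finset.mem_filter.1 hv).2
        refine Finset.mem_coe.2 (Finset.mem_filter.2 ⟨Finset.mem_univ _, v, ⟨hv.1, hv.2.2⟩, rfl, y (rt v), ?_⟩)
        rw [← hφ]; exact hv.2.1
      · intro v hv v' hv' hb
        have hv := (Finset.mem_filter.1 hv).2
        have hv' := (Finset.mem_filter.1 hv').2
        exact i0 v v' hv.1 hv'.1 hb (hv.2.1.trans hv'.2.1.symm)) (by
      intro x _
      rw [Nat.le_div_iff_mul_le (by omega)]
      refine le_trans ?_ ((hC2 (F.bd x) (C.sec x)).trans (hbs _ _))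
      refine Nat.mul_le_mul_right _ (Finset.card_le_card ?_)
      intro z hz
      have hz := (Finset.mem_filter.1 hz).2
      rw [hsame] at hz
      exact Finset.mem_filter.2 ⟨Finset.mem_univ _, hz.2.1.symm, hz.2.2.symm, hz.1⟩) (by
      intro x hx
      have h1 := hLc x (by rw [hx]; decide)
      rw [hS1 x hx] at h1
      have h2 : p ^ (Δ + 1) * (ρ * n) ≤ p ^ (Δ + 1) * ((Pl.R (Pl.sec' x) (C.side x)).card : ℝ) := by
        gcongr
        exact hRc _ _
      have h3 : ((2 * n / (ℓ - 4) : ℕ) : ℝ) ≤ 2 * n / ((ℓ - 4 : ℕ) : ℝ) := by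
        refine Nat.cast_div_le.trans ?_
        push_cast; rfl
      have hθ : 0 ≤ θ * n := le_trans (by positivity) hmark
      have h4 := Nat.floor_le hθ
      have h5 : ((Δ:ℝ) + 1) * ((⌊θ * n⌋₊ : ℝ) * (Δ + 1)) ≤ (Δ + 1) * (θ * n * (Δ + 1)) := by gcongr
      have h6 : (((2 * n / (ℓ - 4)) + (Δ + 1) * (⌊θ * n⌋₊ * (Δ + 1)) : ℕ) : ℝ) < ((L x).card : ℝ) := by
        rw [Nat.cast_add]
        push_cast at h3 ⊢
        linarith
      exact_mod_cast h6)
  obtain ⟨L', hL'd⟩ : ∃ L' : N → Finset W, ∀ x, L' x = if C.kind x = 2 ∨ C.kind x = 3 then L x else ∅ :=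
    ⟨_, fun _ => rfl⟩
  obtain ⟨ψ2, z1, z2, z3, z4, z5, z6⟩ := zverts G U h0 hh0 C φ L' (by
      intro x
      rw [hL'd]
      split_ifs with hx
      · refine (hLS x).trans ?_
        rw [hS2 x hx]; exact hUs _ _
      · simp) M M K lam hΔ hM (by
      intro w
      refine le_trans (Finset.card_le_card ?_) (y4 w)
      intro v hv
      have hv := (Finset.mem_filter.1 hv).2
      refine Finset.mem_filter.2 ⟨Finset.mem_univ _, (hspecd v).2 hv.2.2, hv.1, ?_⟩
      rw [← hφ]; exact hv.2.1) hKb (by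
      intro x hx
      rw [hL'd, if_pos hx]
      have h1 := hLc x (by rcases hx with h | h <;> rw [h] <;> decide)
      rw [hS2 x hx] at h1
      have h2 : p ^ (Δ + 1) * (ε * n) ≤ p ^ (Δ + 1) * ((Us (Pl.sec' x) (C.side x)).card : ℝ) := by
        gcongr
        exact hUcard _ _
      exact_mod_cast hlam.trans (h2.trans h1)) hnum
  have z1' : ∀ x, C.kind x = 2 ∨ C.kind x = 3 → ψ2 x ∈ L x := by
    intro x hx
    have := z1 x hx
    rwa [hL'd, if_pos hx] at this
  have hVnU : ∀ w ∈ V, w ∉ U := fun w hw hw' => Finset.disjoint_left.1 hUV hw' hw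
  have hR1 : ∀ x, C.kind x = 1 → ψ1 x ∈ Pl.R (Pl.sec' x) (C.side x) := by
    intro x hx
    have := hLS x (x1 x hx)
    rwa [hS1 x hx] at this
  obtain ⟨Φ, o1, o2, o3, o4⟩ := glue G C (fun w => w ∈ U) (fun w => ∃ s o, w ∈ Pl.R s o) φ ψ1 ψ2 M (by
      intro v _
      rw [hφ]
      refine ⟨hVnU _ (hVs _ _ (Pl.place_mem v _)), ?_⟩
      rintro ⟨s, o, h⟩
      exact Pl.place_not _ _ _ _ h) (by
      intro v hv
      exact ⟨hVnU _ (hVs _ _ (Pl.R_sub _ _ (hR1 v hv))), _, _, hR1 v hv⟩) (by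
      intro v hv
      have := hLS v (z1' v hv)
      rw [hS2 v hv] at this
      exact hUs _ _ this) i0 (by
      intro v v' hv hv' hne hb
      by_cases hs : C.sec v = C.sec v'
      · exact x2 v v' hv hv' hne ((hsame _ _).2 ⟨hb, hs⟩)
      · intro he
        have a1 := Pl.R_sub _ _ (hR1 v hv)
        have a2 := Pl.R_sub _ _ (hR1 v' hv')
        rw [← he] at a2
        refine Finset.disjoint_left.1 (hdisj _ _ _ _ ?_) a1 a2
        intro hc
        exact hs ((Pl.sec_iff v v' hb).2 (Prod.mk.inj hc).1)) z2 (by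
      intro v u h hv hu
      rw [hφ, hφ, ← (g4 v u h hv hu).1]
      exact Pl.adj v u _ h hv hu (y1 v hv)) (by
      intro x v hx hv hk0
      exact hLadj x _ (x1 x hx) v hv hk0) (by
      intro x v hx hv hk0
      exact hLadj x _ (z1' x hx) v hv hk0) z4 e0 x3 z3 z5 z6
  exact ⟨Φ, o1, o2, o3, o4⟩

end
end ApproxDecomp

namespace ApproxDecomp
section

lemma num_sizes (ν : ℝ) (h0 : 0 < ν) (h1 : ν < 1) (k n : ℕ) (hk : 0 < k) (hn : 8 * (k:ℝ) ≤ ν * n) :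
    ∃ n' n'' : ℕ, ν / 8 * n + k * n' ≤ (n:ℝ) ∧ (n:ℝ) ≤ 2 * k * n' ∧ (n'':ℝ) ≤ (1 - ν / 8) * n' ∧
      (1 - ν / 2) * n ≤ k * (n'':ℝ) ∧ (1 - ν / 8) * n ≤ k * (n':ℝ) + k ∧ 0 < n' ∧ 0 < n'' ∧ n'' ≤ n' ∧ k * n' ≤ n := by
  have hkR : (0:ℝ) < k := by exact_mod_cast hk
  have hnR : (0:ℝ) < n := by
    by_contra h
    push Not at h
    nlinarith
  obtain ⟨a, ha⟩ : ∃ a : ℝ, a = (1 - ν / 8) * n / k := ⟨_, rfl⟩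
  have hka : k * a = (1 - ν / 8) * n := by rw [ha]; field_simp
  have ha0 : 0 ≤ a := by rw [ha]; apply div_nonneg _ hkR.le; apply mul_nonneg _ hnR.le; linarith
  have f1 := Nat.floor_le ha0
  have f2 := Nat.lt_floor_add_one a
  set n' := ⌊a⌋₊
  have hb0 : 0 ≤ (1 - ν / 8) * (n':ℝ) := by apply mul_nonneg _ (Nat.cast_nonneg _); linarith
  have g1 := Nat.floor_le hb0
  have g2 := Nat.lt_floor_add_one ((1 - ν / 8) * (n':ℝ))
  set n'' := ⌊(1 - ν / 8) * (n':ℝ)⌋₊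
  have e1 : k * (n':ℝ) ≤ (1 - ν / 8) * n := by rw [← hka]; gcongr
  have e2 : (1 - ν / 8) * n ≤ k * (n':ℝ) + k := by
    rw [← hka]
    nlinarith
  have hkn : 8 * (k:ℝ) ≤ n := by nlinarith
  have e3 : (1 - ν / 2) * n ≤ k * (n'':ℝ) := by
    have : k * ((1 - ν / 8) * (n':ℝ)) ≤ k * (n'':ℝ) + k := by nlinarith
    have h3 : (1 - ν / 8) * ((1 - ν / 8) * n) ≤ (1 - ν / 8) * (k * (n':ℝ) + k) := by
      apply mul_le_mul_of_nonneg_left e2; linarith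
    nlinarith
  have p'' : 0 < n'' := by
    rcases Nat.eq_zero_or_pos n'' with h | h
    · rw [h] at e3; push_cast at e3; nlinarith
    · exact h
  have le : n'' ≤ n' := by
    have : (n'':ℝ) ≤ n' := by nlinarith [(Nat.cast_nonneg n' : (0:ℝ) ≤ n')]
    exact_mod_cast this
  refine ⟨n', n'', by linarith, ?_, g1, e3, e2, by omega, p'', le, ?_⟩
  · nlinarith
  · have : (k * n' : ℝ) ≤ n := by nlinarith
    exact_mod_cast this

lemma num_sqrt (t n : ℕ) (A B γ : ℝ) (hA : 0 ≤ A) (hB : 0 ≤ B) (hγ : 0 < γ) (ht : (t:ℝ) ≤ 3 * n)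
    (hn : 3 * A * B ^ 2 / γ ^ 2 ≤ n) : Real.sqrt (t * A) * B ≤ γ * n := by
  have hn0 : (0:ℝ) ≤ n := Nat.cast_nonneg n
  rw [div_le_iff₀ (by positivity)] at hn
  have : Real.sqrt (t * A) * B = Real.sqrt (t * A * B ^ 2) := by
    rw [Real.sqrt_mul' _ (sq_nonneg B), Real.sqrt_sq hB]
  rw [this]
  apply Real.sqrt_le_iff.2
  refine ⟨by positivity, ?_⟩
  have h1 : t * A * B ^ 2 ≤ 3 * n * A * B ^ 2 := by gcongr
  nlinarith

lemma num_sz (ν c : ℝ) (r n k n'' T h H P : ℕ) (h0 : 0 < ν) (hr : 0 < r) (hk : 0 < k)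
    (hT : (T:ℝ) ≤ 2 * (1 - ν) * r * n) (hn'' : k * (n'':ℝ) ≤ n) (hd : (1 - ν / 2) * n ≤ k * (n'':ℝ))
    (hH : 8 * (H:ℝ) ≤ ν * k) (hc : (P:ℝ) * c ≤ ν / 16) (hh : (h:ℝ) ≤ c * n) (hP : (P:ℝ) ≤ ν / 16 * n) :
    T + 2 * r * (P * (h + 1)) + 2 * r * (H * n'') ≤ 2 * r * (k * n'') := by
  have hrR : (0:ℝ) < r := by exact_mod_cast hr
  have hkR : (0:ℝ) < k := by exact_mod_cast hk
  have e1 : (P:ℝ) * h ≤ ν / 16 * n := by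
    calc (P:ℝ) * h ≤ P * (c * n) := by gcongr
      _ = (P * c) * n := by ring
      _ ≤ ν / 16 * n := by gcongr
  have e2 : (H:ℝ) * n'' ≤ ν / 8 * n := by
    calc (H:ℝ) * n'' ≤ (ν * k / 8) * n'' := by gcongr; linarith
      _ = ν / 8 * (k * n'') := by ring
      _ ≤ ν / 8 * n := by gcongr
  have : (T + 2 * r * (P * (h + 1)) + 2 * r * (H * n'') : ℝ) ≤ 2 * r * (k * n'') := by
    have : (1 - ν) * n + P * (h + 1) + H * n'' ≤ k * (n'':ℝ) := by
      have : (0:ℝ) ≤ ν * n := by positivity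
      linarith
    have h2 := mul_le_mul_of_nonneg_left this (by positivity : (0:ℝ) ≤ 2 * r)
    nlinarith
  exact_mod_cast this

lemma num_load (ν d s : ℝ) (r n k n'' t H : ℕ) (h0 : 0 < ν) (h1 : ν < 1) (hd : 0 < d) (hr : 0 < r) (hk : 0 < k)
    (hn : 0 < n) (hd'' : (1 - ν / 2) * n ≤ k * (n'':ℝ)) (ht : (t:ℝ) ≤ 3 * n) (hH : 48 * (H:ℝ) ≤ ν * d * k)
    (hs : s ≤ ν * d / (16 * k) * n) :
    ((1 - ν) * r * d * n ^ 2 / n'' + t * r * H : ℝ) / (r * k ^ 2) + s ≤ (1 - 3 * ν / 8) * d * n / k := by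
  have hrR : (0:ℝ) < r := by exact_mod_cast hr
  have hkR : (0:ℝ) < k := by exact_mod_cast hk
  have hnR : (0:ℝ) < n := by exact_mod_cast hn
  have hn2 : 0 < (1 - ν / 2) * n := mul_pos (by linarith) hnR
  have hn''R : (0:ℝ) < n'' := by
    by_contra h
    push Not at h
    nlinarith
  have e1 : (1 - ν) * r * d * n ^ 2 / n'' / (r * k ^ 2) ≤ (1 - ν / 2) * d * n / k := by
    rw [div_div, div_le_div_iff₀ (by positivity) hkR]
    have q : (1 - ν) * n ≤ (1 - ν / 2) * (k * n'') := by
      have := mul_le_mul_of_nonneg_left hd'' (by linarith : (0:ℝ) ≤ 1 - ν / 2)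
      nlinarith [mul_nonneg (sq_nonneg ν) hnR.le]
    have := mul_le_mul_of_nonneg_left q (by positivity : 0 ≤ r * d * n * k)
    nlinarith
  have e2 : t * r * H / (r * k ^ 2) ≤ ν * d / (16 * k) * n := by
    rw [div_mul_eq_mul_div, div_le_div_iff₀ (by positivity) (by positivity)]
    have : (t:ℝ) * (48 * H) ≤ 3 * n * (ν * d * k) := by gcongr
    have := mul_le_mul_of_nonneg_left this (by positivity : 0 ≤ r * (k:ℝ) / 3)
    nlinarith
  rw [add_div]
  have e3 : (1 - 3 * ν / 8) * d * n / k = (1 - ν / 2) * d * n / k + ν * d / (16 * k) * n + ν * d / (16 * k) * n := by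
    field_simp; ring
  linarith

lemma num_mark (ν θ s : ℝ) (r n k n'' t T H Δ l : ℕ) (h0 : 0 < ν) (h1 : ν < 1) (hr : 0 < r) (hk : 0 < k)
    (hn : 0 < n) (hl : 0 < l) (hθ : 0 < θ) (hd'' : (1 - ν / 2) * n ≤ k * (n'':ℝ)) (ht : (t:ℝ) ≤ 3 * n)
    (hT : (T:ℝ) ≤ 2 * (1 - ν) * r * n) (hH : 12 * (H:ℝ) ≤ θ * k) (hlθ : 48 * ((Δ:ℝ) + 1) ≤ θ * l)
    (hs : s ≤ θ / 4 * n) :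
    (t * T / (l:ℝ) * (Δ + 1) / n'' + t * r * H : ℝ) / (r * k) + s ≤ θ * n := by
  have hrR : (0:ℝ) < r := by exact_mod_cast hr
  have hkR : (0:ℝ) < k := by exact_mod_cast hk
  have hnR : (0:ℝ) < n := by exact_mod_cast hn
  have hlR : (0:ℝ) < l := by exact_mod_cast hl
  have hn2 : (1:ℝ) / 2 * n ≤ k * n'' := by nlinarith
  have hn''R : (0:ℝ) < n'' := by
    by_contra h
    push Not at h
    nlinarith
  have hT' : (T:ℝ) ≤ 2 * r * n := by
    have : (0:ℝ) ≤ ν * (r * n) := by positivity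
    nlinarith
  have e1 : t * T / (l:ℝ) * (Δ + 1) / n'' / (r * k) ≤ θ / 4 * n := by
    rw [div_mul_eq_mul_div, div_div, div_div, div_le_iff₀ (by positivity)]
    calc (t:ℝ) * T * (Δ + 1) ≤ (3 * n) * (2 * r * n) * (θ * l / 48) := by gcongr; linarith
      _ = θ / 4 * n * (l * r) * (1 / 2 * n) := by ring
      _ ≤ θ / 4 * n * (l * r) * (k * n'') := by gcongr
      _ = _ := by ring
  have e2 : t * r * H / (r * k) ≤ θ / 4 * n := by
    rw [div_le_iff₀ (by positivity)]
    calc (t:ℝ) * r * H ≤ 3 * n * r * (θ * k / 12) := by gcongr; linarith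
      _ = _ := by ring
  rw [add_div]
  have : 0 ≤ θ * n := by positivity
  linarith

lemma num_D (ν d β ε : ℝ) (n k n' : ℕ) (h0 : 0 < ν) (h1 : ν < 1) (hd : 0 < d) (hd1 : d ≤ 1) (hk : 0 < k) (hn : 0 < n)
    (hn' : (1 - ν / 8) * n ≤ k * (n':ℝ) + k) (hβ : 0 < β)
    (hε : 4 * ε * (8 * k) ≤ ν * d * β) (hn3 : 3 * (8 * k) ≤ ν * d * (n:ℝ)) :
    ((⌈(1 - 3 * ν / 8) * d * n / k⌉₊ : ℕ) : ℝ) + 4 * ε * n / β ≤ d * n' - 1 := by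
  have hkR : (0:ℝ) < k := by exact_mod_cast hk
  have hnR : (0:ℝ) < n := by exact_mod_cast hn
  have hpos : 0 ≤ (1 - 3 * ν / 8) * d * n / k := by
    apply div_nonneg _ hkR.le
    have : 0 ≤ 1 - 3 * ν / 8 := by linarith
    positivity
  have f := Nat.ceil_lt_add_one hpos
  have e1 : 4 * ε * n / β ≤ ν * d * n / (8 * k) := by
    rw [div_le_div_iff₀ hβ (by positivity)]
    have := mul_le_mul_of_nonneg_left hε hnR.le
    nlinarith
  have e2 : (1 - ν / 8) * n / k - 1 ≤ n' := by
    rw [sub_le_iff_le_add, div_le_iff₀ hkR]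
    nlinarith
  have e3 : d * ((1 - ν / 8) * n / k - 1) ≤ d * n' := by gcongr
  have e4 : 3 ≤ ν * d * n / (8 * k) := by rw [le_div_iff₀ (by positivity)]; linarith
  have e5 : d * ((1 - ν / 8) * n / k - 1) = (1 - 3 * ν / 8) * d * n / k + ν * d * n / (8 * k) + ν * d * n / (8 * k) - d := by
    field_simp; ring
  linarith

lemma num_count (ν β ε : ℝ) (n k n' n'' t K M Cw Δ : ℕ) (h0 : 0 < ν) (h1 : ν < 1) (hn' : 0 < n') (hM : 0 < M)
    (hn'' : (n'':ℝ) ≤ (1 - ν / 8) * n') (hb : (n:ℝ) ≤ 2 * k * n') (ht : (t:ℝ) ≤ 3 * n)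
    (hβ : 4 * (Cw * β) ≤ ν / 8) (hε0 : 0 < ε) (hε : Cw * ((Δ + 1) * ε) * (2 * k) ≤ ν / 8 / 4)
    (hMl : Cw * (3 * K * (Δ + 1) * (Δ + 1)) * (2 * k) ≤ ν / 8 / 4 * (M:ℝ)) :
    n'' + Cw * (β * n' + (Δ + 1) * (ε * n) + (t * K * (Δ + 1) * (Δ + 1)) / M) < (n' : ℝ) := by
  have hn'R : (0:ℝ) < n' := by exact_mod_cast hn'
  have hMR : (0:ℝ) < M := by exact_mod_cast hM
  have e1 : Cw * (β * n') ≤ ν / 8 / 4 * n' := by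
    have := mul_le_mul_of_nonneg_right hβ hn'R.le
    linarith
  have e2 : Cw * ((Δ + 1) * (ε * n)) ≤ ν / 8 / 4 * n' := by
    calc Cw * ((Δ + 1) * (ε * n)) ≤ Cw * ((Δ + 1) * (ε * (2 * k * n'))) := by gcongr
      _ = Cw * ((Δ + 1) * ε) * (2 * k) * n' := by ring
      _ ≤ _ := by gcongr
  have e3 : Cw * ((t * K * (Δ + 1) * (Δ + 1)) / M : ℝ) ≤ ν / 8 / 4 * n' := by
    rw [← mul_div_assoc, div_le_iff₀ hMR]
    calc (Cw:ℝ) * (t * K * (Δ + 1) * (Δ + 1)) ≤ Cw * ((3 * (2 * k * n')) * K * (Δ + 1) * (Δ + 1)) := by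
          gcongr; linarith
      _ = Cw * (3 * K * (Δ + 1) * (Δ + 1)) * (2 * k) * n' := by ring
      _ ≤ ν / 8 / 4 * (M:ℝ) * n' := by gcongr
      _ = _ := by ring
  have : 0 < ν * n' := by positivity
  rw [mul_add, mul_add]
  linarith

lemma num_stars (w : ℝ) (n t K M Δ h0 : ℕ) (hw : 0 < w) (hΔ : 1 ≤ Δ) (hM : 0 < M) (ht : (t:ℝ) ≤ 3 * n)
    (hM1 : 12 * K * ((Δ:ℝ) + 1) ≤ w * M) (hM2 : 20 * (Δ:ℝ) ≤ w * M)
    (hh0 : (h0:ℝ) ≤ n / (M:ℝ) ^ 6 + 1)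
    (hn : (K * (Δ + 1) + (Δ + 1) * (M * (Δ + 1)) + (Δ * M + Δ + 3) + 1 : ℝ) ≤ w / 4 * n) :
    (K * (Δ + 1) + (Δ + 1) * (M * (Δ + 1))) + (t * K * (Δ + 1)) / M + h0 * (Δ * M + Δ + 3) ≤ ⌊w * n⌋₊ := by
  have hMR : (0:ℝ) < M := by exact_mod_cast hM
  have hM1R : (1:ℝ) ≤ M := by exact_mod_cast hM
  have hΔR : (1:ℝ) ≤ Δ := by exact_mod_cast hΔ
  have hn0 : (0:ℝ) ≤ n := Nat.cast_nonneg n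
  apply Nat.le_floor
  have e1 : (((t * K * (Δ + 1)) / M : ℕ) : ℝ) ≤ w / 4 * n := by
    refine Nat.cast_div_le.trans ?_
    rw [div_le_iff₀ hMR]
    push_cast
    calc (t:ℝ) * K * (Δ + 1) ≤ 3 * n * K * (Δ + 1) := by gcongr
      _ = n / 4 * (12 * K * (Δ + 1)) := by ring
      _ ≤ n / 4 * (w * M) := by gcongr
      _ = _ := by ring
  have e2 : (h0:ℝ) * (Δ * M + Δ + 3) ≤ w / 4 * n + (Δ * M + Δ + 3) := by
    have q : (n:ℝ) / (M:ℝ) ^ 6 * (Δ * M + Δ + 3) ≤ w / 4 * n := by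
      rw [div_mul_eq_mul_div, div_le_iff₀ (by positivity)]
      have q1 : (Δ * M + Δ + 3 : ℝ) ≤ 5 * Δ * M := by nlinarith
      have q2 : (1:ℝ) ≤ M ^ 4 := one_le_pow₀ hM1R
      have q3 : 5 * Δ * M ≤ w / 4 * M * M := by nlinarith
      have q4 : w / 4 * M * M ≤ w / 4 * M * M * M ^ 4 := le_mul_of_one_le_right (by positivity) q2
      calc (n:ℝ) * (Δ * M + Δ + 3) ≤ n * (w / 4 * M * M * M ^ 4) := by gcongr; linarith
        _ = _ := by ring
    calc (h0:ℝ) * (Δ * M + Δ + 3) ≤ (n / (M:ℝ) ^ 6 + 1) * (Δ * M + Δ + 3) := by gcongr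
      _ = n / (M:ℝ) ^ 6 * (Δ * M + Δ + 3) + (Δ * M + Δ + 3) := by ring
      _ ≤ _ := by linarith
  rw [Nat.cast_add, Nat.cast_add]
  push_cast at e1 e2 ⊢
  have : 0 ≤ w * n := by positivity
  linarith

end
end ApproxDecomp

namespace ApproxDecomp
section
open scoped Classical

lemma num_K (ν c : ℝ) (r n T K h : ℕ) (hν0 : 0 < ν) (hK' : 4 * (r:ℝ) ≤ K * c) (w5 : 2 ≤ c * n)
    (hh2 : c * n < h + 1) (hTR : (T:ℝ) ≤ 2 * (1 - ν) * r * n) : T ≤ K * h := by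
  have : (T:ℝ) ≤ K * h := by
    have a1 : c * n / 2 ≤ h := by linarith
    have a2 : (T:ℝ) ≤ 2 * r * n := by
      have : (0:ℝ) ≤ ν * (r * n) := by positivity
      nlinarith
    calc (T:ℝ) ≤ 2 * r * n := a2
      _ = 4 * r * n / 2 := by ring
      _ ≤ K * c * n / 2 := by gcongr
      _ = K * (c * n / 2) := by ring
      _ ≤ K * h := by gcongr
  exact_mod_cast this

lemma num_beta (ν β : ℝ) (Cw : ℕ) (hβ0 : 0 < β) (hβ : β = ν / 8 / (4 * (Cw + 1))) : 4 * (Cw * β) ≤ ν / 8 := by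
  have : β * (4 * (Cw + 1)) = ν / 8 := by rw [hβ]; field_simp
  nlinarith

lemma num_eps6 (ν ε ε₀ : ℝ) (Cw Δ k : ℕ) (hk : 0 < (k:ℝ)) (hε : 0 < ε) (hεε : ε ≤ ε₀)
    (h6 : ε₀ ≤ ν / 8 / 4 / ((Cw + 1) * (Δ + 1) * (2 * k))) : Cw * ((Δ + 1) * ε) * (2 * k) ≤ ν / 8 / 4 := by
  have := hεε.trans h6
  rw [le_div_iff₀ (by positivity)] at this
  have h9 : 0 ≤ (Δ + 1) * ε * (2 * k) := by positivity
  nlinarith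

lemma num_L (q0 θ : ℝ) (n l Δ : ℕ) (hq0 : 0 < q0) (hn : 0 < (n:ℝ)) (hl : 0 < (l:ℝ)) (hl1 : 4 ≤ q0 * l)
    (hθ : θ = q0 / (4 * (Δ + 1) ^ 2)) :
    (Δ + 1) * (θ * n * (Δ + 1)) = q0 / 4 * n ∧ 2 * n / (l:ℝ) ≤ q0 / 2 * n ∧ 0 < q0 * n := by
  refine ⟨by rw [hθ]; field_simp, ?_, by positivity⟩
  rw [div_le_iff₀ hl]
  have := mul_le_mul_of_nonneg_right hl1 hn.le
  nlinarith

set_option maxHeartbeats 8000000 in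
lemma core_main (ν : ℝ) (Δ : ℕ) (hν0 : 0 < ν) (hν1 : ν < 1) (hΔ : 1 ≤ Δ) (d : ℝ) (hd0 : 0 < d) (hd1 : d ≤ 1) :
    ∃ ε₀ : ℝ, 0 < ε₀ ∧ ∀ (r : ℕ) (ε : ℝ), 0 < r → 0 < ε → ε ≤ ε₀ →
      ∃ M₀ : ℕ, ∀ M : ℕ, M₀ ≤ M → ∃ n₀ : ℕ, 0 < n₀ ∧ ∀ n : ℕ, n₀ ≤ n →
        ∀ (W : Type) (G : SimpleGraph W) (U V : Finset W) (Us Vs : Fin r → Fin 2 → Finset W),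
          Nonempty W → Disjoint U V → (∀ s i, Us s i ⊆ U) → (∀ s i, Vs s i ⊆ V) →
          (∀ (s : Fin r) (i : Fin 2) (s' : Fin r) (i' : Fin 2),
            (s, i) ≠ (s', i') → Disjoint (Vs s i) (Vs s' i')) →
          (∀ s i, (Vs s i).card = n) → (∀ s i, ε * n ≤ ((Us s i).card : ℝ)) →
          (∀ s o o', o ≠ o' → IsRegularPair G (Vs s o) (Vs s o') ε d) →
          (∀ s o o', o ≠ o' → IsRegularPair G (Vs s o) (Us s o') ε d) →
          ((biIndep (SimpleGraph.induce (↑U : Set W) G) : ℝ) ≤ (n : ℝ) / (M : ℝ) ^ 6) →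
          ∀ (N : Type) [Fintype N] (t : ℕ) (F : Forest N t Δ), (t:ℝ) ≤ 3 * n →
            (∀ b, ((Finset.univ.filter fun v => F.bd v = b).card : ℝ) ≤ 2 * (1 - ν) * r * n) →
            ((Finset.univ.filter fun v => F.par v ≠ none).card : ℝ) ≤ (1 - ν) * r * d * n ^ 2 →
            ∃ φ : N → W, (∀ v v', F.bd v = F.bd v' → φ v = φ v' → v = v') ∧
              (∀ v u, F.par v = some u → G.Adj (φ v) (φ u)) ∧
              (∀ v u v' u', F.par v = some u → F.par v' = some u' → s(φ v, φ u) = s(φ v', φ u') → v = v') ∧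
              (∀ u ∈ U, (Finset.univ.filter fun v => φ v = u).card ≤ M) := by
  have hΔR : (1:ℝ) ≤ Δ := by exact_mod_cast hΔ
  obtain ⟨p, hp⟩ : ∃ p : ℝ, p = d / 2 := ⟨_, rfl⟩
  have hp0 : 0 < p := by rw [hp]; positivity
  obtain ⟨ρ, hρ⟩ : ∃ ρ : ℝ, ρ = ν / 8 := ⟨_, rfl⟩
  have hρ0 : 0 < ρ := by rw [hρ]; positivity
  obtain ⟨q0, hq0⟩ : ∃ q0 : ℝ, q0 = p ^ (Δ + 1) * ρ := ⟨_, rfl⟩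
  have hq0p : 0 < q0 := by rw [hq0]; positivity
  obtain ⟨θ, hθ⟩ : ∃ θ : ℝ, θ = q0 / (4 * (Δ + 1) ^ 2) := ⟨_, rfl⟩
  have hθ0 : 0 < θ := by rw [hθ]; positivity
  obtain ⟨l, hl⟩ := exists_nat_ge (4 / q0 + 48 * ((Δ:ℝ) + 1) / θ + 2)
  have hq4 : 0 < 4 / q0 := by positivity
  have hq5 : 0 < 48 * ((Δ:ℝ) + 1) / θ := by positivity
  have hl2 : 2 ≤ l := by
    have : (2:ℝ) ≤ l := by linarith
    exact_mod_cast this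
  have hlR : (0:ℝ) < l := by linarith
  have hl1 : 4 ≤ q0 * l := by
    have : 4 / q0 ≤ l := by linarith
    rw [div_le_iff₀ hq0p] at this; linarith
  have hl3 : 48 * ((Δ:ℝ) + 1) ≤ θ * l := by
    have : 48 * ((Δ:ℝ) + 1) / θ ≤ l := by linarith
    rw [div_le_iff₀ hθ0] at this; linarith
  obtain ⟨ℓ, hℓ⟩ : ∃ ℓ : ℕ, ℓ = l + 4 := ⟨_, rfl⟩
  have hℓ4 : ℓ - 4 = l := by omega
  obtain ⟨H, hH⟩ : ∃ H : ℕ, H = Hw Δ ℓ := ⟨_, rfl⟩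
  obtain ⟨Cw, hCw⟩ : ∃ Cw : ℕ, Cw = (Wds Δ ℓ).card := ⟨_, rfl⟩
  obtain ⟨P, hP⟩ : ∃ P : ℕ, P = (2 * Δ) ^ ℓ := ⟨_, rfl⟩
  have hPpos : 0 < P := by rw [hP]; positivity
  have hPR : (0:ℝ) < P := by exact_mod_cast hPpos
  obtain ⟨k, hk⟩ := exists_nat_ge (8 * (H:ℝ) / ν + 48 * H / (ν * d) + 12 * H / θ + 1)
  have j1 : 0 ≤ 8 * (H:ℝ) / ν := by positivity
  have j2 : 0 ≤ 48 * (H:ℝ) / (ν * d) := by positivity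
  have j3 : 0 ≤ 12 * (H:ℝ) / θ := by positivity
  have hkR : (1:ℝ) ≤ k := by linarith
  have hkpos : 0 < k := by exact_mod_cast (lt_of_lt_of_le one_pos hkR)
  have hk0 : (0:ℝ) < k := by linarith
  have hk1 : 8 * (H:ℝ) ≤ ν * k := by
    have : 8 * (H:ℝ) / ν ≤ k := by linarith
    rw [div_le_iff₀ hν0] at this; linarith
  have hk2 : 48 * (H:ℝ) ≤ ν * d * k := by
    have : 48 * (H:ℝ) / (ν * d) ≤ k := by linarith
    rw [div_le_iff₀ (by positivity)] at this; linarith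
  have hk3 : 12 * (H:ℝ) ≤ θ * k := by
    have : 12 * (H:ℝ) / θ ≤ k := by linarith
    rw [div_le_iff₀ hθ0] at this; linarith
  obtain ⟨β, hβ⟩ : ∃ β : ℝ, β = ν / 8 / (4 * (Cw + 1)) := ⟨_, rfl⟩
  have hβ0 : 0 < β := by rw [hβ]; positivity
  have hβ1 : 4 * (Cw * β) ≤ ν / 8 := num_beta ν β Cw hβ0 hβ
  obtain ⟨c, hc⟩ : ∃ c : ℝ, c = ν / 16 / P := ⟨_, rfl⟩
  have hc0 : 0 < c := by rw [hc]; positivity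
  have hPc : (P:ℝ) * c ≤ ν / 16 := by rw [hc]; apply le_of_eq; field_simp
  -- epsilon threshold
  obtain ⟨ε₀, h1, h2, h3, h4, h5, h6⟩ : ∃ ε₀ : ℝ, 0 < ε₀ ∧ ε₀ ≤ d / 2 ∧ ε₀ ≤ q0 ∧ ε₀ ≤ 1 / (2 * k) ∧
      ε₀ ≤ ν * d * β / (4 * (8 * k)) ∧ ε₀ ≤ ν / 8 / 4 / ((Cw + 1) * (Δ + 1) * (2 * k)) := by
    refine ⟨min (d / 2) (min q0 (min (1 / (2 * k)) (min (ν * d * β / (4 * (8 * k)))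
      (ν / 8 / 4 / ((Cw + 1) * (Δ + 1) * (2 * k)))))), ?_, ?_, ?_, ?_, ?_, ?_⟩
    · refine lt_min (by positivity) (lt_min hq0p (lt_min (by positivity) (lt_min (by positivity) (by positivity))))
    all_goals simp
  refine ⟨ε₀, h1, ?_⟩
  intro r ε hr hε hεε
  have hrR : (0:ℝ) < r := by exact_mod_cast hr
  obtain ⟨K, hK⟩ := exists_nat_ge (4 * r / c)
  have hK' : 4 * r ≤ K * c := by rwa [div_le_iff₀ hc0] at hK
  obtain ⟨w, hw⟩ : ∃ w : ℝ, w = p ^ (Δ + 1) * ε := ⟨_, rfl⟩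
  have hw0 : 0 < w := by rw [hw]; positivity
  obtain ⟨M₀, hM₀⟩ := exists_nat_ge (Cw * (3 * K * (Δ + 1) * (Δ + 1)) * (2 * k) / (ν / 8 / 4) +
    12 * K * ((Δ:ℝ) + 1) / w + 20 * (Δ:ℝ) / w + 1)
  refine ⟨M₀, ?_⟩
  intro M hM
  have hMR : (M₀:ℝ) ≤ M := by exact_mod_cast hM
  have i1 : 0 ≤ Cw * (3 * K * ((Δ:ℝ) + 1) * (Δ + 1)) * (2 * k) / (ν / 8 / 4) := by positivity
  have i2 : 0 ≤ 12 * K * ((Δ:ℝ) + 1) / w := by positivity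
  have i3 : 0 ≤ 20 * (Δ:ℝ) / w := by positivity
  have hMpos : 0 < M := by
    have : (0:ℝ) < M := by linarith
    exact_mod_cast this
  have hM1 : Cw * (3 * K * ((Δ:ℝ) + 1) * (Δ + 1)) * (2 * k) ≤ ν / 8 / 4 * M := by
    have : Cw * (3 * K * ((Δ:ℝ) + 1) * (Δ + 1)) * (2 * k) / (ν / 8 / 4) ≤ M := by linarith
    rw [div_le_iff₀ (by positivity)] at this; linarith
  have hM2 : 12 * K * ((Δ:ℝ) + 1) ≤ w * M := by
    have : 12 * K * ((Δ:ℝ) + 1) / w ≤ M := by linarith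
    rw [div_le_iff₀ hw0] at this; linarith
  have hM3 : 20 * (Δ:ℝ) ≤ w * M := by
    have : 20 * (Δ:ℝ) / w ≤ M := by linarith
    rw [div_le_iff₀ hw0] at this; linarith
  obtain ⟨A, hA⟩ : ∃ A : ℝ, A = (r * k * k + r * 2 * k : ℝ) := ⟨_, rfl⟩
  obtain ⟨B, hB⟩ : ∃ B : ℝ, B = (2 * r * k : ℝ) := ⟨_, rfl⟩
  have hA0 : 0 ≤ A := by rw [hA]; positivity
  have hB0 : 0 ≤ B := by rw [hB]; positivity
  obtain ⟨γ, hγ⟩ : ∃ γ : ℝ, γ = min (θ / 4) (ν * d / (16 * k)) := ⟨_, rfl⟩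
  have hγ0 : 0 < γ := by rw [hγ]; exact lt_min (by positivity) (by positivity)
  have hγ1 : γ ≤ θ / 4 := by rw [hγ]; exact min_le_left _ _
  have hγ2 : γ ≤ ν * d / (16 * k) := by rw [hγ]; exact min_le_right _ _
  obtain ⟨Q, hQ⟩ : ∃ Q : ℝ, Q = (K * (Δ + 1) + (Δ + 1) * (M * (Δ + 1)) + (Δ * M + Δ + 3) + 1 : ℝ) := ⟨_, rfl⟩
  have hQ0 : 0 ≤ Q := by rw [hQ]; positivity
  obtain ⟨n₀, hn₀⟩ := exists_nat_ge (8 * k / ν + P / (ν / 16) + 3 * A * B ^ 2 / γ ^ 2 + 3 * (8 * k) / (ν * d) +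
    2 / c + Q / (w / 4) + 1)
  have u1 : 0 ≤ 8 * k / ν := by positivity
  have u2 : 0 ≤ P / (ν / 16) := by positivity
  have u3 : 0 ≤ 3 * A * B ^ 2 / γ ^ 2 := by positivity
  have u4 : 0 ≤ 3 * (8 * k) / (ν * d) := by positivity
  have u5 : 0 ≤ 2 / c := by positivity
  have u6 : 0 ≤ Q / (w / 4) := by positivity
  refine ⟨n₀, ?_, ?_⟩
  · have : (0:ℝ) < n₀ := by linarith
    exact_mod_cast this
  intro n hn W G U V Us Vs hW hUV hUs hVs hdisj hcard hUcard hVV hVU hbi N _ t F ht hT hE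
  have hnn : (n₀:ℝ) ≤ n := by exact_mod_cast hn
  have hnR : (0:ℝ) < n := by linarith
  have hnpos : 0 < n := by exact_mod_cast hnR
  have w1 : 8 * (k:ℝ) ≤ ν * n := by
    have : 8 * k / ν ≤ n := by linarith
    rw [div_le_iff₀ hν0] at this; linarith
  have w2 : (P:ℝ) ≤ ν / 16 * n := by
    have : P / (ν / 16) ≤ n := by linarith
    rw [div_le_iff₀ (by positivity)] at this; linarith
  have w3 : 3 * A * B ^ 2 / γ ^ 2 ≤ n := by linarith
  have w4 : 3 * (8 * k) ≤ ν * d * n := by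
    have : 3 * (8 * k) / (ν * d) ≤ n := by linarith
    rw [div_le_iff₀ (by positivity)] at this; linarith
  have w5 : 2 ≤ c * n := by
    have : 2 / c ≤ n := by linarith
    rw [div_le_iff₀ hc0] at this; linarith
  have w6 : Q ≤ w / 4 * n := by
    have : Q / (w / 4) ≤ n := by linarith
    rw [div_le_iff₀ (by positivity)] at this; linarith
  obtain ⟨n', n'', s1, s2, s3, s4, s5, s6, s7, s8, s9⟩ := num_sizes ν hν0 hν1 k n hkpos w1
  have hkn'' : k * (n'':ℝ) ≤ n := by
    have : k * n'' ≤ n := (Nat.mul_le_mul_left k s8).trans s9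
    exact_mod_cast this
  obtain ⟨h, hh⟩ : ∃ h : ℕ, h = ⌊c * n⌋₊ := ⟨_, rfl⟩
  have hh1 : (h:ℝ) ≤ c * n := by rw [hh]; exact Nat.floor_le (by positivity)
  have hh2 : c * n < h + 1 := by rw [hh]; exact Nat.lt_floor_add_one _
  have hhpos : 0 < h := by
    have : (0:ℝ) < h := by linarith
    exact_mod_cast this
  have hT0 : 0 ≤ 2 * (1 - ν) * r * n := by
    have : 0 ≤ 1 - ν := by linarith
    positivity
  obtain ⟨T, hTd⟩ : ∃ T : ℕ, T = ⌊2 * (1 - ν) * r * n⌋₊ := ⟨_, rfl⟩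
  have hTR : (T:ℝ) ≤ 2 * (1 - ν) * r * n := by rw [hTd]; exact Nat.floor_le hT0
  have hKh : T ≤ K * h := num_K ν c r n T K h hν0 hK' w5 hh2 hTR
  have hsq := num_sqrt t n A B γ hA0 hB0 hγ0 ht w3
  have hsq1 : Real.sqrt (t * A) * B ≤ θ / 4 * n := hsq.trans (by gcongr)
  have hsq2 : Real.sqrt (t * A) * B ≤ ν * d / (16 * k) * n := hsq.trans (by gcongr)
  have hε2 : ε * n ≤ n' := by
    have : ε ≤ 1 / (2 * k) := hεε.trans h4
    rw [le_div_iff₀ (by positivity)] at this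
    have h9 : ε * n ≤ ε * (2 * k * n') := by gcongr
    have h10 : ε * (2 * k) * n' ≤ 1 * n' := by gcongr
    linarith
  have hε5 : 4 * ε * (8 * k) ≤ ν * d * β := by
    have := hεε.trans h5
    rw [le_div_iff₀ (by positivity)] at this; linarith
  have hε6 : Cw * ((Δ + 1) * ε) * (2 * k) ≤ ν / 8 / 4 := num_eps6 ν ε ε₀ Cw Δ k hk0 hε hεε h6
  have hload := num_load ν d _ r n k n'' t H hν0 hν1 hd0 hr hkpos hnpos s4 ht hk2 hsq2
  have hmark := num_mark ν θ _ r n k n'' t T H Δ l hν0 hν1 hr hkpos hnpos (by omega) hθ0 s4 ht hTR hk3 hl3 hsq1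
  refine core G F U V r Us Vs hUV hUs hVs hdisj n ℓ h k n' n'' ⌈(1 - 3 * ν / 8) * d * n / k⌉₊ T M K
    (⌊(n:ℝ) / (M:ℝ) ^ 6⌋₊ + 1) ⌊w * n⌋₊ ε d β θ p ρ ((1 - ν) * r * d * n ^ 2) hcard hUcard hVV hVU ?_ ?_ hE
    (by omega) hhpos (by omega) hr hkpos s6 s7 ?_ hMpos s9 s8 hε hd0 hβ0 hρ0 (by rw [hρ]; linarith) hε2 hp0
    (by rw [hp]; linarith) (by rw [hp]; linarith) (by rw [← hq0]; linarith) ?_ ?_ ?_ ?_ ?_ ?_ ?_ hKh ?_ ?_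
  · exact Nat.lt_succ_of_le (Nat.le_floor hbi)
  · intro b
    rw [hTd]
    exact Nat.le_floor (hT b)
  · rw [Nat.ceil_pos]
    apply div_pos _ hk0
    have : 0 < 1 - 3 * ν / 8 := by linarith
    positivity
  · exact num_D ν d β ε n k n' hν0 hν1 hd0 hd1 hkpos hnpos s5 hβ0 hε5 w4
  · rw [← hP, ← hH]
    exact num_sz ν c r n k n'' T h H P hν0 hr hkpos hTR hkn'' s4 hk1 hPc hh1 w2
  · rw [← hH, ← hA, ← hB]
    exact hload.trans (Nat.le_ceil _)
  · rw [← hH, ← hA, ← hB, hℓ4]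
    exact hmark
  · rw [hρ]; exact s1
  · rw [← hCw]
    exact num_count ν β ε n k n' n'' t K M Cw Δ hν0 hν1 s6 hMpos s3 s2 ht hβ1 hε hε6 hM1
  · rw [hℓ4, ← mul_assoc (p ^ (Δ + 1)), ← hq0]
    obtain ⟨a1, a2, a3⟩ := num_L q0 θ n l Δ hq0p hnR hlR hl1 hθ
    rw [a1]
    clear * - a2 a3
    linarith
  · rw [← mul_assoc, ← hw]
    exact Nat.floor_le (by positivity)
  · refine num_stars w n t K M Δ _ hw0 hΔ hMpos ht hM2 hM3 ?_ ?_
    · push_cast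
      have := Nat.floor_le (by positivity : 0 ≤ (n:ℝ) / (M:ℝ) ^ 6)
      linarith
    · rw [← hQ]; exact w6

end
end ApproxDecomp

namespace ApproxDecomp
section
open scoped Classical

lemma tree_root {V : Type} [Fintype V] (T : SimpleGraph V) (hT : T.IsTree) :
    ∃ (par : V → Option V) (dep : V → ℕ),
      (∀ v u, par v = some u → dep v = dep u + 1) ∧ (∀ v, par v = none → dep v = 0) ∧
      (∀ v u, par v = some u → T.Adj v u) ∧ (∀ a b, T.Adj a b → par a = some b ∨ par b = some a) ∧
      (Finset.univ.filter fun v => par v ≠ none).card + 1 = Fintype.card V ∧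
      T.edgeSet.ncard + 1 = Fintype.card V := by
  obtain ⟨x⟩ := hT.1.nonempty
  have key : ∀ v, v ≠ x → ∃ u, T.Adj v u ∧ T.dist v x = T.dist u x + 1 := by
    intro v hv
    obtain ⟨p, hp⟩ := (hT.1.preconnected v x).exists_walk_length_eq_dist
    cases p with
    | nil => exact absurd rfl hv
    | @cons _ u _ h q =>
      refine ⟨u, h, le_antisymm ?_ ?_⟩
      · obtain ⟨q', hq'⟩ := (hT.1.preconnected u x).exists_walk_length_eq_dist
        have := SimpleGraph.dist_le (SimpleGraph.Walk.cons h q')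
        rw [SimpleGraph.Walk.length_cons, hq'] at this
        exact this
      · have := SimpleGraph.dist_le q
        rw [← hp, SimpleGraph.Walk.length_cons]
        omega
  choose! f hf1 hf2 using key
  have hx : ∀ v, (if v = x then none else some (f v)) = none ↔ v = x := by
    intro v; split_ifs <;> simp_all
  have hs : ∀ v u, (if v = x then none else some (f v)) = some u ↔ v ≠ x ∧ f v = u := by
    intro v u; split_ifs <;> simp_all
  have hcard : (Finset.univ.filter fun v => v ≠ x).card + 1 = Fintype.card V := by
    rw [Finset.filter_ne' Finset.univ x, Finset.card_erase_add_one (Finset.mem_univ _), Finset.card_univ]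
  have he := hT.card_edgeFinset
  have himg : (Finset.univ.filter fun v => v ≠ x).image (fun v => s(v, f v)) = T.edgeFinset := by
    apply Finset.eq_of_subset_of_card_le
    · intro e he
      simp only [Finset.mem_image, Finset.mem_filter, Finset.mem_univ, true_and] at he
      obtain ⟨v, hv, rfl⟩ := he
      rw [SimpleGraph.mem_edgeFinset]
      exact hf1 v hv
    · rw [Finset.card_image_of_injOn]
      · omega
      · intro v hv v' hv' h
        simp only [Finset.coe_filter, Finset.mem_univ, true_and, Set.mem_ofPred_eq] at hv hv'
        simp only [Sym2.eq_iff] at h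
        rcases h with h | h
        · exact h.1
        · have a := hf2 v hv
          have b := hf2 v' hv'
          rw [h.2] at a
          rw [← h.1] at b
          omega
  refine ⟨fun v => if v = x then none else some (f v), fun v => T.dist v x, ?_, ?_, ?_, ?_, ?_, ?_⟩
  · intro v u h
    obtain ⟨h1, rfl⟩ := (hs v u).1 h
    exact hf2 v h1
  · intro v h
    rw [(hx v).1 h]
    simp
  · intro v u h
    obtain ⟨h1, rfl⟩ := (hs v u).1 h
    exact hf1 v h1
  · intro a b hab
    have : s(a, b) ∈ T.edgeFinset := by rw [SimpleGraph.mem_edgeFinset]; exact hab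
    rw [← himg] at this
    simp only [Finset.mem_image, Finset.mem_filter, Finset.mem_univ, true_and] at this
    obtain ⟨v, hv, h⟩ := this
    rw [Sym2.eq_iff] at h
    rcases h with ⟨rfl, h⟩ | ⟨rfl, h⟩
    · left; exact (hs _ _).2 ⟨hv, h⟩
    · right; exact (hs _ _).2 ⟨hv, h⟩
  · rw [← hcard]
    congr 2
    ext v
    simp [hx]
  · rw [← he, ← SimpleGraph.coe_edgeFinset, Set.ncard_coe_finset]

lemma bins {ι : Type} (m : ι → ℕ) (S : ℝ) (hm : ∀ i, (m i : ℝ) ≤ S) (s : Finset ι) :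
    ∃ (t : ℕ) (bd : ι → ℕ) (b0 : ℕ), (∀ i ∈ s, bd i < t) ∧
      (∀ b, ((∑ i ∈ s.filter (fun i => bd i = b), m i : ℕ) : ℝ) ≤ max S 0) ∧
      (∀ b < t, b ≠ b0 → S / 2 ≤ ((∑ i ∈ s.filter (fun i => bd i = b), m i : ℕ) : ℝ)) := by
  induction s using Finset.induction_on with
  | empty => exact ⟨0, fun _ => 0, 0, by simp, by simp, by simp⟩
  | @insert j s hj ih =>
    obtain ⟨t, bd, b0, h1, h2, h3⟩ := ih
    have upd : ∀ c b, ∑ i ∈ (insert j s).filter (fun i => Function.update bd j c i = b), m i =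
        (if c = b then m j else 0) + ∑ i ∈ s.filter (fun i => bd i = b), m i := by
      intro c b
      have e : s.filter (fun i => Function.update bd j c i = b) = s.filter (fun i => bd i = b) := by
        apply Finset.filter_congr
        intro i hi
        rw [Function.update_of_ne (by rintro rfl; exact hj hi)]
      rw [Finset.filter_insert, Function.update_self, e]
      split_ifs with hcb
      · rw [Finset.sum_insert (by simp [hj])]
      · simp
    by_cases hc : b0 < t ∧ (m j : ℝ) + ((∑ i ∈ s.filter (fun i => bd i = b0), m i : ℕ) : ℝ) ≤ S
    · refine ⟨t, Function.update bd j b0, b0, ?_, ?_, ?_⟩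
      · intro i hi
        by_cases hij : i = j
        · subst hij; simpa using hc.1
        · rw [Function.update_of_ne hij]; exact h1 i (Finset.mem_of_mem_insert_of_ne hi hij)
      · intro b
        rw [upd]
        split_ifs with hb
        · subst hb; push_cast at hc ⊢; exact hc.2.trans (le_max_left _ _)
        · rw [zero_add]; exact h2 b
      · intro b hb hbb
        rw [upd, if_neg (Ne.symm hbb), zero_add]; exact h3 b hb hbb
    · have hz : ∑ i ∈ s.filter (fun i => bd i = t), m i = 0 := by
        rw [Finset.filter_false_of_mem, Finset.sum_empty]
        intro i hi; exact (h1 i hi).ne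
      have hnew : ∀ b0', (∀ b < t, b ≠ b0' → S / 2 ≤ ((∑ i ∈ s.filter (fun i => bd i = b), m i : ℕ) : ℝ)) →
          (t ≠ b0' → S / 2 ≤ m j) → ∃ (t : ℕ) (bd : ι → ℕ) (b0 : ℕ), (∀ i ∈ insert j s, bd i < t) ∧
      (∀ b, ((∑ i ∈ (insert j s).filter (fun i => bd i = b), m i : ℕ) : ℝ) ≤ max S 0) ∧
      (∀ b < t, b ≠ b0 → S / 2 ≤ ((∑ i ∈ (insert j s).filter (fun i => bd i = b), m i : ℕ) : ℝ)) := by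
        intro b0' g1 g2
        refine ⟨t + 1, Function.update bd j t, b0', ?_, ?_, ?_⟩
        · intro i hi
          by_cases hij : i = j
          · subst hij; simp
          · rw [Function.update_of_ne hij]
            exact (h1 i (Finset.mem_of_mem_insert_of_ne hi hij)).trans (Nat.lt_succ_self _)
        · intro b
          rw [upd]
          split_ifs with hb
          · subst hb; rw [hz, add_zero]; exact (hm j).trans (le_max_left _ _)
          · rw [zero_add]; exact h2 b
        · intro b hb hbb
          rw [upd]
          split_ifs with htb
          · subst htb; rw [hz, add_zero]; exact g2 hbb
          · rw [zero_add]; exact g1 b (by omega) hbb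
      by_cases hj2 : S / 2 ≤ m j
      · exact hnew b0 h3 (fun _ => hj2)
      · refine hnew t ?_ (fun h => absurd rfl h)
        intro b hb _
        by_cases hbb : b = b0
        · subst hbb
          have : ¬ ((m j : ℝ) + ((∑ i ∈ s.filter (fun i => bd i = b), m i : ℕ) : ℝ) ≤ S) := fun h => hc ⟨hb, h⟩
          push Not at this hj2
          linarith
        · exact h3 b hb hbb

lemma bins_count {ι : Type} [Fintype ι] (m : ι → ℕ) (S : ℝ) (hS : 0 ≤ S) (hm : ∀ i, (m i : ℝ) ≤ S) :
    ∃ (t : ℕ) (bd : ι → Fin t),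
      (∀ b, ((∑ i ∈ Finset.univ.filter (fun i => bd i = b), m i : ℕ) : ℝ) ≤ S) ∧
      ((t:ℝ) - 1) * (S / 2) ≤ ((∑ i, m i : ℕ) : ℝ) := by
  obtain ⟨t, bd, b0, h1, h2, h3⟩ := bins m S hm Finset.univ
  refine ⟨t, fun i => ⟨bd i, h1 i (Finset.mem_univ _)⟩, ?_, ?_⟩
  · intro b
    have := h2 b
    rw [max_eq_left hS] at this
    simpa [Fin.ext_iff] using this
  · have e : ∑ i, m i = ∑ b ∈ Finset.range t, ∑ i ∈ Finset.univ.filter (fun i => bd i = b), m i :=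
      (Finset.sum_fiberwise_of_maps_to (fun i hi => Finset.mem_range.2 (h1 i hi)) _).symm
    have e2 : ((∑ b ∈ (Finset.range t).erase b0, ∑ i ∈ Finset.univ.filter (fun i => bd i = b), m i : ℕ) : ℝ)
        ≤ ((∑ i, m i : ℕ) : ℝ) := by
      rw [e]
      exact_mod_cast Finset.sum_le_sum_of_subset (Finset.erase_subset _ _)
    refine le_trans ?_ e2
    rw [Nat.cast_sum]
    refine le_trans ?_ (Finset.card_nsmul_le_sum _ _ (S / 2) ?_)
    · rw [nsmul_eq_mul]
      have : (t:ℝ) - 1 ≤ ((Finset.range t).erase b0).card := by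
        have := Finset.pred_card_le_card_erase (s := Finset.range t) (a := b0)
        rw [Finset.card_range] at this
        have : t ≤ ((Finset.range t).erase b0).card + 1 := by omega
        have : (t:ℝ) ≤ ((Finset.range t).erase b0).card + 1 := by exact_mod_cast this
        linarith
      gcongr
    · intro b hb
      rw [Finset.mem_erase, Finset.mem_range] at hb
      exact h3 b hb.2 hb.1

end
end ApproxDecomp

namespace ApproxDecomp
section
open scoped Classical

set_option maxHeartbeats 1000000 in
lemma pack_big (ν d : ℝ) (Δ r n M : ℕ) (hν1 : ν < 1) (hd0 : 0 < d) (hd1 : d ≤ 1)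
    (hr : 0 < r) (hn : 0 < n) (W : Type) (G : SimpleGraph W) (U : Finset W)
    (hcore : ∀ (N : Type) [Fintype N] (t : ℕ) (F : Forest N t Δ), (t:ℝ) ≤ 3 * n →
            (∀ b, ((Finset.univ.filter fun v => F.bd v = b).card : ℝ) ≤ 2 * (1 - ν) * r * n) →
            ((Finset.univ.filter fun v => F.par v ≠ none).card : ℝ) ≤ (1 - ν) * r * d * n ^ 2 →
            ∃ φ : N → W, (∀ v v', F.bd v = F.bd v' → φ v = φ v' → v = v') ∧
              (∀ v u, F.par v = some u → G.Adj (φ v) (φ u)) ∧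
              (∀ v u v' u', F.par v = some u → F.par v' = some u' → s(φ v, φ u) = s(φ v', φ u') → v = v') ∧
              (∀ u ∈ U, (Finset.univ.filter fun v => φ v = u).card ≤ M))
    {ι : Type} [Fintype ι] (m : ι → ℕ) (T : ∀ i, SimpleGraph (Fin (m i))) (hT : ∀ i, (T i).IsTree)
    (hm2 : ∀ i, 2 ≤ m i) (hm : ∀ i, (m i : ℝ) ≤ 2 * (1 - ν) * r * n) (hdeg : ∀ i v, deg (T i) v ≤ Δ)
    (hE : ((∑ i, ((T i).edgeSet.ncard) : ℕ) : ℝ) ≤ (1 - ν) * r * d * n ^ 2) :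
    ∃ φ : ∀ i, Fin (m i) → W,
              (∀ i, Function.Injective (φ i)) ∧
              (∀ i a b, (T i).Adj a b → G.Adj (φ i a) (φ i b)) ∧
              (∀ i j, i ≠ j → ∀ e ∈ (T i).edgeSet, ∀ f ∈ (T j).edgeSet,
                Sym2.map (φ i) e ≠ Sym2.map (φ j) f) ∧
              (∀ u ∈ U,
                (({e : Sym2 W | u ∈ e ∧
                    ∃ i, ∃ f ∈ (T i).edgeSet, e = Sym2.map (φ i) f}.ncard : ℝ)
                  ≤ (Δ : ℝ) * M)) := by
  have hν : 0 < 1 - ν := by linarith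
  have hrR : (0:ℝ) < r := by exact_mod_cast hr
  have hnR : (0:ℝ) < n := by exact_mod_cast hn
  choose p dp t1 t2 t3 t4 t5 t6 using fun i => tree_root (T i) (hT i)
  obtain ⟨t, bd, b1, b2⟩ := bins_count m (2 * (1 - ν) * r * n) (by positivity) hm
  have hp : ∀ (v u : (i : ι) × Fin (m i)), (p v.1 v.2).map (fun b => (⟨v.1, b⟩ : (i : ι) × Fin (m i))) = some u ↔
      ∃ b, p v.1 v.2 = some b ∧ u = ⟨v.1, b⟩ := by
    intro v u
    rw [Option.map_eq_some_iff]
    constructor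
    · rintro ⟨b, h, rfl⟩; exact ⟨b, h, rfl⟩
    · rintro ⟨b, h, rfl⟩; exact ⟨b, h, rfl⟩
  let F : Forest ((i : ι) × Fin (m i)) t Δ :=
    { par := fun v => (p v.1 v.2).map (fun b => ⟨v.1, b⟩)
      dep := fun v => dp v.1 v.2
      bd := fun v => bd v.1
      dep_some := by
        intro v u h
        obtain ⟨b, hb, rfl⟩ := (hp v u).1 h
        exact t1 _ _ _ hb
      dep_none := by
        intro v h
        rw [Option.map_eq_none_iff] at h
        exact t2 _ _ h
      bd_par := by
        intro v u h
        obtain ⟨b, hb, rfl⟩ := (hp v u).1 h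
        rfl
      child_le := by
        rintro ⟨i, u⟩
        refine le_trans ?_ (hdeg i u)
        unfold deg
        rw [Set.ncard_eq_toFinset_card']
        rw [← Finset.card_map (Function.Embedding.sigmaMk (β := fun i => Fin (m i)) i)]
        apply Finset.card_le_card
        rintro v hv
        simp only [Finset.mem_filter] at hv
        obtain ⟨b, hb, h⟩ := (hp v ⟨i, u⟩).1 hv.2
        obtain ⟨j, v⟩ := v
        cases h
        rw [Finset.mem_map]
        refine ⟨v, ?_, rfl⟩
        rw [Set.mem_toFinset]
        exact (t3 _ _ _ hb).symm }
  have hFp : ∀ v u, F.par v = some u ↔ ∃ b, p v.1 v.2 = some b ∧ u = ⟨v.1, b⟩ := hp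
  have hpn : ∑ i, (Finset.univ.filter fun v => p i v ≠ none).card = ∑ i, (T i).edgeSet.ncard := by
    apply Finset.sum_congr rfl
    intro i _
    have := t5 i; have := t6 i; omega
  have hsum : ∑ i, m i ≤ 2 * ∑ i, (T i).edgeSet.ncard := by
    rw [Finset.mul_sum]
    apply Finset.sum_le_sum
    intro i _
    have := t6 i
    rw [Fintype.card_fin] at this
    have := hm2 i
    omega
  have hsumR : ((∑ i, m i : ℕ) : ℝ) ≤ 2 * ((1 - ν) * r * d * n ^ 2) := by
    have : ((∑ i, m i : ℕ) : ℝ) ≤ 2 * ((∑ i, (T i).edgeSet.ncard : ℕ) : ℝ) := by exact_mod_cast hsum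
    linarith
  have ht : (t:ℝ) ≤ 3 * n := by
    have h1 : ((t:ℝ) - 1) * ((1 - ν) * r * n) ≤ (2 * d * n) * ((1 - ν) * r * n) := by
      calc ((t:ℝ) - 1) * ((1 - ν) * r * n) = ((t:ℝ) - 1) * (2 * (1 - ν) * r * n / 2) := by ring
        _ ≤ _ := b2.trans hsumR
        _ = _ := by ring
    have h2 := le_of_mul_le_mul_right h1 (by positivity)
    have h3 : d * n ≤ 1 * n := by gcongr
    have h4 : (1:ℝ) ≤ n := by exact_mod_cast hn
    linarith
  obtain ⟨φ, f1, f2, f3, f4⟩ := hcore _ t F ht (by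
      intro b
      refine le_trans ?_ (b1 b)
      have : (Finset.univ.filter fun v => F.bd v = b) =
          (Finset.univ.filter fun i => bd i = b).sigma (fun i => (Finset.univ : Finset (Fin (m i)))) := by
        ext v
        simp [F]
      rw [this, Finset.card_sigma]
      simp) (by
      refine le_trans ?_ hE
      rw [← hpn]
      have : (Finset.univ.filter fun v => F.par v ≠ none) =
          (Finset.univ : Finset ι).sigma (fun i => Finset.univ.filter fun v => p i v ≠ none) := by
        ext v
        simp [F]
      rw [this, Finset.card_sigma])
  -- each tree edge comes from a child
  have hedge : ∀ i, ∀ e ∈ (T i).edgeSet, ∃ v u : (i : ι) × Fin (m i), v.1 = i ∧ F.par v = some u ∧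
      Sym2.map (fun a => φ ⟨i, a⟩) e = s(φ v, φ u) := by
    intro i e he
    induction e using Sym2.ind with
    | _ a b =>
      rw [SimpleGraph.mem_edgeSet] at he
      rcases t4 i a b he with h | h
      · exact ⟨⟨i, a⟩, ⟨i, b⟩, rfl, (hFp _ _).2 ⟨b, h, rfl⟩, by simp⟩
      · exact ⟨⟨i, b⟩, ⟨i, a⟩, rfl, (hFp _ _).2 ⟨a, h, rfl⟩, by simp [Sym2.eq_swap]⟩
  refine ⟨fun i a => φ ⟨i, a⟩, ?_, ?_, ?_, ?_⟩
  · intro i a b h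
    have := f1 ⟨i, a⟩ ⟨i, b⟩ rfl h
    simpa using this
  · intro i a b hab
    rcases t4 i a b hab with h | h
    · exact f2 ⟨i, a⟩ ⟨i, b⟩ ((hFp _ _).2 ⟨b, h, rfl⟩)
    · exact (f2 ⟨i, b⟩ ⟨i, a⟩ ((hFp _ _).2 ⟨a, h, rfl⟩)).symm
  · intro i j hij e he f hf h
    obtain ⟨v, u, rfl, h2, h3⟩ := hedge i e he
    obtain ⟨v', u', rfl, h2', h3'⟩ := hedge j f hf
    rw [h3, h3'] at h
    exact hij (congrArg Sigma.fst (f3 _ _ _ _ h2 h2' h))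
  · intro u hu
    have hsub : {e : Sym2 W | u ∈ e ∧ ∃ i, ∃ f ∈ (T i).edgeSet, e = Sym2.map (fun a => φ ⟨i, a⟩) f} ⊆
        (((Finset.univ.filter fun v => φ v = u).biUnion fun v =>
          ((T v.1).neighborSet v.2).toFinset.image (fun b => s(u, φ ⟨v.1, b⟩)) : Finset (Sym2 W)) : Set (Sym2 W)) := by
      rintro e ⟨hue, i, f, hf, rfl⟩
      induction f using Sym2.ind with
      | _ a b =>
        rw [SimpleGraph.mem_edgeSet] at hf
        rw [Sym2.map_mk, Sym2.mem_iff] at hue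
        rw [Finset.mem_coe, Finset.mem_biUnion]
        rcases hue with h | h
        · refine ⟨⟨i, a⟩, by simp [h], ?_⟩
          rw [Finset.mem_image]
          refine ⟨b, by simpa using hf, ?_⟩
          rw [Sym2.map_mk, h]
        · refine ⟨⟨i, b⟩, by simp [h], ?_⟩
          rw [Finset.mem_image]
          refine ⟨a, by simpa using hf.symm, ?_⟩
          rw [Sym2.map_mk, h, Sym2.eq_swap]
    have h1 := Set.ncard_le_ncard hsub (Finset.finite_toSet _)
    rw [Set.ncard_coe_finset] at h1
    have h2 : ((Finset.univ.filter fun v => φ v = u).biUnion fun v =>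
          ((T v.1).neighborSet v.2).toFinset.image (fun b => s(u, φ ⟨v.1, b⟩))).card ≤
          (Finset.univ.filter fun v => φ v = u).card * Δ := by
      apply Finset.card_biUnion_le_card_mul
      intro v _
      refine Finset.card_image_le.trans ?_
      have := hdeg v.1 v.2
      unfold deg at this
      rwa [Set.ncard_eq_toFinset_card'] at this
    have h3 := Nat.mul_le_mul_right Δ (f4 u hu)
    have h4 := h1.trans (h2.trans h3)
    rw [mul_comm] at h4
    exact_mod_cast h4

end

set_option maxHeartbeats 1000000 in
theorem embed_one
    (ν : ℝ) (Δ : ℕ) (hν0 : 0 < ν) (hν1 : ν < 1) (hΔ : 1 ≤ Δ) :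
    ∃ d₀ : ℝ, 0 < d₀ ∧
      ∀ d : ℝ, 0 < d → d ≤ d₀ →
      ∃ (r₀ : ℕ) (ε₀ : ℝ), 0 < ε₀ ∧
        ∀ (r : ℕ) (ε : ℝ), r₀ ≤ r → 0 < ε → ε ≤ ε₀ →
        ∃ M₀ : ℕ, ∀ M : ℕ, M₀ ≤ M →
        ∃ n₀ : ℕ, ∀ n : ℕ, n₀ ≤ n →
        ∀ (W : Type) (G : SimpleGraph W) (U V : Finset W)
          (Us Vs : Fin r → Fin 2 → Finset W),
          -- U ∪ V is a vertex partition of G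
          Disjoint U V → (∀ w : W, w ∈ U ∨ w ∈ V) →
          -- the U_{s,i} partition U
          (∀ s i, Us s i ⊆ U) →
          (∀ (s : Fin r) (i : Fin 2) (s' : Fin r) (i' : Fin 2),
            (s, i) ≠ (s', i') → Disjoint (Us s i) (Us s' i')) →
          (∀ u ∈ U, ∃ s i, u ∈ Us s i) →
          -- the V_{s,i} partition V
          (∀ s i, Vs s i ⊆ V) →
          (∀ (s : Fin r) (i : Fin 2) (s' : Fin r) (i' : Fin 2),
            (s, i) ≠ (s', i') → Disjoint (Vs s i) (Vs s' i')) →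
          (∀ v ∈ V, ∃ s i, v ∈ Vs s i) →
          -- (A1)
          (∀ s : Fin r,
            IsSuperRegularPair G (Vs s 0) (Vs s 1) ε d ∧
            IsSuperRegularPair G (Us s 0) (Us s 1) ε d ∧
            IsSuperRegularPair G (Us s 0) (Vs s 1) ε d ∧
            IsSuperRegularPair G (Vs s 0) (Us s 1) ε d) →
          (∀ s i, (Vs s i).card = n) →
          (∀ (s : Fin r) (i : Fin 2), ε * n ≤ ((Us s i).card : ℝ)) →
          -- (A2)
          ((biIndep (SimpleGraph.induce (↑U : Set W) G) : ℝ) ≤ (n : ℝ) / (M : ℝ) ^ 6) →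
          -- the collection of trees
          ∀ (τ : ℕ) (m : Fin τ → ℕ) (T : ∀ i, SimpleGraph (Fin (m i))),
            (∀ i, (T i).IsTree) →
            (∀ i, (m i : ℝ) ≤ 2 * (1 - ν) * r * n) →
            (∀ i v, deg (T i) v ≤ Δ) →
            -- (A3)
            ((∑ i, ((T i).edgeSet.ncard) : ℝ) ≤ (1 - ν) * r * d * n ^ 2) →
            ∃ φ : ∀ i, Fin (m i) → W,
              (∀ i, Function.Injective (φ i)) ∧
              (∀ i a b, (T i).Adj a b → G.Adj (φ i a) (φ i b)) ∧
              (∀ i j, i ≠ j → ∀ e ∈ (T i).edgeSet, ∀ f ∈ (T j).edgeSet,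
                Sym2.map (φ i) e ≠ Sym2.map (φ j) f) ∧
              -- every vertex of U lies in at most Δ M edges used by the packing
              (∀ u ∈ U,
                (({e : Sym2 W | u ∈ e ∧
                    ∃ i, ∃ f ∈ (T i).edgeSet, e = Sym2.map (φ i) f}.ncard : ℝ)
                  ≤ (Δ : ℝ) * M)) := by
  refine ⟨1, one_pos, fun d hd0 hd1 => ?_⟩
  obtain ⟨ε₀, hε₀, H⟩ := core_main ν Δ hν0 hν1 hΔ d hd0 hd1
  refine ⟨1, ε₀, hε₀, fun r ε hr hε hεε => ?_⟩
  obtain ⟨M₀, H⟩ := H r ε hr hε hεε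
  refine ⟨M₀, fun M hM => ?_⟩
  obtain ⟨n₀, hn₀, H⟩ := H M hM
  refine ⟨n₀, ?_⟩
  intro n hn W G U V Us Vs hUV _ hUs _ _ hVs hVd _ hA1 hVc hUc hA2 τ m T hT hm hdeg hE
  have hnpos : 0 < n := lt_of_lt_of_le hn₀ hn
  have hW : Nonempty W := by
    have : (Vs ⟨0, hr⟩ 0).Nonempty := by
      rw [← Finset.card_pos, hVc]; exact hnpos
    obtain ⟨x, _⟩ := this
    exact ⟨x⟩
  have hcore := H n hn W G U V Us Vs hW hUV hUs hVs hVd hVc hUc (by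
      intro s o o' h
      obtain ⟨a1, a2, a3, a4⟩ := hA1 s
      fin_cases o <;> fin_cases o'
      · exact absurd rfl h
      · exact a1.1
      · exact a1.1.symm
      · exact absurd rfl h) (by
      intro s o o' h
      obtain ⟨a1, a2, a3, a4⟩ := hA1 s
      fin_cases o <;> fin_cases o'
      · exact absurd rfl h
      · exact a4.1
      · exact a3.1.symm
      · exact absurd rfl h) hA2
  classical
  have hE' : ((∑ i : {i // 2 ≤ m i}, (T i.1).edgeSet.ncard : ℕ) : ℝ) ≤ (1 - ν) * r * d * n ^ 2 := by
    refine le_trans ?_ hE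
    have : (∑ i : {i // 2 ≤ m i}, (T i.1).edgeSet.ncard) ≤ ∑ i, (T i).edgeSet.ncard := by
      have h1 : (∑ i : {i // 2 ≤ m i}, (T i.1).edgeSet.ncard) =
          ∑ i ∈ Finset.univ.filter (fun i => 2 ≤ m i), (T i).edgeSet.ncard :=
        (Finset.sum_subtype _ (by simp) (fun i => (T i).edgeSet.ncard)).symm
      rw [h1]
      exact Finset.sum_le_sum_of_subset (Finset.filter_subset _ _)
    exact_mod_cast this
  obtain ⟨φ, g1, g2, g3, g4⟩ := pack_big ν d Δ r n M hν1 hd0 hd1 hr hnpos W G U hcore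
    (fun i : {i // 2 ≤ m i} => m i.1) (fun i => T i.1) (fun i => hT i.1) (fun i => i.2) (fun i => hm i.1)
    (fun i => hdeg i.1) hE'
  obtain ⟨x⟩ := hW
  have hno : ∀ i, ¬ 2 ≤ m i → Subsingleton (Fin (m i)) := by
    intro i hi
    rw [Fin.subsingleton_iff_le_one]
    omega
  have hbig : ∀ i, ∀ e ∈ (T i).edgeSet, 2 ≤ m i := by
    intro i e he
    by_contra hi
    have := hno i hi
    induction e using Sym2.ind with
    | _ a b =>
      rw [SimpleGraph.mem_edgeSet] at he
      exact he.ne (Subsingleton.elim _ _)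
  obtain ⟨ψ, hψ⟩ : ∃ ψ : ∀ i, Fin (m i) → W, ∀ i (h : 2 ≤ m i), ψ i = φ ⟨i, h⟩ :=
    ⟨fun i => if h : 2 ≤ m i then φ ⟨i, h⟩ else fun _ => x, fun i h => by simp [h]⟩
  refine ⟨ψ, ?_, ?_, ?_, ?_⟩
  · intro i
    by_cases h : 2 ≤ m i
    · rw [hψ i h]; exact g1 ⟨i, h⟩
    · have := hno i h
      exact Function.injective_of_subsingleton _
  · intro i a b hab
    have h := hbig i s(a, b) hab
    rw [hψ i h]
    exact g2 ⟨i, h⟩ a b hab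
  · intro i j hij e he f hf
    have h := hbig i e he
    have h' := hbig j f hf
    rw [hψ i h, hψ j h']
    exact g3 ⟨i, h⟩ ⟨j, h'⟩ (fun hh => hij (congrArg Subtype.val hh)) e he f hf
  · intro u hu
    have := g4 u hu
    convert this using 4
    ext e
    constructor
    · rintro ⟨h1, i, f, hf, rfl⟩
      have h := hbig i f hf
      refine ⟨h1, ⟨i, h⟩, f, hf, ?_⟩
      rw [hψ i h]
    · rintro ⟨h1, ⟨i, h⟩, f, hf, rfl⟩
      refine ⟨h1, i, f, hf, ?_⟩
      rw [hψ i h]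

end ApproxDecomp
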